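/- arXiv:1112.4954 — 3 statements merged into one kernel-verified Lean document; each statement's English description precedes it below -/
import Mathlib

section
/- Every admissible subset B of Ψ⁺ lies in the W(B_n)-orbit of Z_t for some t with 0 ≤ t < (n+1)/2, or of Z̃_t for some t with 1 ≤ t < (n+1)/2, or of Z̄_t for some t with 1 ≤ t ≤ (n+1)/2; i.e., there exist w ∈ W(B_n) and t such that w·B equals one of Z_t, Z̃_t, Z̄_t. -/
open scoped RealInnerProductSpace

/-- The standard basis vector `ε_i` of `ℝ^{n+1}` (here `ε_1, …, ε_{n+1}` of the paper
are indexed by `0, …, n`). -/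
noncomputable def εv (n : ℕ) (i : Fin (n + 1)) : EuclideanSpace ℝ (Fin (n + 1)) :=
  EuclideanSpace.single i (1 : ℝ)

/-- The positive roots `Ψ⁺` of type `B_n`: `ε_j ± ε_i` for `1 ≤ i < j ≤ n` (long)
and `ε_j` for `1 ≤ j ≤ n` (short). -/
def PsiPos (n : ℕ) : Set (EuclideanSpace ℝ (Fin (n + 1))) :=
  {v | ∃ i j : Fin (n + 1), 0 < i.val ∧ i < j ∧ (v = εv n j - εv n i ∨ v = εv n j + εv n i)} ∪
  {v | ∃ j : Fin (n + 1), 0 < j.val ∧ v = εv n j}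

/-- The positive roots `Φ⁺` of type `D_{n+1}`: `ε_j ± ε_i` for `0 ≤ i < j ≤ n`. -/
def PhiPos (n : ℕ) : Set (EuclideanSpace ℝ (Fin (n + 1))) :=
  {v | ∃ i j : Fin (n + 1), i < j ∧ (v = εv n j - εv n i ∨ v = εv n j + εv n i)}

/-- `α` and `α'` are orthogonal mates in `Φ⁺`: `{α, α'} = {ε_j − ε_i, ε_j + ε_i}`. -/
def DMateRel (n : ℕ) (α α' : EuclideanSpace ℝ (Fin (n + 1))) : Prop :=
  ∃ i j : Fin (n + 1), i < j ∧
    ((α = εv n j - εv n i ∧ α' = εv n j + εv n i) ∨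
     (α = εv n j + εv n i ∧ α' = εv n j - εv n i))

/-- The orthogonal projection `p(x) = x − (x, ε_1)·ε_1`. -/
noncomputable def projP (n : ℕ) (x : EuclideanSpace ℝ (Fin (n + 1))) :
    EuclideanSpace ℝ (Fin (n + 1)) :=
  x - ⟪x, εv n 0⟫ • εv n 0

/-- A set of vectors is mutually orthogonal if distinct members have zero inner product. -/
def MutOrth (n : ℕ) (S : Set (EuclideanSpace ℝ (Fin (n + 1)))) : Prop :=
  ∀ a ∈ S, ∀ b ∈ S, a ≠ b → ⟪a, b⟫ = 0

/-- The set `A = {α ∈ Φ⁺ : p(α) ∈ B}`. -/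
noncomputable def liftSet (n : ℕ) (B : Set (EuclideanSpace ℝ (Fin (n + 1)))) :
    Set (EuclideanSpace ℝ (Fin (n + 1))) :=
  {α | α ∈ PhiPos n ∧ projP n α ∈ B}

/-- A subset `B ⊆ Ψ⁺` of mutually orthogonal roots is admissible if
`A = {α ∈ Φ⁺ : p(α) ∈ B}` consists of mutually orthogonal roots and either no member
of `A` has its orthogonal mate in `A`, or every member of `A` has its mate in `A`. -/
noncomputable def AdmissibleB (n : ℕ) (B : Set (EuclideanSpace ℝ (Fin (n + 1)))) : Prop :=
  B ⊆ PsiPos n ∧ MutOrth n B ∧ MutOrth n (liftSet n B) ∧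
  ((¬ ∃ α ∈ liftSet n B, ∃ α' ∈ liftSet n B, DMateRel n α α') ∨
   (∀ α ∈ liftSet n B, ∃ α' ∈ liftSet n B, DMateRel n α α'))

/-- The Weyl group `W(B_n)`: linear isometries of `ℝ^{n+1}` fixing `ε_1` and permuting
`{±ε_2, …, ±ε_{n+1}}`. -/
def WgrpB (n : ℕ) :
    Set (EuclideanSpace ℝ (Fin (n + 1)) ≃ₗᵢ[ℝ] EuclideanSpace ℝ (Fin (n + 1))) :=
  {w | w (εv n 0) = εv n 0 ∧
    ∀ i : Fin (n + 1), 0 < i.val → ∃ j : Fin (n + 1), 0 < j.val ∧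
      (w (εv n i) = εv n j ∨ w (εv n i) = - εv n j)}

/-- The action of `w ∈ W(B_n)` on subsets of `Ψ⁺`:
`w·X = {β ∈ Ψ⁺ : β ∈ w(X) or −β ∈ w(X)}`. -/
def actWB (n : ℕ) (w : EuclideanSpace ℝ (Fin (n + 1)) ≃ₗᵢ[ℝ] EuclideanSpace ℝ (Fin (n + 1)))
    (X : Set (EuclideanSpace ℝ (Fin (n + 1)))) : Set (EuclideanSpace ℝ (Fin (n + 1))) :=
  {β | β ∈ PsiPos n ∧ (β ∈ ⇑w '' X ∨ -β ∈ ⇑w '' X)}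

/-- The simple roots of type `B_n`: `β 0 = ε_2` and `β i = ε_{i+2} − ε_{i+1}` for
`1 ≤ i ≤ n-1` (junk value `0` out of range). -/
noncomputable def βB (n : ℕ) (i : ℕ) : EuclideanSpace ℝ (Fin (n + 1)) :=
  if i = 0 then εv n 1
  else if h : i + 1 ≤ n then εv n ⟨i + 1, by omega⟩ - εv n ⟨i, by omega⟩ else 0

/-- The orthogonal mates `β_i* = ε_{i+2} + ε_{i+1}` of the long simple roots
(junk value `0` out of range). -/
noncomputable def βstarB (n : ℕ) (i : ℕ) : EuclideanSpace ℝ (Fin (n + 1)) :=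
  if h : 1 ≤ i ∧ i + 1 ≤ n then εv n ⟨i + 1, by omega⟩ + εv n ⟨i, by omega⟩ else 0

/-- `Z_t = {β_{n-1-2i} : 0 ≤ i < t}`. -/
noncomputable def Zset (n t : ℕ) : Set (EuclideanSpace ℝ (Fin (n + 1))) :=
  {β | ∃ k : ℕ, k < t ∧ β = βB n (n - 1 - 2 * k)}

/-- `Z̃_t = {β_{n-1-2i}, β*_{n-1-2i} : 0 ≤ i < t}`. -/
noncomputable def Ztil (n t : ℕ) : Set (EuclideanSpace ℝ (Fin (n + 1))) :=
  {β | ∃ k : ℕ, k < t ∧ (β = βB n (n - 1 - 2 * k) ∨ β = βstarB n (n - 1 - 2 * k))}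

/-- `Z̄_t = {β_{n-1-2i}, β*_{n-1-2i} : 0 ≤ i < t-1} ∪ {β₀}`. -/
noncomputable def Zbar (n t : ℕ) : Set (EuclideanSpace ℝ (Fin (n + 1))) :=
  {β | ∃ k : ℕ, k + 1 < t ∧ (β = βB n (n - 1 - 2 * k) ∨ β = βstarB n (n - 1 - 2 * k))} ∪
    {βB n 0}

theorem inner_εv (n : ℕ) (i j : Fin (n + 1)) :
    ⟪εv n i, εv n j⟫ = if i = j then (1 : ℝ) else 0 := by
  simp [εv, EuclideanSpace.inner_single_left]

/-- The root `ε_j + c ε_i`. -/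
noncomputable def longRoot (n : ℕ) (c : ℝ) (i j : Fin (n + 1)) :
    EuclideanSpace ℝ (Fin (n + 1)) :=
  εv n j + c • εv n i

theorem longRoot_neg_one (n : ℕ) (i j : Fin (n + 1)) :
    longRoot n (-1) i j = εv n j - εv n i := by
  simp [longRoot, sub_eq_add_neg]

theorem longRoot_one (n : ℕ) (i j : Fin (n + 1)) :
    longRoot n 1 i j = εv n j + εv n i := by
  simp [longRoot]

theorem inner_longRoot (n : ℕ) (c d : ℝ) (i j k l : Fin (n + 1)) :
    ⟪longRoot n c i j, longRoot n d k l⟫ =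
      (if j = l then 1 else 0) + d * (if j = k then 1 else 0) +
        (c * (if i = l then 1 else 0) + c * d * (if i = k then 1 else 0)) := by
  simp only [longRoot, inner_add_left, inner_add_right, real_inner_smul_left,
    real_inner_smul_right, inner_εv]
  ring

theorem inner_εv_longRoot (n : ℕ) (c : ℝ) (i j k : Fin (n + 1)) :
    ⟪εv n k, longRoot n c i j⟫ =
      (if k = j then 1 else 0) + c * (if k = i then 1 else 0) := by
  simp only [longRoot, inner_add_right, real_inner_smul_right, inner_εv]

theorem longRoot_injective {n : ℕ} {c d : ℝ} {i j k l : Fin (n + 1)}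
    (hc : c = 1 ∨ c = -1) (hij : i < j) (hkl : k < l)
    (h : longRoot n c i j = longRoot n d k l) : i = k ∧ j = l ∧ c = d := by
  have key (m : Fin (n + 1)) : ((if m = j then 1 else 0) + c * (if m = i then 1 else 0) : ℝ) =
      (if m = l then 1 else 0) + d * (if m = k then 1 else 0) := by
    rw [← inner_εv_longRoot, ← inner_εv_longRoot, h]
  have h1 := key i
  have h2 := key j
  have h3 := key k
  have h4 := key l
  grind

theorem share_index_eq {n : ℕ} {B : Set (EuclideanSpace ℝ (Fin (n + 1)))} (hB : MutOrth n B)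
    {c d : ℝ} {i j k l : Fin (n + 1)} (hc : c = 1 ∨ c = -1) (hd : d = 1 ∨ d = -1)
    (hij : i < j) (hkl : k < l) (h1 : longRoot n c i j ∈ B) (h2 : longRoot n d k l ∈ B)
    (h : i = k ∨ i = l ∨ j = k ∨ j = l) : i = k ∧ j = l := by
  by_cases he : longRoot n c i j = longRoot n d k l
  · have := longRoot_injective hc hij hkl he
    exact ⟨this.1, this.2.1⟩
  · have := hB _ h1 _ h2 he
    rw [inner_longRoot] at this
    grind

theorem short_disjoint_long {n : ℕ} {B : Set (EuclideanSpace ℝ (Fin (n + 1)))}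
    (hB : MutOrth n B) {c : ℝ} {i j k : Fin (n + 1)} (hc : c = 1 ∨ c = -1)
    (hij : i < j) (h1 : longRoot n c i j ∈ B) (h2 : εv n k ∈ B) : k ≠ i ∧ k ≠ j := by
  have hne : εv n k ≠ longRoot n c i j := by
    intro he
    have h3 : ⟪εv n i, εv n k⟫ = ⟪εv n i, longRoot n c i j⟫ := by rw [he]
    have h4 : ⟪εv n j, εv n k⟫ = ⟪εv n j, longRoot n c i j⟫ := by rw [he]
    rw [inner_εv, inner_εv_longRoot] at h3 h4
    grind
  have := hB _ h2 _ h1 hne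
  rw [inner_εv_longRoot] at this
  grind

theorem exists_perm_extending {α β : Type*} [Finite β] {f g : α → β}
    (hf : Function.Injective f) (hg : Function.Injective g) :
    ∃ σ : Equiv.Perm β, ∀ a, σ (f a) = g a := by
  classical
  cases nonempty_fintype β
  let e : {x // x ∈ Set.range f} ≃ {x // x ∈ Set.range g} :=
    (Equiv.ofInjective f hf).symm.trans (Equiv.ofInjective g hg)
  refine ⟨e.extendSubtype, fun a => ?_⟩
  rw [Equiv.extendSubtype_apply_of_mem e (f a) ⟨a, rfl⟩]
  simp [e, Equiv.ofInjective_symm_apply hf a]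

/-- A disjoint family of pairs and at most one further index can be moved by a permutation
fixing `0` to the standard position: the pairs at the end, the further index at `1`. -/
theorem exists_perm_standard {n : ℕ} (P : Finset (Fin (n + 1) × Fin (n + 1)))
    (S : Finset (Fin (n + 1))) (hP : ∀ p ∈ P, 0 < p.1 ∧ p.1 < p.2)
    (hdisj : ∀ p ∈ P, ∀ q ∈ P,
      (p.1 = q.1 ∨ p.1 = q.2 ∨ p.2 = q.1 ∨ p.2 = q.2) → p = q)
    (hS : ∀ m ∈ S, 0 < m) (hS1 : S.card ≤ 1)
    (hSP : ∀ m ∈ S, ∀ p ∈ P, m ≠ p.1 ∧ m ≠ p.2) :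
    2 * P.card + S.card ≤ n ∧ ∃ (σ : Equiv.Perm (Fin (n + 1))) (e : P ≃ Fin P.card),
      σ 0 = 0 ∧ (∀ m ∈ S, (σ m).val = 1) ∧
      ∀ p : P, (σ p.1.2).val = n - 2 * (e p).val ∧ (σ p.1.1).val = n - 1 - 2 * (e p).val := by
  classical
  let f : Option S ⊕ (P ⊕ P) → Fin (n + 1) :=
    Sum.elim (fun o => o.elim 0 (fun m => m.1)) (Sum.elim (fun p => p.1.1) (fun p => p.1.2))
  have hf : Function.Injective f := by
    rintro ((_ | ⟨m, hm⟩) | (⟨p, hp⟩ | ⟨p, hp⟩)) ((_ | ⟨m', hm'⟩) | (⟨q, hq⟩ | ⟨q, hq⟩)) h <;>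
      simp only [f, Sum.elim_inl, Sum.elim_inr, Option.elim_none, Option.elim_some] at h <;>
      grind
  have hcard : 2 * P.card + S.card ≤ n := by
    have := Fintype.card_le_of_injective f hf
    simp at this
    omega
  refine ⟨hcard, ?_⟩
  let e : P ≃ Fin P.card := P.equivFin
  let g : Option S ⊕ (P ⊕ P) → Fin (n + 1) :=
    Sum.elim (fun o => o.elim 0 (fun _ => Fin.ofNat (n + 1) 1))
      (Sum.elim (fun p => ⟨n - 1 - 2 * (e p).val, by omega⟩)
        (fun p => ⟨n - 2 * (e p).val, by omega⟩))
  have hS0 (m) (hm : m ∈ S) : S.card = 1 := by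
    have := Finset.card_pos.2 ⟨m, hm⟩
    omega
  have hone (m) (hm : m ∈ S) : (1 % (n + 1)) = 1 := by
    have := hS0 m hm
    exact Nat.mod_eq_of_lt (by omega)
  have hg : Function.Injective g := by
    rintro ((_ | ⟨m, hm⟩) | (p | p)) ((_ | ⟨m', hm'⟩) | (q | q)) h <;>
      simp only [g, Sum.elim_inl, Sum.elim_inr, Option.elim_none, Option.elim_some,
        Fin.ext_iff, Fin.val_ofNat, Fin.val_zero] at h
    · rfl
    · have := hone m' hm'; omega
    · have := (e q).2; omega
    · have := (e q).2; omega
    · have := hone m hm; omega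
    · have := Finset.card_le_one.1 hS1 m hm m' hm'
      subst this; rfl
    · have := hone m hm; have := hS0 m hm; have := (e q).2; omega
    · have := hone m hm; have := hS0 m hm; have := (e q).2; omega
    · have := (e p).2; omega
    · have := hone m' hm'; have := hS0 m' hm'; have := (e p).2; omega
    · have := (e p).2; have := (e q).2
      have : e p = e q := Fin.ext (by omega)
      rw [e.injective this]
    · have := (e p).2; have := (e q).2; omega
    · have := (e p).2; omega
    · have := hone m' hm'; have := hS0 m' hm'; have := (e p).2; omega
    · have := (e p).2; have := (e q).2; omega
    · have := (e p).2; have := (e q).2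
      have : e p = e q := Fin.ext (by omega)
      rw [e.injective this]
  obtain ⟨σ, hσ⟩ := exists_perm_extending hf hg
  refine ⟨σ, e, hσ (Sum.inl none), fun m hm => ?_, fun p => ⟨?_, ?_⟩⟩
  · have := hσ (Sum.inl (some ⟨m, hm⟩))
    simp only [f, g, Sum.elim_inl, Option.elim_some] at this
    rw [this, Fin.val_ofNat, hone m hm]
  · exact congrArg Fin.val (hσ (Sum.inr (Sum.inr p)))
  · exact congrArg Fin.val (hσ (Sum.inr (Sum.inl p)))

theorem exists_signed_perm {n : ℕ} (σ : Equiv.Perm (Fin (n + 1))) (h0 : σ 0 = 0)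
    (s : Fin (n + 1) → Prop) (hs : ¬ s 0) :
    ∃ w ∈ WgrpB n, (∀ i, s i → w (εv n i) = -εv n (σ i)) ∧
      (∀ i, ¬ s i → w (εv n i) = εv n (σ i)) := by
  classical
  let w : EuclideanSpace ℝ (Fin (n + 1)) ≃ₗᵢ[ℝ] EuclideanSpace ℝ (Fin (n + 1)) :=
    (LinearIsometryEquiv.piLpCongrRight 2 (fun i =>
      if s i then LinearIsometryEquiv.neg ℝ (E := ℝ) else LinearIsometryEquiv.refl ℝ ℝ)).trans
      (LinearIsometryEquiv.piLpCongrLeft 2 ℝ ℝ σ)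
  have h1 (i) (hi : s i) : w (εv n i) = -εv n (σ i) := by
    simp only [w, εv, LinearIsometryEquiv.trans_apply,
      LinearIsometryEquiv.piLpCongrRight_single, EuclideanSpace.piLpCongrLeft_single, if_pos hi]
    ext j
    by_cases h : j = σ i <;> simp [h]
  have h2 (i) (hi : ¬ s i) : w (εv n i) = εv n (σ i) := by
    simp only [w, εv, LinearIsometryEquiv.trans_apply,
      LinearIsometryEquiv.piLpCongrRight_single, EuclideanSpace.piLpCongrLeft_single, if_neg hi]
    simp
  refine ⟨w, ⟨by rw [h2 0 hs, h0], fun i hi => ⟨σ i, ?_, ?_⟩⟩, h1, h2⟩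
  · rw [Nat.pos_iff_ne_zero]
    intro h
    have : σ i = σ 0 := by rw [h0]; exact Fin.ext h
    rw [σ.injective this] at hi
    simp at hi
  · by_cases hi : s i
    · exact Or.inr (h1 i hi)
    · exact Or.inl (h2 i hi)

theorem neg_notMem_PsiPos {n : ℕ} {v : EuclideanSpace ℝ (Fin (n + 1))} (hv : v ∈ PsiPos n) :
    -v ∉ PsiPos n := by
  let φ : EuclideanSpace ℝ (Fin (n + 1)) := WithLp.toLp 2 (fun i => (i.val : ℝ))
  have hφ (i) : ⟪φ, εv n i⟫ = (i.val : ℝ) := by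
    simp [φ, εv, EuclideanSpace.inner_single_right]
  have key {u} (hu : u ∈ PsiPos n) : 0 < ⟪φ, u⟫ := by
    rcases hu with ⟨i, j, hi, hij, rfl | rfl⟩ | ⟨j, hj, rfl⟩
    · rw [inner_sub_right, hφ, hφ, sub_pos]
      exact_mod_cast hij
    · rw [inner_add_right, hφ, hφ]
      positivity
    · rw [hφ]
      exact_mod_cast hj
  intro h
  have h1 := key hv
  have h2 := key h
  rw [inner_neg_right] at h2
  linarith

theorem actWB_eq {n : ℕ}
    {w : EuclideanSpace ℝ (Fin (n + 1)) ≃ₗᵢ[ℝ] EuclideanSpace ℝ (Fin (n + 1))}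
    {B Z : Set (EuclideanSpace ℝ (Fin (n + 1)))} (h : ⇑w '' B = Z) (hZ : Z ⊆ PsiPos n) :
    actWB n w B = Z := by
  ext β
  simp only [actWB, h, Set.mem_ofPred_eq]
  refine ⟨?_, fun hβ => ⟨hZ hβ, Or.inl hβ⟩⟩
  rintro ⟨hβ, h | h⟩
  · exact h
  · exact absurd (hZ h) (neg_notMem_PsiPos hβ)

theorem βB_eq {n k : ℕ} {a b : Fin (n + 1)} (hk : 2 * k + 2 ≤ n) (ha : a.val = n - 2 * k)
    (hb : b.val = n - 1 - 2 * k) : βB n (n - 1 - 2 * k) = εv n a - εv n b := by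
  rw [βB, if_neg (by omega), dif_pos (by omega)]
  congr 2 <;> apply Fin.ext <;> simp only [] <;> omega

theorem βstarB_eq {n k : ℕ} {a b : Fin (n + 1)} (hk : 2 * k + 2 ≤ n) (ha : a.val = n - 2 * k)
    (hb : b.val = n - 1 - 2 * k) : βstarB n (n - 1 - 2 * k) = εv n a + εv n b := by
  rw [βstarB, dif_pos (by omega)]
  congr 2 <;> apply Fin.ext <;> simp only [] <;> omega

theorem βB_mem_PsiPos {n k : ℕ} (hk : 2 * k + 2 ≤ n) : βB n (n - 1 - 2 * k) ∈ PsiPos n := by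
  refine Or.inl ⟨⟨n - 1 - 2 * k, by omega⟩, ⟨n - 2 * k, by omega⟩, ?_, ?_, Or.inl ?_⟩
  · simp only []; omega
  · rw [Fin.lt_def]; simp only []; omega
  · exact βB_eq hk rfl rfl

theorem βstarB_mem_PsiPos {n k : ℕ} (hk : 2 * k + 2 ≤ n) :
    βstarB n (n - 1 - 2 * k) ∈ PsiPos n := by
  refine Or.inl ⟨⟨n - 1 - 2 * k, by omega⟩, ⟨n - 2 * k, by omega⟩, ?_, ?_, Or.inr ?_⟩
  · simp only []; omega
  · rw [Fin.lt_def]; simp only []; omega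
  · exact βstarB_eq hk rfl rfl

theorem projP_longRoot_zero {n : ℕ} (c : ℝ) {j : Fin (n + 1)} (hj : 0 < j) :
    projP n (longRoot n c 0 j) = εv n j := by
  rw [projP, real_inner_comm, inner_εv_longRoot]
  simp [longRoot, hj.ne]

theorem projP_longRoot_of_pos {n : ℕ} (c : ℝ) {i j : Fin (n + 1)} (hi : 0 < i) (hij : i < j) :
    projP n (longRoot n c i j) = longRoot n c i j := by
  rw [projP, real_inner_comm, inner_εv_longRoot]
  simp [hi.ne, (hi.trans hij).ne]

theorem longRoot_mem_PhiPos {n : ℕ} {c : ℝ} (hc : c = 1 ∨ c = -1) {i j : Fin (n + 1)}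
    (hij : i < j) : longRoot n c i j ∈ PhiPos n := by
  refine ⟨i, j, hij, ?_⟩
  rcases hc with rfl | rfl
  · exact Or.inr (longRoot_one n i j)
  · exact Or.inl (longRoot_neg_one n i j)

theorem dMateRel_longRoot {n : ℕ} {i j : Fin (n + 1)} (hij : i < j) :
    DMateRel n (longRoot n (-1) i j) (longRoot n 1 i j) :=
  ⟨i, j, hij, Or.inl ⟨longRoot_neg_one n i j, longRoot_one n i j⟩⟩

theorem DMateRel.eq_longRoot {n : ℕ} {c : ℝ} (hc : c = 1 ∨ c = -1) {i j : Fin (n + 1)}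
    (hij : i < j) {α : EuclideanSpace ℝ (Fin (n + 1))} (h : DMateRel n (longRoot n c i j) α) :
    α = longRoot n (-c) i j := by
  obtain ⟨k, l, hkl, ⟨h1, rfl⟩ | ⟨h1, rfl⟩⟩ := h
  · rw [← longRoot_neg_one] at h1
    obtain ⟨rfl, rfl, rfl⟩ := longRoot_injective hc hij hkl h1
    rw [neg_neg, longRoot_one]
  · rw [← longRoot_one] at h1
    obtain ⟨rfl, rfl, rfl⟩ := longRoot_injective hc hij hkl h1
    rw [longRoot_neg_one]

theorem mem_PsiPos_iff {n : ℕ} {v : EuclideanSpace ℝ (Fin (n + 1))} :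
    v ∈ PsiPos n ↔ (∃ i j : Fin (n + 1), ∃ c : ℝ, (c = 1 ∨ c = -1) ∧ 0 < i ∧ i < j ∧
      v = longRoot n c i j) ∨ ∃ j : Fin (n + 1), 0 < j ∧ v = εv n j := by
  refine or_congr ⟨?_, ?_⟩ Iff.rfl
  · rintro ⟨i, j, hi, hij, rfl | rfl⟩
    · exact ⟨i, j, -1, Or.inr rfl, hi, hij, (longRoot_neg_one n i j).symm⟩
    · exact ⟨i, j, 1, Or.inl rfl, hi, hij, (longRoot_one n i j).symm⟩
  · rintro ⟨i, j, c, rfl | rfl, hi, hij, rfl⟩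
    · exact ⟨i, j, hi, hij, Or.inr (longRoot_one n i j)⟩
    · exact ⟨i, j, hi, hij, Or.inl (longRoot_neg_one n i j)⟩

/-- Every admissible subset `B` of `Ψ⁺` lies in the `W(B_n)`-orbit of `Z_t`
(`0 ≤ t < (n+1)/2`), of `Z̃_t` (`1 ≤ t < (n+1)/2`), or of `Z̄_t` (`1 ≤ t ≤ (n+1)/2`). -/
theorem statement_11 (n : ℕ) (hn : 2 ≤ n) (B : Set (EuclideanSpace ℝ (Fin (n + 1))))
    (hB : AdmissibleB n B) :
    ∃ w ∈ WgrpB n, ∃ t : ℕ,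
      (2 * t ≤ n ∧ actWB n w B = Zset n t) ∨
      (1 ≤ t ∧ 2 * t ≤ n ∧ actWB n w B = Ztil n t) ∨
      (1 ≤ t ∧ 2 * t ≤ n + 1 ∧ actWB n w B = Zbar n t) := by
  classical
  obtain ⟨hsub, horth, hlift, hmate⟩ := hB
  let P : Finset (Fin (n + 1) × Fin (n + 1)) := Finset.univ.filter fun p =>
    0 < p.1 ∧ p.1 < p.2 ∧ ∃ c : ℝ, (c = 1 ∨ c = -1) ∧ longRoot n c p.1 p.2 ∈ B
  let S : Finset (Fin (n + 1)) := Finset.univ.filter fun m => 0 < m ∧ εv n m ∈ B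
  have memP {i j} : (i, j) ∈ P ↔
      0 < i ∧ i < j ∧ ∃ c : ℝ, (c = 1 ∨ c = -1) ∧ longRoot n c i j ∈ B := by simp [P]
  have memS {m} : m ∈ S ↔ 0 < m ∧ εv n m ∈ B := by simp [S]
  have lift_short {m} (hm : m ∈ S) {c : ℝ} (hc : c = 1 ∨ c = -1) :
      longRoot n c 0 m ∈ liftSet n B := by
    rw [memS] at hm
    refine ⟨longRoot_mem_PhiPos hc hm.1, ?_⟩
    rw [projP_longRoot_zero c hm.1]
    exact hm.2
  have lift_long {i j} {c : ℝ} (hc : c = 1 ∨ c = -1) (hi : 0 < i) (hij : i < j) :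
      longRoot n c i j ∈ liftSet n B ↔ longRoot n c i j ∈ B := by
    simp only [liftSet, Set.mem_ofPred_eq, projP_longRoot_of_pos c hi hij,
      longRoot_mem_PhiPos hc hij, true_and]
  have hdisj : ∀ p ∈ P, ∀ q ∈ P,
      (p.1 = q.1 ∨ p.1 = q.2 ∨ p.2 = q.1 ∨ p.2 = q.2) → p = q := by
    rintro ⟨i, j⟩ hp ⟨k, l⟩ hq h
    obtain ⟨-, hij, c, hc, hcB⟩ := memP.1 hp
    obtain ⟨-, hkl, d, hd, hdB⟩ := memP.1 hq
    obtain ⟨rfl, rfl⟩ := share_index_eq horth hc hd hij hkl hcB hdB h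
    rfl
  have hS1 : S.card ≤ 1 := by
    refine Finset.card_le_one.2 fun a ha b hb => ?_
    exact (share_index_eq hlift (Or.inl rfl) (Or.inl rfl) (memS.1 ha).1 (memS.1 hb).1
      (lift_short ha (Or.inl rfl)) (lift_short hb (Or.inl rfl)) (Or.inl rfl)).2
  have hSP : ∀ m ∈ S, ∀ p ∈ P, m ≠ p.1 ∧ m ≠ p.2 := by
    rintro m hm ⟨i, j⟩ hp
    obtain ⟨-, hij, c, hc, hcB⟩ := memP.1 hp
    exact short_disjoint_long horth hc hij hcB (memS.1 hm).2
  obtain ⟨hcard, σ, e, hσ0, hσS, hσP⟩ := exists_perm_standard P S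
    (fun p hp => ⟨(memP.1 hp).1, (memP.1 hp).2.1⟩) hdisj (fun m hm => (memS.1 hm).1) hS1 hSP
  have hk (k : Fin P.card) : 2 * k.val + 2 ≤ n := by have := k.2; omega
  rcases hmate with hno | hall
  · have hSe : S = ∅ := by
      refine Finset.eq_empty_of_forall_notMem fun m hm => hno ?_
      exact ⟨_, lift_short hm (Or.inr rfl), _, lift_short hm (Or.inl rfl),
        dMateRel_longRoot (memS.1 hm).1⟩
    have hnot {i j} (hi : 0 < i) (hij : i < j) (h : longRoot n (-1) i j ∈ B) :
        longRoot n 1 i j ∉ B := fun h' => hno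
      ⟨_, (lift_long (Or.inr rfl) hi hij).2 h, _, (lift_long (Or.inl rfl) hi hij).2 h',
        dMateRel_longRoot hij⟩
    obtain ⟨w, hw, hw1, hw2⟩ := exists_signed_perm σ hσ0
      (fun i => 0 < i ∧ ∃ j, i < j ∧ longRoot n 1 i j ∈ B) (by simp)
    have hroot {i j} (hp : (i, j) ∈ P) {c : ℝ} (hc : c = 1 ∨ c = -1)
        (hcB : longRoot n c i j ∈ B) :
        w (longRoot n c i j) = βB n (n - 1 - 2 * (e ⟨(i, j), hp⟩).val) := by
      obtain ⟨hi, hij, -⟩ := memP.1 hp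
      rw [βB_eq (hk _) (hσP ⟨(i, j), hp⟩).1 (hσP ⟨(i, j), hp⟩).2]
      have hj : w (εv n j) = εv n (σ j) := by
        refine hw2 j ?_
        rintro ⟨-, l, hjl, hB'⟩
        have := share_index_eq horth hc (Or.inl rfl) hij hjl hcB hB' (Or.inr (Or.inr (Or.inl rfl)))
        exact hij.ne this.1
      rcases hc with rfl | rfl
      · rw [longRoot_one, map_add, hj, hw1 i ⟨hi, j, hij, hcB⟩, sub_eq_add_neg]
      · rw [longRoot_neg_one, map_sub, hj, hw2 i]
        rintro ⟨-, l, hil, hB'⟩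
        obtain ⟨-, rfl⟩ := share_index_eq horth (Or.inr rfl) (Or.inl rfl) hij hil hcB hB'
          (Or.inl rfl)
        exact hnot hi hij hcB hB'
    refine ⟨w, hw, P.card, Or.inl ⟨by omega, actWB_eq (Set.Subset.antisymm ?_ ?_) ?_⟩⟩
    · rintro _ ⟨b, hb, rfl⟩
      rcases mem_PsiPos_iff.1 (hsub hb) with ⟨i, j, c, hc, hi, hij, rfl⟩ | ⟨j, hj, rfl⟩
      · exact ⟨_, (e ⟨(i, j), memP.2 ⟨hi, hij, c, hc, hb⟩⟩).2, hroot _ hc hb⟩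
      · have : j ∈ S := memS.2 ⟨hj, hb⟩
        simp [hSe] at this
    · rintro _ ⟨k, hkt, rfl⟩
      obtain ⟨⟨⟨i, j⟩, hp⟩, hpk⟩ := e.surjective ⟨k, hkt⟩
      obtain ⟨-, -, c, hc, hcB⟩ := memP.1 hp
      refine ⟨_, hcB, ?_⟩
      rw [hroot hp hc hcB, hpk]
    · rintro _ ⟨k, hkt, rfl⟩
      exact βB_mem_PsiPos (hk ⟨k, hkt⟩)
  · have hboth {i j} (hp : (i, j) ∈ P) {d : ℝ} (hd : d = 1 ∨ d = -1) : longRoot n d i j ∈ B := by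
      obtain ⟨hi, hij, c, hc, hcB⟩ := memP.1 hp
      obtain ⟨α, hα, hm⟩ := hall _ ((lift_long hc hi hij).2 hcB)
      obtain rfl := hm.eq_longRoot hc hij
      have hc' : -c = 1 ∨ -c = -1 := by
        rcases hc with rfl | rfl
        · exact Or.inr rfl
        · exact Or.inl (neg_neg 1)
      have hneg := (lift_long hc' hi hij).1 hα
      have hdc : d = c ∨ d = -c := by grind
      rcases hdc with rfl | rfl
      · exact hcB
      · exact hneg
    obtain ⟨w, hw, -, hw2⟩ := exists_signed_perm σ hσ0 (fun _ => False) id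
    have hw3 (i) : w (εv n i) = εv n (σ i) := hw2 i id
    have hneg (p : P) : w (longRoot n (-1) p.1.1 p.1.2) = βB n (n - 1 - 2 * (e p).val) := by
      rw [βB_eq (hk _) (hσP p).1 (hσP p).2, longRoot_neg_one, map_sub, hw3, hw3]
    have hpos (p : P) : w (longRoot n 1 p.1.1 p.1.2) = βstarB n (n - 1 - 2 * (e p).val) := by
      rw [βstarB_eq (hk _) (hσP p).1 (hσP p).2, longRoot_one, map_add, hw3, hw3]
    have hlong {i j} {c : ℝ} (hc : c = 1 ∨ c = -1) (hi : 0 < i) (hij : i < j)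
        (hcB : longRoot n c i j ∈ B) : w (longRoot n c i j) ∈ Ztil n P.card := by
      have hp : (i, j) ∈ P := memP.2 ⟨hi, hij, c, hc, hcB⟩
      refine ⟨_, (e ⟨_, hp⟩).2, ?_⟩
      rcases hc with rfl | rfl
      · exact Or.inr (hpos ⟨_, hp⟩)
      · exact Or.inl (hneg ⟨_, hp⟩)
    have hsurj : Ztil n P.card ⊆ w '' B := by
      rintro _ ⟨k, hkt, h⟩
      obtain ⟨⟨⟨i, j⟩, hp⟩, hpk⟩ := e.surjective ⟨k, hkt⟩
      rcases h with rfl | rfl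
      · exact ⟨_, hboth hp (Or.inr rfl), by rw [hneg ⟨_, hp⟩, hpk]⟩
      · exact ⟨_, hboth hp (Or.inl rfl), by rw [hpos ⟨_, hp⟩, hpk]⟩
    have hZsub : Ztil n P.card ⊆ PsiPos n := by
      rintro _ ⟨k, hkt, rfl | rfl⟩
      · exact βB_mem_PsiPos (hk ⟨k, hkt⟩)
      · exact βstarB_mem_PsiPos (hk ⟨k, hkt⟩)
    rcases S.eq_empty_or_nonempty with hSe | ⟨m, hm⟩
    · have hact : actWB n w B = Ztil n P.card := by
        refine actWB_eq (Set.Subset.antisymm ?_ hsurj) hZsub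
        rintro _ ⟨b, hb, rfl⟩
        rcases mem_PsiPos_iff.1 (hsub hb) with ⟨i, j, c, hc, hi, hij, rfl⟩ | ⟨j, hj, rfl⟩
        · exact hlong hc hi hij hb
        · have : j ∈ S := memS.2 ⟨hj, hb⟩
          simp [hSe] at this
      refine ⟨w, hw, P.card, ?_⟩
      rcases Nat.eq_zero_or_pos P.card with h0 | h0
      · refine Or.inl ⟨by omega, ?_⟩
        rw [hact, h0]
        simp [Ztil, Zset]
      · exact Or.inr (Or.inl ⟨h0, by omega, hact⟩)
    · have hSc : 0 < S.card := Finset.card_pos.2 ⟨m, hm⟩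
      have hbar : Zbar n (P.card + 1) = Ztil n P.card ∪ {βB n 0} := by
        simp [Zbar, Ztil]
      have hshort {j} (hj : j ∈ S) : w (εv n j) = βB n 0 := by
        rw [hw3, βB, if_pos rfl]
        congr 1
        rw [Fin.ext_iff, hσS j hj, Fin.val_one', Nat.mod_eq_of_lt (by omega)]
      refine ⟨w, hw, P.card + 1, Or.inr (Or.inr ⟨by omega, by omega, ?_⟩)⟩
      rw [hbar]
      refine actWB_eq (Set.Subset.antisymm ?_ (Set.union_subset hsurj ?_))
        (Set.union_subset hZsub ?_)
      · rintro _ ⟨b, hb, rfl⟩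
        rcases mem_PsiPos_iff.1 (hsub hb) with ⟨i, j, c, hc, hi, hij, rfl⟩ | ⟨j, hj, rfl⟩
        · exact Or.inl (hlong hc hi hij hb)
        · exact Or.inr (hshort (memS.2 ⟨hj, hb⟩))
      · rintro _ rfl
        exact ⟨_, (memS.1 hm).2, hshort hm⟩
      · rintro _ rfl
        rw [βB, if_pos rfl]
        refine Or.inr ⟨1, ?_, rfl⟩
        rw [Fin.val_one', Nat.mod_eq_of_lt (by omega)]
        exact one_pos
end

section
/- For the W(B_n)-action on finite subsets of Ψ⁺: the orbit of Z_t (0 ≤ t < (n+1)/2) has cardinality 2^t·C(n,2t)·(2t−1)!!; the orbit of Z̄_t (1 ≤ t ≤ (n+1)/2) has cardinality n·C(n−1,2t−2)·(2t−3)!!; and the orbit of Z̃_t (1 ≤ t < (n+1)/2) has cardinality C(n,2t)·(2t−1)!!. Here C(a,b) denotes the binomial coefficient and (2k−1)!! = 1·3·5⋯(2k−1) with (−1)!! = 1. -/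
open scoped RealInnerProductSpace

/-- `doubleFactOdd k = (2k-1)!! = 1·3·5⋯(2k-1)`, with `doubleFactOdd 0 = 1`. -/
def doubleFactOdd : ℕ → ℕ
  | 0 => 1
  | (k + 1) => (2 * k + 1) * doubleFactOdd k

open Equiv.Perm in
theorem cycleType_eq_replicate_two {n : ℕ} {σ : Equiv.Perm (Fin n)} (hσ : ∀ p, σ (σ p) = p)
    {t : ℕ} (ht : σ.support.card = 2 * t) : σ.cycleType = Multiset.replicate t 2 := by
  have h2 : ∀ m ∈ σ.cycleType, m = 2 := fun m hm =>
    le_antisymm (Nat.le_of_dvd two_pos ((dvd_of_mem_cycleType hm).trans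
      (orderOf_dvd_of_pow_eq_one (by ext p; simp [pow_two, hσ])))) (two_le_of_mem_cycleType hm)
  have hr := Multiset.eq_replicate_card.2 h2
  have hs := sum_cycleType σ
  rw [hr, Multiset.sum_replicate, smul_eq_mul, ht] at hs
  rw [hr]
  congr 1
  omega

/-- The permutations of `Fin n` that are products of `t` disjoint transpositions. -/
def pairings (n t : ℕ) : Finset (Equiv.Perm (Fin n)) :=
  Finset.univ.filter fun σ => σ.cycleType = Multiset.replicate t 2

theorem mem_pairings {n t : ℕ} {σ : Equiv.Perm (Fin n)} :
    σ ∈ pairings n t ↔ σ.cycleType = Multiset.replicate t 2 := by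
  simp [pairings]

theorem pairings_apply_apply {n t : ℕ} {σ : Equiv.Perm (Fin n)} (hσ : σ ∈ pairings n t)
    (p : Fin n) : σ (σ p) = p := by
  have h : σ ^ 2 = 1 := by
    rw [← orderOf_dvd_iff_pow_eq_one, ← Equiv.Perm.lcm_cycleType, mem_pairings.1 hσ,
      Multiset.lcm_dvd]
    intro m hm
    rw [Multiset.eq_of_mem_replicate hm]
  simpa [pow_two] using DFunLike.congr_fun h p

theorem card_support_of_mem_pairings {n t : ℕ} {σ : Equiv.Perm (Fin n)}
    (hσ : σ ∈ pairings n t) : σ.support.card = 2 * t := by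
  rw [← Equiv.Perm.sum_cycleType, mem_pairings.1 hσ, Multiset.sum_replicate, smul_eq_mul, mul_comm]

theorem conj_mem_pairings {n t : ℕ} {σ : Equiv.Perm (Fin n)} (hσ : σ ∈ pairings n t)
    (τ : Equiv.Perm (Fin n)) : τ * σ * τ⁻¹ ∈ pairings n t := by
  rw [mem_pairings, Equiv.Perm.cycleType_conj, mem_pairings.1 hσ]

theorem exists_conj_of_mem_pairings {n t : ℕ} {σ σ' : Equiv.Perm (Fin n)}
    (hσ : σ ∈ pairings n t) (hσ' : σ' ∈ pairings n t) :
    ∃ τ : Equiv.Perm (Fin n), τ * σ * τ⁻¹ = σ' :=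
  isConj_iff.1 (Equiv.Perm.isConj_iff_cycleType_eq.2
    ((mem_pairings.1 hσ).trans (mem_pairings.1 hσ').symm))

/-- The larger elements of the two-element orbits of an involution. -/
def pairMaxima {n : ℕ} (σ : Equiv.Perm (Fin n)) : Finset (Fin n) :=
  Finset.univ.filter fun p => σ p < p

theorem mem_pairMaxima {n : ℕ} {σ : Equiv.Perm (Fin n)} {p : Fin n} :
    p ∈ pairMaxima σ ↔ σ p < p := by
  simp [pairMaxima]

theorem card_pairMaxima {n t : ℕ} {σ : Equiv.Perm (Fin n)} (hσ : σ ∈ pairings n t) :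
    (pairMaxima σ).card = t := by
  have hinv := pairings_apply_apply hσ
  have hs : σ.support = pairMaxima σ ∪ (pairMaxima σ).map σ.toEmbedding := by
    ext p
    simp only [Equiv.Perm.mem_support, Finset.mem_union, Finset.mem_map_equiv, mem_pairMaxima]
    rw [σ.symm_apply_eq.2 (hinv p).symm, hinv, ← lt_or_lt_iff_ne]
  have hd : Disjoint (pairMaxima σ) ((pairMaxima σ).map σ.toEmbedding) := by
    rw [Finset.disjoint_left]
    intro p hp hp'
    rw [Finset.mem_map_equiv, mem_pairMaxima, σ.symm_apply_eq.2 (hinv p).symm, hinv] at hp'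
    exact lt_asymm hp' (mem_pairMaxima.1 hp)
  have h := card_support_of_mem_pairings hσ
  rw [hs, Finset.card_union_of_disjoint hd, Finset.card_map] at h
  omega

theorem factorial_two_mul_eq (t : ℕ) :
    (2 * t).factorial = 2 ^ t * t.factorial * doubleFactOdd t := by
  induction t with
  | zero => rfl
  | succ k ih =>
    rw [show 2 * (k + 1) = 2 * k + 1 + 1 by ring, Nat.factorial_succ, Nat.factorial_succ, ih,
      Nat.factorial_succ, doubleFactOdd]
    ring

theorem card_pairings {n t : ℕ} (ht : 2 * t ≤ n) :
    (pairings n t).card = n.choose (2 * t) * doubleFactOdd t := by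
  have h := Equiv.Perm.card_of_cycleType_mul_eq (Fin n) (Multiset.replicate t 2)
  have hcond : (Multiset.replicate t 2).sum ≤ Fintype.card (Fin n) ∧
      ∀ a ∈ Multiset.replicate t 2, 2 ≤ a := by
    refine ⟨?_, fun a ha => (Multiset.eq_of_mem_replicate ha).ge⟩
    rw [Multiset.sum_replicate, smul_eq_mul, Fintype.card_fin]
    omega
  have hprod : (∏ m ∈ (Multiset.replicate t 2).toFinset,
      ((Multiset.replicate t 2).count m).factorial) = t.factorial := by
    rcases Nat.eq_zero_or_pos t with rfl | hpos
    · rfl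
    · rw [Multiset.toFinset_replicate, if_neg hpos.ne', Finset.prod_singleton,
        Multiset.count_replicate_self]
  rw [if_pos hcond, hprod, Multiset.sum_replicate, Multiset.prod_replicate, smul_eq_mul,
    Fintype.card_fin, mul_comm t 2, ← Nat.choose_mul_factorial_mul_factorial ht,
    factorial_two_mul_eq] at h
  refine Nat.eq_of_mul_eq_mul_right
    (show 0 < (n - 2 * t).factorial * 2 ^ t * t.factorial by positivity) ?_
  rw [pairings]
  linarith

/-- `σ` exchanges the two largest elements of `Fin n`, the next two, and so on, for `t` pairs,
and fixes everything else. -/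
def IsStandardPairing {n : ℕ} (t : ℕ) (σ : Equiv.Perm (Fin n)) : Prop :=
  ∀ p q : Fin n, (σ p = q ∧ p ≠ q) ↔
    ∃ k < t, (p.val + 2 * k + 1 = n ∧ q.val + 2 * k + 2 = n) ∨
      (q.val + 2 * k + 1 = n ∧ p.val + 2 * k + 2 = n)

theorem exists_standard_pairing {n t : ℕ} (ht : 2 * t ≤ n) :
    ∃ σ ∈ pairings n t, IsStandardPairing t σ := by
  let f : Fin n → Fin n := fun p =>
    if h : n - 2 * t ≤ p.val then
      if (n - 1 - p.val) % 2 = 0 then ⟨p.val - 1, by omega⟩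
      else if h' : p.val + 1 < n then ⟨p.val + 1, h'⟩ else p
    else p
  have hf : ∀ p : Fin n, (f p).val = if n - 2 * t ≤ p.val then
      if (n - 1 - p.val) % 2 = 0 then p.val - 1 else p.val + 1 else p.val := by
    intro p
    simp only [f]
    split_ifs <;> simp
    omega
  have hinv : ∀ p, f (f p) = p := by
    intro p
    apply Fin.ext
    have h1 := hf p
    have h2 := hf (f p)
    have := p.isLt
    split_ifs at h1 h2 <;> omega
  have hspec : ∀ p q : Fin n, (f p = q ∧ p ≠ q) ↔
      ∃ k < t, (p.val + 2 * k + 1 = n ∧ q.val + 2 * k + 2 = n) ∨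
        (q.val + 2 * k + 1 = n ∧ p.val + 2 * k + 2 = n) := by
    intro p q
    have h1 := hf p
    rw [Ne, Fin.ext_iff, Fin.ext_iff, h1]
    have := p.isLt
    constructor
    · rintro ⟨h2, h3⟩
      refine ⟨(n - 1 - p.val) / 2, ?_⟩
      split_ifs at h2 <;> omega
    · rintro ⟨k, hk, h⟩
      split_ifs <;> omega
  let σ : Equiv.Perm (Fin n) := Function.Involutive.toPerm f hinv
  have hσ : ∀ p, σ p = f p := fun _ => rfl
  have hsupp : σ.support = Finset.univ.filter fun p : Fin n => ¬ p.val < n - 2 * t := by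
    ext p
    simp only [Equiv.Perm.mem_support, hσ, Finset.mem_filter, Finset.mem_univ, true_and]
    rw [Ne, Fin.ext_iff, hf]
    have := p.isLt
    split_ifs <;> omega
  refine ⟨σ, mem_pairings.2 (cycleType_eq_replicate_two hinv ?_), hspec⟩
  have hc := Finset.card_filter_add_card_filter_not (s := (Finset.univ : Finset (Fin n)))
    (fun p : Fin n => p.val < n - 2 * t)
  rw [hsupp]
  rw [Fin.card_filter_val_lt, Finset.card_univ, Fintype.card_fin] at hc
  omega

/-- The basis vectors permuted up to sign by `W(B_n)`, indexed by `Fin n`. -/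
noncomputable def posVec (n : ℕ) (p : Fin n) : EuclideanSpace ℝ (Fin (n + 1)) :=
  εv n p.succ

theorem posVec_apply_succ {n : ℕ} (p q : Fin n) :
    posVec n p q.succ = if q = p then 1 else 0 := by
  simp [posVec, εv]

theorem smul_posVec_apply_succ {n : ℕ} (c : ℤˣ) (p q : Fin n) :
    (c • posVec n p) q.succ = if q = p then ((c : ℤ) : ℝ) else 0 := by
  rcases Int.units_eq_one_or c with rfl | rfl <;> simp [posVec_apply_succ, Units.neg_smul]
  split_ifs <;> simp

theorem smul_posVec_inj {n : ℕ} {c c' : ℤˣ} {p q : Fin n}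
    (h : c • posVec n p = c' • posVec n q) : p = q := by
  have hp := congrArg (fun v => v p.succ) h
  simp only [smul_posVec_apply_succ] at hp
  by_contra hpq
  simp [hpq] at hp

theorem smul_add_ne_smul_posVec {n : ℕ} {c c' s : ℤˣ} {p q r : Fin n} (hpq : p ≠ q) :
    c • (posVec n p + s • posVec n q) ≠ c' • posVec n r := by
  intro h
  rw [smul_add, smul_smul] at h
  have hp := congrArg (fun v => v p.succ) h
  have hq := congrArg (fun v => v q.succ) h
  simp only [PiLp.add_apply, smul_posVec_apply_succ, hpq, hpq.symm, if_true, if_false] at hp hq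
  split_ifs at hp hq <;> simp_all

theorem eq_or_swap_of_smul_add_eq {n : ℕ} {c c' s s' : ℤˣ} {p q a b : Fin n}
    (hpq : p ≠ q) (hab : a ≠ b)
    (h : c • (posVec n p + s • posVec n q) = c' • (posVec n a + s' • posVec n b)) :
    s = s' ∧ ((p = a ∧ q = b) ∨ (p = b ∧ q = a)) := by
  rw [smul_add, smul_add, smul_smul, smul_smul] at h
  have hp := congrArg (fun v => v p.succ) h
  have hq := congrArg (fun v => v q.succ) h
  simp only [PiLp.add_apply, smul_posVec_apply_succ, hpq, hpq.symm, if_true, if_false] at hp hq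
  have hcast : ∀ x y : ℤˣ, ((x : ℤ) : ℝ) = ((y : ℤ) : ℝ) → x = y := fun x y hxy =>
    Units.ext (by exact_mod_cast hxy)
  by_cases h1 : p = a
  · subst h1
    by_cases h2 : q = b
    · subst h2
      simp only [hpq, hpq.symm, if_true, if_false, add_zero, zero_add] at hp hq
      have hc := hcast _ _ hp
      have hcs := hcast _ _ hq
      rw [hc] at hcs
      exact ⟨mul_left_cancel hcs, Or.inl ⟨rfl, rfl⟩⟩
    · simp [hpq.symm, h2] at hq
  · by_cases h2 : p = b
    · subst h2
      by_cases h3 : q = a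
      · subst h3
        simp only [hpq, hpq.symm, if_true, if_false, add_zero, zero_add] at hp hq
        have hc := hcast _ _ hp
        have hcs := hcast _ _ hq
        rw [hc, mul_assoc] at hcs
        refine ⟨?_, Or.inr ⟨rfl, rfl⟩⟩
        rw [← Int.units_inv_eq_self s', eq_comm, inv_eq_iff_mul_eq_one]
        exact mul_left_cancel (hcs.trans (mul_one c').symm)
      · simp [hpq.symm, h3] at hq
    · simp [h1, h2] at hp

theorem posVec_mem_PsiPos {n : ℕ} (p : Fin n) : posVec n p ∈ PsiPos n :=
  Or.inr ⟨p.succ, by simp, rfl⟩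

theorem exists_smul_mem_PsiPos {n : ℕ} {p q : Fin n} (hpq : p ≠ q) (s : ℤˣ) :
    ∃ c : ℤˣ, c • (posVec n p + s • posVec n q) ∈ PsiPos n := by
  rcases lt_or_gt_of_ne hpq with h | h
  · rcases Int.units_eq_one_or s with rfl | rfl
    · exact ⟨1, Or.inl ⟨p.succ, q.succ, by simp, by simpa using h, Or.inr (by simp [posVec, add_comm])⟩⟩
    · exact ⟨-1, Or.inl ⟨p.succ, q.succ, by simp, by simpa using h,
        Or.inl (by simp [posVec, Units.neg_smul, sub_eq_add_neg, add_comm])⟩⟩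
  · refine ⟨1, Or.inl ⟨q.succ, p.succ, by simp, by simpa using h, ?_⟩⟩
    rcases Int.units_eq_one_or s with rfl | rfl
    · exact Or.inr (by simp [posVec])
    · exact Or.inl (by simp [posVec, Units.neg_smul, sub_eq_add_neg])

/-- `v` is, up to sign, a long root `ε_p ± ε_q` given by the signed graph `G`, or a short root
`ε_p` given by the vertex set `A`. -/
def IsGraphRoot {n : ℕ} (G : Fin n → Fin n → ℤˣ → Prop) (A : Fin n → Prop)
    (v : EuclideanSpace ℝ (Fin (n + 1))) : Prop :=
  (∃ p q s, ∃ c : ℤˣ, G p q s ∧ v = c • (posVec n p + s • posVec n q)) ∨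
    ∃ p, ∃ c : ℤˣ, A p ∧ v = c • posVec n p

/-- The positive roots of type `B_n` given by a signed graph and a vertex set. -/
def graphRoots {n : ℕ} (G : Fin n → Fin n → ℤˣ → Prop) (A : Fin n → Prop) :
    Set (EuclideanSpace ℝ (Fin (n + 1))) :=
  {v | v ∈ PsiPos n ∧ IsGraphRoot G A v}

/-- A signed graph is proper if it is loopless and undirected. -/
def IsProperGraph {n : ℕ} (G : Fin n → Fin n → ℤˣ → Prop) : Prop :=
  ∀ p q s, G p q s → p ≠ q ∧ G q p s

theorem IsProperGraph.imp_of_graphRoots_eq {n : ℕ} {G G' : Fin n → Fin n → ℤˣ → Prop}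
    {A A' : Fin n → Prop} (hG : IsProperGraph G) (hG' : IsProperGraph G')
    (h : graphRoots G A = graphRoots G' A') {p q : Fin n} {s : ℤˣ} (hpq : G p q s) :
    G' p q s := by
  have hne := (hG p q s hpq).1
  obtain ⟨c, hc⟩ := exists_smul_mem_PsiPos hne s
  have hmem : c • (posVec n p + s • posVec n q) ∈ graphRoots G' A' :=
    h ▸ ⟨hc, Or.inl ⟨p, q, s, c, hpq, rfl⟩⟩
  rcases hmem.2 with ⟨a, b, s', c', hab, heq⟩ | ⟨a, c', -, heq⟩
  · obtain ⟨rfl, ⟨rfl, rfl⟩ | ⟨rfl, rfl⟩⟩ := eq_or_swap_of_smul_add_eq hne (hG' a b s' hab).1 heq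
    · exact hab
    · exact (hG' _ _ _ hab).2
  · exact absurd heq (smul_add_ne_smul_posVec hne)

theorem IsProperGraph.vertex_imp_of_graphRoots_eq {n : ℕ} {G G' : Fin n → Fin n → ℤˣ → Prop}
    {A A' : Fin n → Prop} (hG' : IsProperGraph G')
    (h : graphRoots G A = graphRoots G' A') {p : Fin n} (hp : A p) : A' p := by
  have hmem : posVec n p ∈ graphRoots G' A' :=
    h ▸ ⟨posVec_mem_PsiPos p, Or.inr ⟨p, 1, hp, (one_smul _ _).symm⟩⟩
  rcases hmem.2 with ⟨a, b, s', c', hab, heq⟩ | ⟨a, c', ha, heq⟩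
  · rw [← one_smul ℤˣ (posVec n p)] at heq
    exact absurd heq.symm (smul_add_ne_smul_posVec (hG' a b s' hab).1)
  · rw [← one_smul ℤˣ (posVec n p)] at heq
    rwa [smul_posVec_inj heq]

theorem map_units_smul {n : ℕ}
    (w : EuclideanSpace ℝ (Fin (n + 1)) ≃ₗᵢ[ℝ] EuclideanSpace ℝ (Fin (n + 1)))
    (c : ℤˣ) (v : EuclideanSpace ℝ (Fin (n + 1))) : w (c • v) = c • w v := by
  rcases Int.units_eq_one_or c with rfl | rfl <;> simp [Units.neg_smul]

theorem exists_signedPerm_of_mem_WgrpB {n : ℕ}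
    {w : EuclideanSpace ℝ (Fin (n + 1)) ≃ₗᵢ[ℝ] EuclideanSpace ℝ (Fin (n + 1))}
    (hw : w ∈ WgrpB n) :
    ∃ (τ : Equiv.Perm (Fin n)) (u : Fin n → ℤˣ), ∀ p, w (posVec n p) = u p • posVec n (τ p) := by
  have h : ∀ p : Fin n, ∃ (q : Fin n) (c : ℤˣ), w (posVec n p) = c • posVec n q := by
    intro p
    obtain ⟨j, hj, h⟩ := hw.2 p.succ (by simp)
    obtain ⟨q, rfl⟩ := Fin.exists_succ_eq.2 (show j ≠ 0 from fun h => by simp [h] at hj)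
    rcases h with h | h
    · exact ⟨q, 1, by simpa [posVec] using h⟩
    · exact ⟨q, -1, by simpa [posVec, Units.neg_smul] using h⟩
  choose f u hf using h
  have hinj : Function.Injective f := by
    intro p q hpq
    have h : w (u p • posVec n p) = w (u q • posVec n q) := by
      rw [map_units_smul, map_units_smul, hf, hf, smul_smul, smul_smul, hpq, Int.units_mul_self,
        Int.units_mul_self]
    exact smul_posVec_inj (w.injective h)
  exact ⟨Equiv.ofBijective f (Finite.injective_iff_bijective.1 hinj), u, hf⟩

theorem exists_mem_WgrpB_of_signedPerm {n : ℕ} (τ : Equiv.Perm (Fin n)) (u : Fin n → ℤˣ) :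
    ∃ w ∈ WgrpB n, ∀ p, w (posVec n p) = u p • posVec n (τ p) := by
  let e : Fin (n + 1) → (ℝ ≃ₗᵢ[ℝ] ℝ) :=
    Fin.cons (.refl ℝ ℝ) fun p => if u p = 1 then .refl ℝ ℝ else .neg ℝ
  let b := EuclideanSpace.basisFun (Fin (n + 1)) ℝ
  let w := (LinearIsometryEquiv.piLpCongrRight 2 e).trans
    (b.equiv b (Equiv.Perm.decomposeFin.symm (0, τ)))
  have hb : ∀ i, b i = εv n i := fun i => by simp [b, εv]
  have h0 : w (εv n 0) = εv n 0 := by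
    have h1 : LinearIsometryEquiv.piLpCongrRight 2 e (εv n 0) = εv n 0 := by
      ext i
      refine Fin.cases ?_ (fun i => ?_) i <;> simp [εv, e]
    simp only [w, LinearIsometryEquiv.trans_apply, h1]
    rw [← hb, OrthonormalBasis.equiv_apply_basis]
    simp
  have hs : ∀ p, w (posVec n p) = u p • posVec n (τ p) := by
    intro p
    have h1 : LinearIsometryEquiv.piLpCongrRight 2 e (εv n p.succ) = u p • εv n p.succ := by
      ext i
      refine Fin.cases ?_ (fun i => ?_) i
      · rcases Int.units_eq_one_or (u p) with h | h <;> simp [εv, e, h, Units.neg_smul]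
      · by_cases hip : i = p
        · subst hip
          rcases Int.units_eq_one_or (u i) with h | h <;> simp [εv, e, h, Units.neg_smul]
        · rcases Int.units_eq_one_or (u p) with h | h <;> simp [εv, e, h, hip, Units.neg_smul]
    simp only [w, LinearIsometryEquiv.trans_apply, posVec, h1, map_units_smul]
    rw [← hb, OrthonormalBasis.equiv_apply_basis]
    simp [hb]
  refine ⟨w, ⟨h0, fun i hi => ?_⟩, hs⟩
  obtain ⟨p, rfl⟩ := Fin.exists_succ_eq.2 (show i ≠ 0 from fun h => by simp [h] at hi)
  refine ⟨(τ p).succ, by simp, ?_⟩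
  have := hs p
  rcases Int.units_eq_one_or (u p) with h | h <;> rw [h] at this <;>
    simp only [one_smul, Units.neg_smul] at this
  · exact Or.inl this
  · exact Or.inr this

theorem isGraphRoot_map_iff {n : ℕ} {G G' : Fin n → Fin n → ℤˣ → Prop} {A A' : Fin n → Prop}
    {τ : Equiv.Perm (Fin n)} {u : Fin n → ℤˣ}
    {w : EuclideanSpace ℝ (Fin (n + 1)) ≃ₗᵢ[ℝ] EuclideanSpace ℝ (Fin (n + 1))}
    (hw : ∀ p, w (posVec n p) = u p • posVec n (τ p))
    (hG : ∀ p q s, G' (τ p) (τ q) (u p * u q * s) ↔ G p q s) (hA : ∀ p, A' (τ p) ↔ A p)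
    (v : EuclideanSpace ℝ (Fin (n + 1))) : IsGraphRoot G' A' (w v) ↔ IsGraphRoot G A v := by
  have hadd : ∀ p q (s c : ℤˣ), w (c • (posVec n p + s • posVec n q)) =
      (c * u p) • (posVec n (τ p) + (u p * u q * s) • posVec n (τ q)) := by
    intro p q s c
    rw [map_units_smul, map_add, map_units_smul, hw, hw, smul_add, smul_add, smul_smul, smul_smul,
      smul_smul, smul_smul]
    congr 2
    rw [show c * u p * (u p * u q * s) = c * (u p * u p) * (u q * s) by group, Int.units_mul_self,
      mul_one, mul_assoc, mul_comm s]
  have hsgl : ∀ p (c : ℤˣ), w (c • posVec n p) = (c * u p) • posVec n (τ p) := by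
    intro p c
    rw [map_units_smul, hw, smul_smul]
  have hcancel : ∀ a b : ℤˣ, a * b * b = a := fun a b => by
    rw [mul_assoc, Int.units_mul_self, mul_one]
  constructor
  · rintro (⟨p, q, s, c, h, heq⟩ | ⟨p, c, h, heq⟩)
    · obtain ⟨p, rfl⟩ := τ.surjective p
      obtain ⟨q, rfl⟩ := τ.surjective q
      have hs : u p * u q * (u p * u q * s) = s := by
        rw [← mul_assoc, Int.units_mul_self, one_mul]
      refine Or.inl ⟨p, q, u p * u q * s, c * u p, ?_, w.injective ?_⟩
      · rwa [← hG, hs]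
      · rw [hadd, hs, hcancel, heq]
    · obtain ⟨p, rfl⟩ := τ.surjective p
      refine Or.inr ⟨p, c * u p, (hA p).1 h, w.injective ?_⟩
      rw [hsgl, hcancel, heq]
  · rintro (⟨p, q, s, c, h, rfl⟩ | ⟨p, c, h, rfl⟩)
    · exact Or.inl ⟨_, _, _, _, (hG p q s).2 h, hadd p q s c⟩
    · exact Or.inr ⟨_, _, (hA p).2 h, hsgl p c⟩

theorem actWB_eq_graphRoots {n : ℕ} {G G' : Fin n → Fin n → ℤˣ → Prop} {A A' : Fin n → Prop}
    {Z : Set (EuclideanSpace ℝ (Fin (n + 1)))} (hZ : ∀ v, v ∈ Z ∨ -v ∈ Z ↔ IsGraphRoot G A v)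
    {τ : Equiv.Perm (Fin n)} {u : Fin n → ℤˣ}
    {w : EuclideanSpace ℝ (Fin (n + 1)) ≃ₗᵢ[ℝ] EuclideanSpace ℝ (Fin (n + 1))}
    (hw : ∀ p, w (posVec n p) = u p • posVec n (τ p))
    (hG : ∀ p q s, G' (τ p) (τ q) (u p * u q * s) ↔ G p q s) (hA : ∀ p, A' (τ p) ↔ A p) :
    actWB n w Z = graphRoots G' A' := by
  ext β
  obtain ⟨v, rfl⟩ := w.surjective β
  refine and_congr_right fun _ => ?_
  rw [isGraphRoot_map_iff hw hG hA, ← hZ, ← map_neg, w.injective.mem_set_image,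
    w.injective.mem_set_image]

/-- The signed graph joining `p ≠ q` when `σ p = q`, with both signs. -/
def fullGraph {n : ℕ} (σ : Equiv.Perm (Fin n)) (p q : Fin n) (_ : ℤˣ) : Prop :=
  σ p = q ∧ p ≠ q

/-- The signed graph joining `p ≠ q` when `σ p = q`, with sign `1` exactly when the larger of
`p`, `q` lies in `F`. -/
def signedGraph {n : ℕ} (σ : Equiv.Perm (Fin n)) (F : Finset (Fin n)) (p q : Fin n)
    (s : ℤˣ) : Prop :=
  (σ p = q ∧ p ≠ q) ∧ (s = 1 ↔ max p q ∈ F)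

theorem isProperGraph_fullGraph {n : ℕ} {σ : Equiv.Perm (Fin n)} (hσ : ∀ p, σ (σ p) = p) :
    IsProperGraph (fullGraph σ) := by
  rintro p q s ⟨rfl, hne⟩
  exact ⟨hne, hσ p, hne.symm⟩

theorem isProperGraph_signedGraph {n : ℕ} {σ : Equiv.Perm (Fin n)} (hσ : ∀ p, σ (σ p) = p)
    (F : Finset (Fin n)) : IsProperGraph (signedGraph σ F) := by
  rintro p q s ⟨⟨rfl, hne⟩, hF⟩
  exact ⟨hne, ⟨hσ p, hne.symm⟩, max_comm p (σ p) ▸ hF⟩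

theorem eq_of_forall_imp {n : ℕ} {σ σ' : Equiv.Perm (Fin n)}
    (h : ∀ p q, (σ p = q ∧ p ≠ q) → σ' p = q) (h' : ∀ p q, (σ' p = q ∧ p ≠ q) → σ p = q) :
    σ = σ' := by
  ext p
  by_cases hp : σ p = p
  · by_cases hp' : σ' p = p
    · rw [hp, hp']
    · rw [h' p _ ⟨rfl, Ne.symm hp'⟩]
  · rw [h p _ ⟨rfl, Ne.symm hp⟩]

theorem eq_of_graphRoots_fullGraph_eq {n : ℕ} {σ σ' : Equiv.Perm (Fin n)} {A A' : Fin n → Prop}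
    (hσ : ∀ p, σ (σ p) = p) (hσ' : ∀ p, σ' (σ' p) = p)
    (h : graphRoots (fullGraph σ) A = graphRoots (fullGraph σ') A') : σ = σ' :=
  eq_of_forall_imp
    (fun _ _ hpq => ((isProperGraph_fullGraph hσ).imp_of_graphRoots_eq
      (isProperGraph_fullGraph hσ') h (s := 1) hpq).1)
    (fun _ _ hpq => ((isProperGraph_fullGraph hσ').imp_of_graphRoots_eq
      (isProperGraph_fullGraph hσ) h.symm (s := 1) hpq).1)

theorem exists_sign_iff (P : Prop) : ∃ s : ℤˣ, s = 1 ↔ P := by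
  by_cases h : P
  · exact ⟨1, by simp [h]⟩
  · exact ⟨-1, by simp [h]⟩

theorem eq_of_graphRoots_signedGraph_eq {n : ℕ} {σ σ' : Equiv.Perm (Fin n)}
    {F F' : Finset (Fin n)} {A A' : Fin n → Prop}
    (hσ : ∀ p, σ (σ p) = p) (hσ' : ∀ p, σ' (σ' p) = p)
    (hF : F ⊆ pairMaxima σ) (hF' : F' ⊆ pairMaxima σ')
    (h : graphRoots (signedGraph σ F) A = graphRoots (signedGraph σ' F') A') :
    σ = σ' ∧ F = F' := by
  have himp := fun p q s => (isProperGraph_signedGraph hσ F).imp_of_graphRoots_eq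
    (isProperGraph_signedGraph hσ' F') h (p := p) (q := q) (s := s)
  have himp' := fun p q s => (isProperGraph_signedGraph hσ' F').imp_of_graphRoots_eq
    (isProperGraph_signedGraph hσ F) h.symm (p := p) (q := q) (s := s)
  constructor
  · refine eq_of_forall_imp (fun p q hpq => ?_) (fun p q hpq => ?_)
    · obtain ⟨s, hs⟩ := exists_sign_iff (max p q ∈ F)
      exact (himp p q s ⟨hpq, hs⟩).1.1
    · obtain ⟨s, hs⟩ := exists_sign_iff (max p q ∈ F')
      exact (himp' p q s ⟨hpq, hs⟩).1.1
  · have key : ∀ {σ σ' : Equiv.Perm (Fin n)} {F F' : Finset (Fin n)}, F ⊆ pairMaxima σ →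
        (∀ p q s, signedGraph σ F p q s → signedGraph σ' F' p q s) → F ⊆ F' := by
      intro σ σ' F F' hF himp p hp
      have hlt := mem_pairMaxima.1 (hF hp)
      have h1 := (himp p (σ p) 1 ⟨⟨rfl, hlt.ne'⟩, by simpa [max_eq_left hlt.le] using hp⟩).2
      simpa [max_eq_left hlt.le] using h1
    exact Finset.Subset.antisymm (key hF himp) (key hF' himp')

theorem conj_apply_eq_iff {n : ℕ} (τ σ : Equiv.Perm (Fin n)) (p q : Fin n) :
    ((τ * σ * τ⁻¹) (τ p) = τ q ∧ τ p ≠ τ q) ↔ (σ p = q ∧ p ≠ q) := by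
  simp

theorem actWB_eq_graphRoots_fullGraph {n : ℕ} {σ : Equiv.Perm (Fin n)} {A A' : Fin n → Prop}
    {Z : Set (EuclideanSpace ℝ (Fin (n + 1)))}
    (hZ : ∀ v, v ∈ Z ∨ -v ∈ Z ↔ IsGraphRoot (fullGraph σ) A v)
    {τ : Equiv.Perm (Fin n)} {u : Fin n → ℤˣ}
    {w : EuclideanSpace ℝ (Fin (n + 1)) ≃ₗᵢ[ℝ] EuclideanSpace ℝ (Fin (n + 1))}
    (hw : ∀ p, w (posVec n p) = u p • posVec n (τ p)) (hA : ∀ p, A' (τ p) ↔ A p) :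
    actWB n w Z = graphRoots (fullGraph (τ * σ * τ⁻¹)) A' :=
  actWB_eq_graphRoots hZ hw (fun p q _ => conj_apply_eq_iff τ σ p q) hA

theorem ncard_orbit_of_fullGraph {n t : ℕ} {σ : Equiv.Perm (Fin n)} (hσ : σ ∈ pairings n t)
    {Z : Set (EuclideanSpace ℝ (Fin (n + 1)))}
    (hZ : ∀ v, v ∈ Z ∨ -v ∈ Z ↔ IsGraphRoot (fullGraph σ) (fun _ => False) v) :
    Set.ncard {X | ∃ w ∈ WgrpB n, X = actWB n w Z} = (pairings n t).card := by
  have himg : {X | ∃ w ∈ WgrpB n, X = actWB n w Z} =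
      (fun σ' => graphRoots (fullGraph σ') (fun _ => False)) '' (pairings n t : Set _) := by
    ext X
    constructor
    · rintro ⟨w, hw, rfl⟩
      obtain ⟨τ, u, hτ⟩ := exists_signedPerm_of_mem_WgrpB hw
      exact ⟨τ * σ * τ⁻¹, conj_mem_pairings hσ τ,
        (actWB_eq_graphRoots_fullGraph hZ hτ fun _ => Iff.rfl).symm⟩
    · rintro ⟨σ', hσ', rfl⟩
      obtain ⟨τ, rfl⟩ := exists_conj_of_mem_pairings hσ hσ'
      obtain ⟨w, hw, hτ⟩ := exists_mem_WgrpB_of_signedPerm τ 1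
      exact ⟨w, hw, (actWB_eq_graphRoots_fullGraph hZ hτ fun _ => Iff.rfl).symm⟩
  rw [himg, Set.InjOn.ncard_image, Set.ncard_coe_finset]
  intro a ha b hb hab
  exact eq_of_graphRoots_fullGraph_eq (pairings_apply_apply ha) (pairings_apply_apply hb) hab

/-- Any two pairings with a marked fixed point are conjugate, respecting the marked points. -/
theorem exists_conj_of_fixed {n t : ℕ} {σ σ' : Equiv.Perm (Fin n)} {a a' : Fin n}
    (hσ : σ ∈ pairings n t) (hσ' : σ' ∈ pairings n t) (ha : σ a = a) (ha' : σ' a' = a') :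
    ∃ τ : Equiv.Perm (Fin n), τ * σ * τ⁻¹ = σ' ∧ τ a = a' := by
  obtain ⟨τ, hτ⟩ := exists_conj_of_mem_pairings hσ hσ'
  have hfix : σ' (τ a) = τ a := by rw [← hτ]; simp [ha]
  have hcomm : Equiv.swap (τ a) a' * σ' = σ' * Equiv.swap (τ a) a' := by
    rw [Equiv.mul_swap_eq_swap_mul, hfix, ha']
  refine ⟨Equiv.swap (τ a) a' * τ, ?_, by simp⟩
  rw [mul_inv_rev, show Equiv.swap (τ a) a' * τ * σ * (τ⁻¹ * (Equiv.swap (τ a) a')⁻¹) =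
    Equiv.swap (τ a) a' * (τ * σ * τ⁻¹) * (Equiv.swap (τ a) a')⁻¹ by group, hτ, hcomm,
    mul_inv_cancel_right]

theorem ncard_orbit_of_fullGraph_vertex {n t : ℕ} {σ : Equiv.Perm (Fin n)}
    (hσ : σ ∈ pairings n t) {a : Fin n} (ha : σ a = a)
    {Z : Set (EuclideanSpace ℝ (Fin (n + 1)))}
    (hZ : ∀ v, v ∈ Z ∨ -v ∈ Z ↔ IsGraphRoot (fullGraph σ) (fun p => p = a) v) :
    Set.ncard {X | ∃ w ∈ WgrpB n, X = actWB n w Z} = (pairings n t).card * (n - 2 * t) := by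
  have himg : {X | ∃ w ∈ WgrpB n, X = actWB n w Z} =
      (fun x : (_ : Equiv.Perm (Fin n)) × Fin n => graphRoots (fullGraph x.1) (fun p => p = x.2)) ''
        ((pairings n t).sigma fun σ' => σ'.supportᶜ : Finset _) := by
    ext X
    constructor
    · rintro ⟨w, hw, rfl⟩
      obtain ⟨τ, u, hτ⟩ := exists_signedPerm_of_mem_WgrpB hw
      refine ⟨⟨τ * σ * τ⁻¹, τ a⟩, ?_,
        (actWB_eq_graphRoots_fullGraph hZ hτ fun _ => τ.injective.eq_iff).symm⟩
      simp [conj_mem_pairings hσ τ, ha]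
    · rintro ⟨⟨σ', a'⟩, hx, rfl⟩
      simp only [Finset.mem_coe, Finset.mem_sigma, Finset.mem_compl, Equiv.Perm.mem_support,
        not_not] at hx
      obtain ⟨τ, rfl, rfl⟩ := exists_conj_of_fixed hσ hx.1 ha hx.2
      obtain ⟨w, hw, hτ⟩ := exists_mem_WgrpB_of_signedPerm τ 1
      exact ⟨w, hw, (actWB_eq_graphRoots_fullGraph hZ hτ fun _ => τ.injective.eq_iff).symm⟩
  rw [himg, Set.InjOn.ncard_image, Set.ncard_coe_finset, Finset.card_sigma,
    Finset.sum_const_nat]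
  · intro σ' hσ'
    rw [Finset.card_compl, card_support_of_mem_pairings hσ', Fintype.card_fin]
  · rintro ⟨σ₁, a₁⟩ h₁ ⟨σ₂, a₂⟩ h₂ hab
    simp only [Finset.mem_coe, Finset.mem_sigma] at h₁ h₂
    have hp₂ := pairings_apply_apply h₂.1
    obtain rfl : σ₁ = σ₂ := eq_of_graphRoots_fullGraph_eq (pairings_apply_apply h₁.1) hp₂ hab
    obtain rfl : a₁ = a₂ :=
      (isProperGraph_fullGraph hp₂).vertex_imp_of_graphRoots_eq hab (p := a₁) rfl
    rfl

theorem ncard_orbit_of_signedGraph {n t : ℕ} {σ : Equiv.Perm (Fin n)} (hσ : σ ∈ pairings n t)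
    {Z : Set (EuclideanSpace ℝ (Fin (n + 1)))}
    (hZ : ∀ v, v ∈ Z ∨ -v ∈ Z ↔ IsGraphRoot (signedGraph σ ∅) (fun _ => False) v) :
    Set.ncard {X | ∃ w ∈ WgrpB n, X = actWB n w Z} = (pairings n t).card * 2 ^ t := by
  have hinv := pairings_apply_apply hσ
  have himg : {X | ∃ w ∈ WgrpB n, X = actWB n w Z} =
      (fun x : (_ : Equiv.Perm (Fin n)) × Finset (Fin n) =>
        graphRoots (signedGraph x.1 x.2) (fun _ => False)) ''
        ((pairings n t).sigma fun σ' => (pairMaxima σ').powerset : Finset _) := by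
    ext X
    constructor
    · rintro ⟨w, hw, rfl⟩
      obtain ⟨τ, u, hτ⟩ := exists_signedPerm_of_mem_WgrpB hw
      have hconj := conj_mem_pairings hσ τ
      refine ⟨⟨τ * σ * τ⁻¹, (pairMaxima (τ * σ * τ⁻¹)).filter
        fun p => u (τ⁻¹ p) * u (σ (τ⁻¹ p)) = -1⟩,
        Finset.mem_sigma.2 ⟨hconj, Finset.mem_powerset.2 (Finset.filter_subset _ _)⟩,
        (actWB_eq_graphRoots hZ hτ (fun p q s => ?_) fun _ => Iff.rfl).symm⟩
      refine and_congr_right_iff.2 ?_ |>.trans (and_congr_left' (conj_apply_eq_iff τ σ p q))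
      intro hpq
      obtain ⟨rfl, hne⟩ := (conj_apply_eq_iff τ σ p q).1 hpq
      have hmax : max (τ p) (τ (σ p)) ∈ (pairMaxima (τ * σ * τ⁻¹)).filter
          (fun p => u (τ⁻¹ p) * u (σ (τ⁻¹ p)) = -1) ↔ u p * u (σ p) = -1 := by
        rcases lt_or_gt_of_ne hpq.2 with hlt | hlt
        · simp [max_eq_right hlt.le, mem_pairMaxima, hinv, hlt, mul_comm]
        · simp [max_eq_left hlt.le, mem_pairMaxima, hlt]
      rw [hmax]
      rcases Int.units_eq_one_or (u p * u (σ p)) with h | h <;> rw [h] <;>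
        rcases Int.units_eq_one_or s with rfl | rfl <;> simp
    · rintro ⟨⟨σ', F⟩, hx, rfl⟩
      simp only [Finset.mem_coe, Finset.mem_sigma, Finset.mem_powerset] at hx
      obtain ⟨hσ', hF⟩ := hx
      obtain ⟨τ, rfl⟩ := exists_conj_of_mem_pairings hσ hσ'
      obtain ⟨w, hw, hτ⟩ := exists_mem_WgrpB_of_signedPerm τ fun p => if τ p ∈ F then -1 else 1
      refine ⟨w, hw, (actWB_eq_graphRoots hZ hτ (fun p q s => ?_) fun _ => Iff.rfl).symm⟩
      refine and_congr_right_iff.2 ?_ |>.trans (and_congr_left' (conj_apply_eq_iff τ σ p q))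
      intro hpq
      obtain ⟨rfl, hne⟩ := (conj_apply_eq_iff τ σ p q).1 hpq
      have hmem : ∀ p, τ p ∈ F → τ (σ p) < τ p := fun p hp => by
        simpa [mem_pairMaxima] using hF hp
      have h1 := hmem p
      have h2 := hmem (σ p)
      rw [hinv] at h2
      rcases lt_or_gt_of_ne hpq.2 with hlt | hlt
      · have h3 : τ p ∉ F := fun h => lt_asymm hlt (h1 h)
        rw [max_eq_right hlt.le]
        by_cases h4 : τ (σ p) ∈ F <;> rcases Int.units_eq_one_or s with rfl | rfl <;> simp [h3, h4]
      · have h3 : τ (σ p) ∉ F := fun h => lt_asymm hlt (h2 h)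
        rw [max_eq_left hlt.le]
        by_cases h4 : τ p ∈ F <;> rcases Int.units_eq_one_or s with rfl | rfl <;> simp [h3, h4]
  rw [himg, Set.InjOn.ncard_image, Set.ncard_coe_finset, Finset.card_sigma,
    Finset.sum_const_nat]
  · intro σ' hσ'
    rw [Finset.card_powerset, card_pairMaxima hσ']
  · rintro ⟨σ₁, F₁⟩ h₁ ⟨σ₂, F₂⟩ h₂ hab
    simp only [Finset.mem_coe, Finset.mem_sigma, Finset.mem_powerset] at h₁ h₂
    obtain ⟨rfl, rfl⟩ := eq_of_graphRoots_signedGraph_eq (pairings_apply_apply h₁.1)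
      (pairings_apply_apply h₂.1) h₁.2 h₂.2 hab
    rfl

theorem βB_eq_sub {n k : ℕ} {p q : Fin n} (hp : p.val + 2 * k + 1 = n)
    (hq : q.val + 2 * k + 2 = n) : βB n (n - 1 - 2 * k) = posVec n p - posVec n q := by
  rw [βB, if_neg (by omega), dif_pos (by omega), posVec, posVec]
  congr 2 <;> ext <;> simp <;> omega

theorem βstarB_eq_add {n k : ℕ} {p q : Fin n} (hp : p.val + 2 * k + 1 = n)
    (hq : q.val + 2 * k + 2 = n) : βstarB n (n - 1 - 2 * k) = posVec n p + posVec n q := by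
  rw [βstarB, dif_pos (by omega), posVec, posVec]
  congr 2 <;> ext <;> simp <;> omega

theorem mem_Zset_iff {n t : ℕ} (ht : 2 * t ≤ n) {σ : Equiv.Perm (Fin n)}
    (hσ : IsStandardPairing t σ)
    (v : EuclideanSpace ℝ (Fin (n + 1))) :
    v ∈ Zset n t ∨ -v ∈ Zset n t ↔ IsGraphRoot (signedGraph σ ∅) (fun _ => False) v := by
  constructor
  · have key : ∀ v ∈ Zset n t, ∃ p q, (σ p = q ∧ p ≠ q) ∧
        v = posVec n p + (-1 : ℤˣ) • posVec n q := by
      rintro _ ⟨k, hk, rfl⟩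
      have hp : (⟨n - 1 - 2 * k, by omega⟩ : Fin n).val + 2 * k + 1 = n := by simp; omega
      have hq : (⟨n - 2 - 2 * k, by omega⟩ : Fin n).val + 2 * k + 2 = n := by simp; omega
      refine ⟨_, _, (hσ _ _).2 ⟨k, hk, Or.inl ⟨hp, hq⟩⟩, ?_⟩
      rw [βB_eq_sub hp hq, Units.neg_smul, one_smul, sub_eq_add_neg]
    rintro (h | h)
    · obtain ⟨p, q, hpq, rfl⟩ := key v h
      exact Or.inl ⟨p, q, -1, 1, ⟨hpq, by simp⟩, (one_smul _ _).symm⟩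
    · obtain ⟨p, q, hpq, hv⟩ := key _ h
      refine Or.inl ⟨p, q, -1, -1, ⟨hpq, by simp⟩, ?_⟩
      rw [← hv, Units.neg_smul, one_smul, neg_neg]
  · rintro (⟨p, q, s, c, ⟨hpq, hs⟩, rfl⟩ | ⟨_, _, h, _⟩)
    · obtain rfl : s = -1 := (Int.units_eq_one_or s).resolve_left (by simpa using hs)
      obtain ⟨k, hk, ⟨hp, hq⟩ | ⟨hq, hp⟩⟩ := (hσ p q).1 hpq <;>
      rcases Int.units_eq_one_or c with rfl | rfl <;>
      simp only [Units.neg_smul, one_smul, neg_neg, ← sub_eq_add_neg]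
      · exact Or.inl ⟨k, hk, (βB_eq_sub hp hq).symm⟩
      · exact Or.inr ⟨k, hk, (βB_eq_sub hp hq).symm⟩
      · exact Or.inr ⟨k, hk, by rw [neg_sub, βB_eq_sub hq hp]⟩
      · exact Or.inl ⟨k, hk, by rw [neg_sub, βB_eq_sub hq hp]⟩
    · exact h.elim

theorem mem_Ztil_iff {n t : ℕ} (ht : 2 * t ≤ n) {σ : Equiv.Perm (Fin n)}
    (hσ : IsStandardPairing t σ)
    (v : EuclideanSpace ℝ (Fin (n + 1))) :
    v ∈ Ztil n t ∨ -v ∈ Ztil n t ↔ IsGraphRoot (fullGraph σ) (fun _ => False) v := by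
  constructor
  · have key : ∀ v ∈ Ztil n t, ∃ p q, ∃ s : ℤˣ, (σ p = q ∧ p ≠ q) ∧
        v = posVec n p + s • posVec n q := by
      rintro v ⟨k, hk, hv⟩
      have hp : (⟨n - 1 - 2 * k, by omega⟩ : Fin n).val + 2 * k + 1 = n := by simp; omega
      have hq : (⟨n - 2 - 2 * k, by omega⟩ : Fin n).val + 2 * k + 2 = n := by simp; omega
      have hpq := (hσ _ _).2 ⟨k, hk, Or.inl ⟨hp, hq⟩⟩
      rcases hv with rfl | rfl
      · refine ⟨_, _, -1, hpq, ?_⟩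
        rw [βB_eq_sub hp hq, Units.neg_smul, one_smul, sub_eq_add_neg]
      · refine ⟨_, _, 1, hpq, ?_⟩
        rw [βstarB_eq_add hp hq, one_smul]
    rintro (h | h)
    · obtain ⟨p, q, s, hpq, rfl⟩ := key v h
      exact Or.inl ⟨p, q, s, 1, hpq, (one_smul _ _).symm⟩
    · obtain ⟨p, q, s, hpq, hv⟩ := key _ h
      refine Or.inl ⟨p, q, s, -1, hpq, ?_⟩
      rw [← hv, Units.neg_smul, one_smul, neg_neg]
  · rintro (⟨p, q, s, c, hpq, rfl⟩ | ⟨_, _, h, _⟩)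
    · obtain ⟨k, hk, ⟨hp, hq⟩ | ⟨hq, hp⟩⟩ := (hσ p q).1 hpq <;>
      rcases Int.units_eq_one_or c with rfl | rfl <;>
      rcases Int.units_eq_one_or s with rfl | rfl <;>
      simp only [Units.neg_smul, one_smul, neg_neg, ← sub_eq_add_neg]
      · exact Or.inl ⟨k, hk, Or.inr (βstarB_eq_add hp hq).symm⟩
      · exact Or.inl ⟨k, hk, Or.inl (βB_eq_sub hp hq).symm⟩
      · exact Or.inr ⟨k, hk, Or.inr (βstarB_eq_add hp hq).symm⟩
      · exact Or.inr ⟨k, hk, Or.inl (βB_eq_sub hp hq).symm⟩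
      · exact Or.inl ⟨k, hk, Or.inr ((βstarB_eq_add hq hp).trans (add_comm _ _)).symm⟩
      · exact Or.inr ⟨k, hk, Or.inl (by rw [neg_sub, βB_eq_sub hq hp])⟩
      · exact Or.inr ⟨k, hk, Or.inr ((βstarB_eq_add hq hp).trans (add_comm _ _)).symm⟩
      · exact Or.inl ⟨k, hk, Or.inl (by rw [neg_sub, βB_eq_sub hq hp])⟩
    · exact h.elim

theorem Zbar_succ (n t : ℕ) : Zbar n (t + 1) = Ztil n t ∪ {βB n 0} := by
  simp [Zbar, Ztil]

theorem mem_Zbar_succ_iff {n t : ℕ} (hn : 0 < n) (ht : 2 * t ≤ n) {σ : Equiv.Perm (Fin n)}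
    (hσ : IsStandardPairing t σ)
    (v : EuclideanSpace ℝ (Fin (n + 1))) :
    v ∈ Zbar n (t + 1) ∨ -v ∈ Zbar n (t + 1) ↔
      IsGraphRoot (fullGraph σ) (fun p => p = ⟨0, hn⟩) v := by
  have hβ : βB n 0 = posVec n ⟨0, hn⟩ := by
    rw [βB, if_pos rfl, posVec]
    congr 1
    ext
    simp [Nat.mod_eq_of_lt (show 1 < n + 1 by omega)]
  have h := mem_Ztil_iff ht hσ v
  simp only [IsGraphRoot, false_and, exists_false, or_false] at h
  rw [Zbar_succ, IsGraphRoot, ← h, Set.mem_union, Set.mem_union, or_or_or_comm,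
    Set.mem_singleton_iff, Set.mem_singleton_iff, hβ]
  refine or_congr_right ⟨?_, ?_⟩
  · rintro (rfl | h)
    · exact ⟨_, 1, rfl, (one_smul _ _).symm⟩
    · exact ⟨_, -1, rfl, by rw [← h, Units.neg_smul, one_smul, neg_neg]⟩
  · rintro ⟨_, c, rfl, rfl⟩
    rcases Int.units_eq_one_or c with rfl | rfl
    · exact Or.inl (one_smul _ _)
    · exact Or.inr (by rw [Units.neg_smul, one_smul, neg_neg])

/-- The `W(B_n)`-orbit of `Z_t` has `2^t·C(n,2t)·(2t-1)!!` elements, the orbit of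
`Z̄_t` has `n·C(n-1,2t-2)·(2t-3)!!` elements, and the orbit of `Z̃_t` has
`C(n,2t)·(2t-1)!!` elements. -/
theorem statement_12 (n : ℕ) (hn : 2 ≤ n) :
    (∀ t : ℕ, 2 * t ≤ n →
      Set.ncard {X | ∃ w ∈ WgrpB n, X = actWB n w (Zset n t)} =
        2 ^ t * Nat.choose n (2 * t) * doubleFactOdd t) ∧
    (∀ t : ℕ, 1 ≤ t → 2 * t ≤ n + 1 →
      Set.ncard {X | ∃ w ∈ WgrpB n, X = actWB n w (Zbar n t)} =
        n * Nat.choose (n - 1) (2 * t - 2) * doubleFactOdd (t - 1)) ∧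
    (∀ t : ℕ, 1 ≤ t → 2 * t ≤ n →
      Set.ncard {X | ∃ w ∈ WgrpB n, X = actWB n w (Ztil n t)} =
        Nat.choose n (2 * t) * doubleFactOdd t) := by
  refine ⟨fun t ht => ?_, fun t ht1 ht => ?_, fun t _ ht => ?_⟩
  · obtain ⟨σ, hσ, hspec⟩ := exists_standard_pairing ht
    rw [ncard_orbit_of_signedGraph hσ (mem_Zset_iff ht hspec), card_pairings ht]
    ring
  · obtain ⟨r, rfl⟩ := Nat.exists_eq_add_of_le' ht1
    have hr : 2 * r ≤ n := by omega
    obtain ⟨σ, hσ, hspec⟩ := exists_standard_pairing hr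
    have hfix : σ ⟨0, by omega⟩ = ⟨0, by omega⟩ := by
      by_contra hne
      obtain ⟨k, hk, h⟩ := (hspec _ _).1 ⟨rfl, Ne.symm hne⟩
      simp only at h
      omega
    rw [ncard_orbit_of_fullGraph_vertex hσ hfix (mem_Zbar_succ_iff (by omega) hr hspec),
      card_pairings hr]
    obtain ⟨m, rfl⟩ := Nat.exists_eq_add_of_le' (show 1 ≤ n by omega)
    rw [show 2 * (r + 1) - 2 = 2 * r by omega, Nat.add_sub_cancel, Nat.add_sub_cancel]
    have h := Nat.choose_mul_succ_eq m (2 * r)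
    rw [mul_right_comm, ← h]
    ring
  · obtain ⟨σ, hσ, hspec⟩ := exists_standard_pairing ht
    rw [ncard_orbit_of_fullGraph hσ (mem_Ztil_iff ht hspec), card_pairings ht]
end

section
/- Every element of the Brauer monoid BrM(B_n) can be written as δ^k·u·f·v for some integer k, some elements u, v of the multiplicative submonoid W of Br(B_n) generated by r_0,…,r_{n−1}, and some f ∈ F. -/
/-- The ground ring `ℤ[δ, δ⁻¹]` of Laurent polynomials over `ℤ`. -/
abbrev Lp : Type := LaurentPolynomial ℤ

/-- The parameter `δ`. -/
noncomputable def δpar : Lp := LaurentPolynomial.T 1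

/-- Generators of the Brauer algebra of type `B_n`: `r i` and `e i` for `0 ≤ i ≤ n-1`. -/
inductive BGen (n : ℕ) : Type
  | r (i : Fin n) : BGen n
  | e (i : Fin n) : BGen n

/-- The generator `r i` viewed in the free algebra. -/
noncomputable def fr {n : ℕ} (i : Fin n) : FreeAlgebra Lp (BGen n) :=
  FreeAlgebra.ι Lp (BGen.r i)

/-- The generator `e i` viewed in the free algebra. -/
noncomputable def fe {n : ℕ} (i : Fin n) : FreeAlgebra Lp (BGen n) :=
  FreeAlgebra.ι Lp (BGen.e i)

/-- The defining relations of the Brauer algebra of type `B_n`. -/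
inductive BrauerBRel (n : ℕ) : FreeAlgebra Lp (BGen n) → FreeAlgebra Lp (BGen n) → Prop
  | rr (i : Fin n) : BrauerBRel n (fr i * fr i) 1
  | re (i : Fin n) : BrauerBRel n (fr i * fe i) (fe i)
  | er (i : Fin n) : BrauerBRel n (fe i * fr i) (fe i)
  | ee (i : Fin n) (h : 0 < i.val) : BrauerBRel n (fe i * fe i) (δpar • fe i)
  | e0e0 (i : Fin n) (h : i.val = 0) : BrauerBRel n (fe i * fe i) ((δpar * δpar) • fe i)
  | rrFar (i j : Fin n) (h : i.val + 2 ≤ j.val ∨ j.val + 2 ≤ i.val) :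
      BrauerBRel n (fr i * fr j) (fr j * fr i)
  | erFar (i j : Fin n) (h : i.val + 2 ≤ j.val ∨ j.val + 2 ≤ i.val) :
      BrauerBRel n (fe i * fr j) (fr j * fe i)
  | eeFar (i j : Fin n) (h : i.val + 2 ≤ j.val ∨ j.val + 2 ≤ i.val) :
      BrauerBRel n (fe i * fe j) (fe j * fe i)
  | braid (i j : Fin n) (h : i.val + 1 = j.val ∨ j.val + 1 = i.val)
      (hi : 0 < i.val) (hj : 0 < j.val) :
      BrauerBRel n (fr i * fr j * fr i) (fr j * fr i * fr j)
  | rre (i j : Fin n) (h : i.val + 1 = j.val ∨ j.val + 1 = i.val)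
      (hi : 0 < i.val) (hj : 0 < j.val) :
      BrauerBRel n (fr j * fr i * fe j) (fe i * fe j)
  | rer (i j : Fin n) (h : i.val + 1 = j.val ∨ j.val + 1 = i.val)
      (hi : 0 < i.val) (hj : 0 < j.val) :
      BrauerBRel n (fr i * fe j * fr i) (fr j * fe i * fr j)
  | b1010 (i j : Fin n) (h0 : i.val = 0) (h1 : j.val = 1) :
      BrauerBRel n (fr j * fr i * fr j * fr i) (fr i * fr j * fr i * fr j)
  | b_r0r1e0 (i j : Fin n) (h0 : i.val = 0) (h1 : j.val = 1) :
      BrauerBRel n (fr i * fr j * fe i) (fr j * fe i)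
  | b_r0e1r0e1 (i j : Fin n) (h0 : i.val = 0) (h1 : j.val = 1) :
      BrauerBRel n (fr i * fe j * fr i * fe j) (fe j * fe i * fe j)
  | b_r0r1r0e1 (i j : Fin n) (h0 : i.val = 0) (h1 : j.val = 1) :
      BrauerBRel n (fr i * fr j * fr i * fe j) (fe j * (fr i * fr j * fr i))
  | b_e0r1e0 (i j : Fin n) (h0 : i.val = 0) (h1 : j.val = 1) :
      BrauerBRel n (fe i * fr j * fe i) (δpar • fe i)
  | b_e0e1e0 (i j : Fin n) (h0 : i.val = 0) (h1 : j.val = 1) :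
      BrauerBRel n (fe i * fe j * fe i) (δpar • fe i)
  | b_e0r1r0 (i j : Fin n) (h0 : i.val = 0) (h1 : j.val = 1) :
      BrauerBRel n (fe i * fr j * fr i) (fe i * fr j)
  | b_e0e1r0 (i j : Fin n) (h0 : i.val = 0) (h1 : j.val = 1) :
      BrauerBRel n (fe i * fe j * fr i) (fe i * fe j)

/-- The Brauer algebra of type `B_n` over `ℤ[δ, δ⁻¹]`. -/
abbrev BrauerB (n : ℕ) : Type := RingQuot (BrauerBRel n)

/-- The generator `r i` of `Br(B_n)` (defined to be `1` for out-of-range indices). -/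
noncomputable def rb (n : ℕ) (i : ℕ) : BrauerB n :=
  if h : i < n then RingQuot.mkAlgHom Lp (BrauerBRel n) (fr ⟨i, h⟩) else 1

/-- The generator `e i` of `Br(B_n)` (defined to be `1` for out-of-range indices). -/
noncomputable def eb (n : ℕ) (i : ℕ) : BrauerB n :=
  if h : i < n then RingQuot.mkAlgHom Lp (BrauerBRel n) (fe ⟨i, h⟩) else 1


/-- The elements `e_i*` of `Br(B_n)`: `e₁* = r₀e₁r₀` and
`e_i* = r_{i-1}r_i·e_{i-1}*·r_ir_{i-1}` for `i ≥ 2` (junk value `1` at `i = 0`). -/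
noncomputable def es (n : ℕ) : ℕ → BrauerB n
  | 0 => 1
  | 1 => rb n 0 * eb n 1 * rb n 0
  | (i + 2) => rb n (i + 1) * rb n (i + 2) * es n (i + 1) * rb n (i + 2) * rb n (i + 1)

/-- The element `g = e₂r₁e₀e₁e₂` of `Br(B_n)`. -/
noncomputable def gB (n : ℕ) : BrauerB n :=
  eb n 2 * rb n 1 * eb n 0 * eb n 1 * eb n 2

/-- `f_t^{(1)} = ∏_{i=1}^{t} e_{n+1-2i}` (so `f₀^{(1)} = 1`). -/
noncomputable def f1B (n : ℕ) : ℕ → BrauerB n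
  | 0 => 1
  | (t + 1) => f1B n t * eb n (n - 1 - 2 * t)

/-- `f_t^{(2)} = ∏_{i=1}^{t} e_{n+1-2i}·e_{n+1-2i}*` (so `f₀^{(2)} = 1`). -/
noncomputable def f2B (n : ℕ) : ℕ → BrauerB n
  | 0 => 1
  | (t + 1) => f2B n t * (eb n (n - 1 - 2 * t) * es n (n - 1 - 2 * t))

/-- `f_t^{(3)} = e₀·f_{t-1}^{(2)}`. -/
noncomputable def f3B (n : ℕ) (t : ℕ) : BrauerB n := eb n 0 * f2B n (t - 1)

/-- `f_t^{(4)} = g·f_{t-1}^{(2)}`. -/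
noncomputable def f4B (n : ℕ) (t : ℕ) : BrauerB n := gB n * f2B n (t - 1)

/-- `f_t^{(5)} = e₀e₁·f_{t-1}^{(2)}`. -/
noncomputable def f5B (n : ℕ) (t : ℕ) : BrauerB n := eb n 0 * eb n 1 * f2B n (t - 1)

/-- `f_t^{(6)} = e₁e₀·f_{t-1}^{(2)}`. -/
noncomputable def f6B (n : ℕ) (t : ℕ) : BrauerB n := eb n 1 * eb n 0 * f2B n (t - 1)

/-- The set `F` of all the elements `f_t^{(i)}`, for `t` in the admissible ranges:
`0 ≤ t < (n+1)/2` for `i = 1`; `1 ≤ t ≤ n/2` for `i = 2, 5, 6`;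
`1 ≤ t ≤ (n+1)/2` for `i = 3`; `1 ≤ t ≤ (n-1)/2` for `i = 4`. -/
def FsetB (n : ℕ) : Set (BrauerB n) :=
  {x | ∃ t : ℕ, 2 * t ≤ n ∧ x = f1B n t} ∪
  {x | ∃ t : ℕ, 1 ≤ t ∧ 2 * t ≤ n ∧ x = f2B n t} ∪
  {x | ∃ t : ℕ, 1 ≤ t ∧ 2 * t ≤ n + 1 ∧ x = f3B n t} ∪
  {x | ∃ t : ℕ, 1 ≤ t ∧ 2 * t + 1 ≤ n ∧ x = f4B n t} ∪
  {x | ∃ t : ℕ, 1 ≤ t ∧ 2 * t ≤ n ∧ x = f5B n t} ∪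
  {x | ∃ t : ℕ, 1 ≤ t ∧ 2 * t ≤ n ∧ x = f6B n t}

/-- The submonoid `W` of `Br(B_n)` generated by `r_0, …, r_{n-1}` (a copy of the
Weyl group `W(B_n)`). -/
noncomputable def WmonB (n : ℕ) : Submonoid (BrauerB n) :=
  Submonoid.closure {x | ∃ i : ℕ, i < n ∧ x = rb n i}

/-- The Brauer monoid `BrM(B_n)`: the multiplicative submonoid of `Br(B_n)` generated
by `δ`, `δ⁻¹` and all the generators `r_i`, `e_i`. -/
noncomputable def BrMB (n : ℕ) : Submonoid (BrauerB n) :=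
  Submonoid.closure
    ({algebraMap Lp _ (LaurentPolynomial.T 1), algebraMap Lp _ (LaurentPolynomial.T (-1))} ∪
      {x | ∃ i : ℕ, i < n ∧ x = rb n i} ∪ {x | ∃ i : ℕ, i < n ∧ x = eb n i})

section
variable {G X : Type*} [Group G] [MulAction G X]

/-- The relations of the symmetric group for `ρ 1, …, ρ (n - 1)`. -/
structure BraidFamily (n : ℕ) (ρ : ℕ → G) : Prop where
  sq (i : ℕ) : ρ i * ρ i = 1
  far (i j : ℕ) : i + 2 ≤ j → ρ i * ρ j = ρ j * ρ i
  braid (i : ℕ) : 1 ≤ i → i + 1 < n → ρ i * ρ (i + 1) * ρ i = ρ (i + 1) * ρ i * ρ (i + 1)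

/-- The translates of `x` to the points `0, 1, 2, …`. -/
def pointOrbit (ρ : ℕ → G) (x : X) : ℕ → X
  | 0 => x
  | i + 1 => ρ (i + 1) • pointOrbit ρ x i

/-- The translates of `b i` to the pairs of points `(i, i + 1), (i, i + 2), …`. -/
def pairOrbit (ρ : ℕ → G) (b : ℕ → X) (i : ℕ) : ℕ → X
  | 0 => b i
  | m + 1 => ρ (i + m + 2) • pairOrbit ρ b i m

variable {n : ℕ} {ρ : ℕ → G}

theorem BraidFamily.smul_smul_self (h : BraidFamily n ρ) (i : ℕ) (x : X) : ρ i • ρ i • x = x := by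
  rw [smul_smul, h.sq, one_smul]

theorem BraidFamily.smul_comm (h : BraidFamily n ρ) {i j : ℕ} (hij : i + 2 ≤ j) (x : X) :
    ρ i • ρ j • x = ρ j • ρ i • x := by
  rw [smul_smul, h.far i j hij, mul_smul]

theorem BraidFamily.smul_braid (h : BraidFamily n ρ) {i : ℕ} (hi : 1 ≤ i) (hn : i + 1 < n)
    (x : X) : ρ i • ρ (i + 1) • ρ i • x = ρ (i + 1) • ρ i • ρ (i + 1) • x := by
  simpa only [mul_smul] using congrArg (· • x) (h.braid i hi hn)

theorem pointOrbit_fixed_of_lt (h : BraidFamily n ρ) {x : X}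
    (hx : ∀ k, 2 ≤ k → k < n → ρ k • x = x) {k i : ℕ} (hk : i + 2 ≤ k) (hn : k < n) :
    ρ k • pointOrbit ρ x i = pointOrbit ρ x i := by
  induction i with
  | zero => exact hx k (by omega) hn
  | succ i ih => rw [pointOrbit, ← h.smul_comm (by omega), ih (by omega)]

theorem pointOrbit_fixed_of_gt (h : BraidFamily n ρ) {x : X}
    (hx : ∀ k, 2 ≤ k → k < n → ρ k • x = x) {k i : ℕ} (hk : k + 2 ≤ i) (hn : i < n) :
    ρ (k + 1) • pointOrbit ρ x i = pointOrbit ρ x i := by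
  induction i, hk using Nat.le_induction with
  | base =>
    rw [pointOrbit, pointOrbit, h.smul_braid (by omega) (by omega),
      pointOrbit_fixed_of_lt h hx (by omega) (by omega)]
  | succ i hi ih => rw [pointOrbit, h.smul_comm (by omega), ih (by omega)]

theorem smul_pointOrbit (h : BraidFamily n ρ) {x : X}
    (hx : ∀ k, 2 ≤ k → k < n → ρ k • x = x) {k i : ℕ} (hk : k + 1 < n) (hi : i < n) :
    ρ (k + 1) • pointOrbit ρ x i = pointOrbit ρ x (Equiv.swap k (k + 1) i) := by
  rcases lt_trichotomy i k with hlt | rfl | hgt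
  · rw [Equiv.swap_apply_of_ne_of_ne (by omega) (by omega),
      pointOrbit_fixed_of_lt h hx (by omega) hk]
  · rw [Equiv.swap_apply_left, pointOrbit]
  · obtain rfl | hgt := (Nat.succ_le_of_lt hgt).eq_or_lt
    · rw [Nat.succ_eq_add_one, Equiv.swap_apply_right, pointOrbit, h.smul_smul_self]
    · rw [Equiv.swap_apply_of_ne_of_ne (by omega) (by omega),
        pointOrbit_fixed_of_gt h hx (by omega) hi]

/-- The hypotheses on a family of elements attached to the pairs `(i, i + 1)` that make
its translates well-defined. -/
structure EdgeFamily (n : ℕ) (ρ : ℕ → G) (b : ℕ → X) : Prop where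
  self (i : ℕ) : i + 1 < n → ρ (i + 1) • b i = b i
  right (i k : ℕ) : i + 1 < n → k < n → i + 3 ≤ k → ρ k • b i = b i
  left (i k : ℕ) : i + 1 < n → 1 ≤ k → k + 1 ≤ i → ρ k • b i = b i
  shift (i : ℕ) : i + 2 < n → ρ (i + 1) • ρ (i + 2) • b i = b (i + 1)

variable {b : ℕ → X}

theorem pairOrbit_fixed_of_lt (h : BraidFamily n ρ) (hb : EdgeFamily n ρ b) {i m k : ℕ}
    (hk : i + m + 3 ≤ k) (hn : k < n) : ρ k • pairOrbit ρ b i m = pairOrbit ρ b i m := by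
  induction m with
  | zero => exact hb.right i k (by omega) hn (by omega)
  | succ m ih => rw [pairOrbit, ← h.smul_comm (by omega), ih (by omega)]

theorem pairOrbit_fixed_of_gt (h : BraidFamily n ρ) (hb : EdgeFamily n ρ b) {i m k : ℕ}
    (hk : 1 ≤ k) (hki : k + 1 ≤ i) (hn : i + m + 1 < n) :
    ρ k • pairOrbit ρ b i m = pairOrbit ρ b i m := by
  induction m with
  | zero => exact hb.left i k (by omega) (by omega) (by omega)
  | succ m ih => rw [pairOrbit, h.smul_comm (by omega), ih (by omega)]

theorem pairOrbit_fixed_of_between (h : BraidFamily n ρ) (hb : EdgeFamily n ρ b) {i m k : ℕ}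
    (hk : i + 2 ≤ k) (hkm : k ≤ i + m) (hn : i + m + 1 < n) :
    ρ k • pairOrbit ρ b i m = pairOrbit ρ b i m := by
  obtain ⟨c, rfl⟩ : ∃ c, k = i + c + 2 := ⟨k - i - 2, by omega⟩
  obtain ⟨l, rfl⟩ : ∃ l, m = c + 2 + l := ⟨m - c - 2, by omega⟩
  clear hkm
  induction l with
  | zero =>
    rw [Nat.add_zero, pairOrbit, pairOrbit]
    have : i + (c + 1) + 2 = i + c + 2 + 1 := by omega
    rw [this, h.smul_braid (by omega) (by omega), pairOrbit_fixed_of_lt h hb (by omega) (by omega)]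
  | succ l ih => rw [← Nat.add_assoc, pairOrbit, h.smul_comm (by omega), ih (by omega)]

theorem smul_pairOrbit_left (h : BraidFamily n ρ) (hb : EdgeFamily n ρ b) {i m : ℕ}
    (hn : i + m + 2 < n) :
    ρ (i + 1) • pairOrbit ρ b i (m + 1) = pairOrbit ρ b (i + 1) m := by
  induction m with
  | zero => exact hb.shift i (by omega)
  | succ m ih =>
    rw [pairOrbit, h.smul_comm (by omega), ih (by omega), pairOrbit]
    congr 2; omega

/-- The translate attached to an unordered pair of distinct points. -/
def pairOf (ρ : ℕ → G) (b : ℕ → X) (i j : ℕ) : X :=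
  if i < j then pairOrbit ρ b i (j - i - 1) else pairOrbit ρ b j (i - j - 1)

theorem pairOf_comm (ρ : ℕ → G) (b : ℕ → X) (i j : ℕ) : pairOf ρ b i j = pairOf ρ b j i := by
  unfold pairOf
  rcases lt_trichotomy i j with hij | rfl | hij
  · rw [if_pos hij, if_neg (by omega)]
  · rfl
  · rw [if_pos hij, if_neg (by omega)]

theorem smul_pairOf_of_lt (h : BraidFamily n ρ) (hb : EdgeFamily n ρ b) {k i j : ℕ}
    (hk : k + 1 < n) (hij : i < j) (hj : j < n) :
    ρ (k + 1) • pairOf ρ b i j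
      = pairOf ρ b (Equiv.swap k (k + 1) i) (Equiv.swap k (k + 1) j) := by
  obtain ⟨m, rfl⟩ : ∃ m, j = i + m + 1 := ⟨j - i - 1, by omega⟩
  have key (i m : ℕ) : pairOf ρ b i (i + m + 1) = pairOrbit ρ b i m := by
    rw [pairOf, if_pos (by omega)]; congr 1; omega
  rw [key]
  by_cases h1 : k + 1 < i
  · rw [Equiv.swap_apply_of_ne_of_ne (by omega) (by omega),
      Equiv.swap_apply_of_ne_of_ne (by omega) (by omega), key,
      pairOrbit_fixed_of_gt h hb (by omega) (by omega) hj]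
  by_cases h2 : k + 1 = i
  · subst h2
    rw [Equiv.swap_apply_right, Equiv.swap_apply_of_ne_of_ne (by omega) (by omega),
      ← smul_pairOrbit_left h hb (by omega), h.smul_smul_self, ← key]
    congr 1; omega
  by_cases h3 : k = i
  · subst h3
    rw [Equiv.swap_apply_left]
    cases m with
    | zero => rw [Nat.add_zero, Equiv.swap_apply_right, pairOf_comm, key k 0, pairOrbit,
        hb.self k (by omega)]
    | succ m =>
      rw [Equiv.swap_apply_of_ne_of_ne (by omega) (by omega), smul_pairOrbit_left h hb (by omega),
        ← key]
      congr 1; omega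
  rw [Equiv.swap_apply_of_ne_of_ne (x := i) (by omega) (by omega)]
  by_cases h4 : k < i + m
  · rw [Equiv.swap_apply_of_ne_of_ne (by omega) (by omega), key,
      pairOrbit_fixed_of_between h hb (by omega) (by omega) hj]
  by_cases h5 : k = i + m
  · subst h5
    obtain ⟨m, rfl⟩ : ∃ c, m = c + 1 := ⟨m - 1, by omega⟩
    rw [Equiv.swap_apply_right, pairOrbit, ← Nat.add_assoc, key]
    exact h.smul_smul_self _ _
  by_cases h6 : k = i + m + 1
  · subst h6
    rw [Equiv.swap_apply_left, Nat.add_assoc i m 1, key, pairOrbit]; rfl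
  · rw [Equiv.swap_apply_of_ne_of_ne (by omega) (by omega), key,
      pairOrbit_fixed_of_lt h hb (by omega) (by omega)]

theorem smul_pairOf (h : BraidFamily n ρ) (hb : EdgeFamily n ρ b) {k i j : ℕ}
    (hk : k + 1 < n) (hij : i ≠ j) (hi : i < n) (hj : j < n) :
    ρ (k + 1) • pairOf ρ b i j
      = pairOf ρ b (Equiv.swap k (k + 1) i) (Equiv.swap k (k + 1) j) := by
  rcases hij.lt_or_gt with hij | hij
  · exact smul_pairOf_of_lt h hb hk hij hj
  · rw [pairOf_comm, smul_pairOf_of_lt h hb hk hij hi, pairOf_comm]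

end

theorem List.Nodup.exists_perm_map_eq {α : Type*} [Finite α] {l l' : List α} (h : l.Nodup)
    (h' : l'.Nodup) (hl : l.length = l'.length) : ∃ σ : Equiv.Perm α, l.map σ = l' := by
  classical
  let f : {x // x ∈ l} ≃ {x // x ∈ l'} :=
    (h.getEquiv l).symm.trans ((finCongr hl).trans (h'.getEquiv l'))
  refine ⟨f.extendSubtype, List.ext_getElem (by simpa using hl) fun i hi hi' => ?_⟩
  rw [List.length_map] at hi
  rw [List.getElem_map, Equiv.extendSubtype_apply_of_mem f _ (List.getElem_mem hi)]
  have : (⟨l[i], List.getElem_mem hi⟩ : {x // x ∈ l}) = h.getEquiv l ⟨i, hi⟩ := rfl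
  simp only [f, this, Equiv.trans_apply, Equiv.symm_apply_apply]
  rfl

open ConjAct in
/-- Generators of a monoid satisfying the relations of the Brauer monoid of type `B_n`. -/
structure BrauerData (n : ℕ) (A : Type*) [Monoid A] where
  R : ℕ → Aˣ
  e : ℕ → A
  d : Aˣ
  three_le : 3 ≤ n
  d_comm (x : A) : ↑d * x = x * ↑d
  R_sq (i : ℕ) : R i * R i = 1
  R_far (i j : ℕ) : i + 2 ≤ j → R i * R j = R j * R i
  R_braid (i : ℕ) : 1 ≤ i → i + 1 < n → R i * R (i + 1) * R i = R (i + 1) * R i * R (i + 1)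
  R_mul_e (i : ℕ) : i < n → ↑(R i) * e i = e i
  e_mul_R (i : ℕ) : i < n → e i * ↑(R i) = e i
  e_sq (i : ℕ) : 0 < i → i < n → e i * e i = ↑d * e i
  e_zero_sq : e 0 * e 0 = ↑d * (↑d * e 0)
  R_e_far (i j : ℕ) : i + 2 ≤ j ∨ j + 2 ≤ i → i < n → j < n → ↑(R j) * e i = e i * ↑(R j)
  e_far (i j : ℕ) : i + 2 ≤ j → j < n → e i * e j = e j * e i
  RRe : ↑(R 2) * ↑(R 1) * e 2 = e 1 * e 2
  ReR (i : ℕ) : 1 ≤ i → i + 1 < n → ↑(R i) * e (i + 1) * ↑(R i) = ↑(R (i + 1)) * e i * ↑(R (i + 1))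
  R_braid_zero : R 1 * R 0 * R 1 * R 0 = R 0 * R 1 * R 0 * R 1
  R01e0 : ↑(R 0) * ↑(R 1) * e 0 = ↑(R 1) * e 0
  R0e1R0e1 : ↑(R 0) * e 1 * ↑(R 0) * e 1 = e 1 * e 0 * e 1
  R010e1 : ↑(R 0) * ↑(R 1) * ↑(R 0) * e 1 = e 1 * (↑(R 0) * ↑(R 1) * ↑(R 0))
  e0R1e0 : e 0 * ↑(R 1) * e 0 = ↑d * e 0
  e0e1e0 : e 0 * e 1 * e 0 = ↑d * e 0
  e0R1R0 : e 0 * ↑(R 1) * ↑(R 0) = e 0 * ↑(R 1)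
  e0e1R0 : e 0 * e 1 * ↑(R 0) = e 0 * e 1

namespace BrauerData

open ConjAct Equiv

variable {n : ℕ} {A : Type*} [Monoid A] (B : BrauerData n A)

/-- The generators `R i` as operators acting by conjugation. -/
def ρ (i : ℕ) : ConjAct Aˣ := toConjAct (B.R i)

theorem braidFamily : BraidFamily n B.ρ where
  sq i := by rw [ρ, ← toConjAct_mul, B.R_sq, toConjAct_one]
  far i j h := by simp only [ρ, ← toConjAct_mul, B.R_far i j h]
  braid i h h' := by simp only [ρ, ← toConjAct_mul, B.R_braid i h h']

theorem R_inv (i : ℕ) : (B.R i)⁻¹ = B.R i := inv_eq_of_mul_eq_one_left (B.R_sq i)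

theorem ρ_smul (i : ℕ) (x : A) : B.ρ i • x = ↑(B.R i) * x * ↑(B.R i) := by
  rw [ρ, units_smul_def, ofConjAct_toConjAct, B.R_inv]

theorem ρ_smul_unit (i : ℕ) (x : Aˣ) : B.ρ i • x = B.R i * x * B.R i := by
  rw [ρ, ConjAct.smul_def, ofConjAct_toConjAct, B.R_inv]

theorem R_mul_R_mul (i : ℕ) (x : A) : ↑(B.R i) * (↑(B.R i) * x) = x := by
  rw [← mul_assoc, ← Units.val_mul, B.R_sq, Units.val_one, one_mul]

theorem R_mul_R (i : ℕ) : (↑(B.R i) * ↑(B.R i) : A) = 1 := by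
  rw [← Units.val_mul, B.R_sq, Units.val_one]

theorem ρ_smul_eq_self {i : ℕ} {x : A} (h : ↑(B.R i) * x = x * ↑(B.R i)) : B.ρ i • x = x := by
  rw [ρ_smul, h, mul_assoc, B.R_mul_R, mul_one]

theorem edgeFamily : EdgeFamily n B.ρ (fun i => B.e (i + 1)) where
  self i h := by rw [ρ_smul, B.R_mul_e _ h, B.e_mul_R _ h]
  right i k h hk h' := B.ρ_smul_eq_self (B.R_e_far _ _ (by omega) h hk)
  left i k h hk h' := B.ρ_smul_eq_self (B.R_e_far _ _ (by omega) h (by omega))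
  shift i h := by
    rw [B.ρ_smul (i + 2), ← B.ReR (i + 1) (by omega) h, ← ρ_smul, B.braidFamily.smul_smul_self]

/-- The element `e_β` for the short positive root `β` attached to a point. -/
def E (a : Fin n) : A := pointOrbit B.ρ (B.e 0) a

/-- The sign change at a point. -/
def S (a : Fin n) : Aˣ := pointOrbit B.ρ (B.R 0) a

/-- The element `e_β` for the long positive root `β = ε_a - ε_b`. -/
def P (a b : Fin n) : A := pairOf B.ρ (fun i => B.e (i + 1)) a b

theorem P_comm (a b : Fin n) : B.P a b = B.P b a := pairOf_comm _ _ _ _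

/-- The group generated by `d` and `R 0, …, R (n - 1)`. -/
def W : Subgroup Aˣ := Subgroup.closure (insert B.d {u | ∃ i < n, u = B.R i})

theorem d_mem_W : B.d ∈ B.W := Subgroup.subset_closure (.inl rfl)

theorem R_mem_W {i : ℕ} (hi : i < n) : B.R i ∈ B.W := Subgroup.subset_closure (.inr ⟨i, hi, rfl⟩)

theorem S_mem_W (a : Fin n) : B.S a ∈ B.W := by
  obtain ⟨i, hi⟩ := a
  change pointOrbit B.ρ (B.R 0) i ∈ B.W
  induction i with
  | zero => exact B.R_mem_W hi
  | succ i ih =>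
    rw [pointOrbit, ρ_smul_unit]
    exact mul_mem (mul_mem (B.R_mem_W hi) (ih (by omega))) (B.R_mem_W hi)

/-- The unit `u` permutes the points as `σ` does. -/
structure Lifts (u : Aˣ) (σ : Perm (Fin n)) : Prop where
  mem : u ∈ B.W
  E (a : Fin n) : toConjAct u • B.E a = B.E (σ a)
  S (a : Fin n) : toConjAct u • B.S a = B.S (σ a)
  P (a b : Fin n) : a ≠ b → toConjAct u • B.P a b = B.P (σ a) (σ b)

variable {B}

theorem Lifts.one : B.Lifts 1 1 where
  mem := one_mem _
  E a := by simp
  S a := by simp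
  P a b _ := by simp

theorem Lifts.mul {u v : Aˣ} {σ τ : Perm (Fin n)} (hu : B.Lifts u σ) (hv : B.Lifts v τ) :
    B.Lifts (u * v) (σ * τ) where
  mem := mul_mem hu.mem hv.mem
  E a := by rw [toConjAct_mul, mul_smul, hv.E, hu.E, Perm.mul_apply]
  S a := by rw [toConjAct_mul, mul_smul, hv.S, hu.S, Perm.mul_apply]
  P a b h := by
    rw [toConjAct_mul, mul_smul, hv.P _ _ h, hu.P _ _ (τ.injective.ne h), Perm.mul_apply,
      Perm.mul_apply]

theorem Lifts.inv {u : Aˣ} {σ : Perm (Fin n)} (hu : B.Lifts u σ) : B.Lifts u⁻¹ σ⁻¹ where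
  mem := inv_mem hu.mem
  E a := by rw [toConjAct_inv, inv_smul_eq_iff, hu.E, Perm.inv_def, apply_symm_apply]
  S a := by rw [toConjAct_inv, inv_smul_eq_iff, hu.S, Perm.inv_def, apply_symm_apply]
  P a b h := by
    rw [toConjAct_inv, inv_smul_eq_iff, Perm.inv_def, hu.P _ _ (σ.symm.injective.ne h),
      apply_symm_apply, apply_symm_apply]

variable (B)

theorem lifts_R {k : ℕ} (hk : k + 1 < n) :
    B.Lifts (B.R (k + 1)) (swap ⟨k, by omega⟩ ⟨k + 1, hk⟩) := by
  have hs (a : Fin n) : swap k (k + 1) a.val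
      = (swap (⟨k, by omega⟩ : Fin n) ⟨k + 1, hk⟩ a).val := by
    simp only [swap_apply_def, Fin.ext_iff]
    split_ifs <;> rfl
  refine ⟨B.R_mem_W hk, fun a => ?_, fun a => ?_, fun a b hab => ?_⟩
  · refine (smul_pointOrbit B.braidFamily (fun k h hk => ?_) hk a.2).trans (by rw [hs]; rfl)
    exact B.ρ_smul_eq_self (B.R_e_far _ _ (by omega) (by omega) hk)
  · refine (smul_pointOrbit B.braidFamily (fun k h hk => ?_) hk a.2).trans (by rw [hs]; rfl)
    rw [ρ_smul_unit, ← B.R_far 0 k (by omega), mul_assoc, B.R_sq, mul_one]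
  · refine (smul_pairOf B.braidFamily B.edgeFamily hk (Fin.val_injective.ne hab) a.2 b.2).trans
      (by rw [hs, hs]; rfl)

theorem exists_lifts (σ : Perm (Fin n)) : ∃ u, B.Lifts u σ := by
  obtain ⟨m, rfl⟩ : ∃ m, n = m + 1 := ⟨n - 1, by have := B.three_le; omega⟩
  have hσ : σ ∈ Submonoid.closure (Set.range fun i : Fin m => swap i.castSucc i.succ) := by
    rw [Perm.mclosure_swap_castSucc_succ]; trivial
  induction hσ using Submonoid.closure_induction with
  | mem _ h =>
    obtain ⟨i, rfl⟩ := h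
    exact ⟨_, B.lifts_R (k := i) (by omega)⟩
  | one => exact ⟨1, .one⟩
  | mul _ _ _ _ h h' =>
    obtain ⟨u, hu⟩ := h
    obtain ⟨v, hv⟩ := h'
    exact ⟨_, hu.mul hv⟩

theorem smul_unit_val (g : ConjAct Aˣ) (u : Aˣ) : g • (u : A) = ((g • u : Aˣ) : A) := by
  rw [units_smul_def, ConjAct.smul_def]; simp

theorem smul_d (g : ConjAct Aˣ) : g • (B.d : A) = B.d := by
  rw [units_smul_def, ← B.d_comm, mul_assoc, Units.mul_inv, mul_one]

theorem exists_lifts_map {l l' : List (Fin n)} (h : l.Nodup) (h' : l'.Nodup)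
    (hl : l.length = l'.length) : ∃ u σ, B.Lifts u σ ∧ l.map σ = l' := by
  obtain ⟨σ, hσ⟩ := h.exists_perm_map_eq h' hl
  obtain ⟨u, hu⟩ := B.exists_lifts σ
  exact ⟨u, σ, hu, hσ⟩

/-- One of the first three points. -/
def pt (i : Fin 3) : Fin n := ⟨i, i.2.trans_le B.three_le⟩

theorem pt_injective : Function.Injective B.pt := fun i j h => by
  simpa [pt, Fin.ext_iff] using h

theorem pt_zero_ne_one : B.pt 0 ≠ B.pt 1 := B.pt_injective.ne (by decide)

theorem pt_one_ne_two : B.pt 1 ≠ B.pt 2 := B.pt_injective.ne (by decide)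

theorem exists_lifts_pair {a b : Fin n} (h : a ≠ b) :
    ∃ u σ, B.Lifts u σ ∧ σ (B.pt 0) = a ∧ σ (B.pt 1) = b := by
  obtain ⟨u, σ, hu, hσ⟩ := B.exists_lifts_map (l := [B.pt 0, B.pt 1]) (l' := [a, b])
    (by simpa using B.pt_zero_ne_one) (by simpa using h) rfl
  exact ⟨u, σ, hu, by simpa using hσ⟩

theorem exists_lifts_triple {a b c : Fin n} (hab : a ≠ b) (hac : a ≠ c) (hbc : b ≠ c) :
    ∃ u σ, B.Lifts u σ ∧ σ (B.pt 0) = a ∧ σ (B.pt 1) = b ∧ σ (B.pt 2) = c := by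
  obtain ⟨u, σ, hu, hσ⟩ := B.exists_lifts_map (l := [B.pt 0, B.pt 1, B.pt 2]) (l' := [a, b, c])
    (by simp [B.pt_injective.eq_iff]) (by simp [hab, hac, hbc]) rfl
  exact ⟨u, σ, hu, by simpa using hσ⟩

theorem E_zero : B.E (B.pt 0) = B.e 0 := rfl

theorem E_one : B.E (B.pt 1) = B.R 1 * B.e 0 * B.R 1 := B.ρ_smul _ _

theorem S_zero : B.S (B.pt 0) = B.R 0 := rfl

theorem S_one : B.S (B.pt 1) = B.R 1 * B.R 0 * B.R 1 := B.ρ_smul_unit _ _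

theorem S_two : B.S (B.pt 2) = B.R 2 * (B.R 1 * B.R 0 * B.R 1) * B.R 2 := by
  rw [← S_one]; exact B.ρ_smul_unit _ _

theorem P_zero_one : B.P (B.pt 0) (B.pt 1) = B.e 1 := rfl

theorem P_one_two : B.P (B.pt 1) (B.pt 2) = B.e 2 := rfl

theorem eq_of_d_mul_eq {x y : A} (h : ↑B.d * x = ↑B.d * y) : x = y :=
  (Units.mul_right_inj _).1 h

theorem one_lt (B : BrauerData n A) : 1 < n := by have := B.three_le; omega

theorem two_lt (B : BrauerData n A) : 2 < n := B.three_le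

theorem e1_e2 : B.e 1 * B.e 2 = B.e 1 * (↑(B.R 2) * ↑(B.R 1)) := by
  have h := congrArg (· * (B.R 1 : A)) (B.ReR 1 le_rfl B.three_le)
  simp only [mul_assoc, B.R_mul_R, mul_one] at h
  rw [← B.RRe, mul_assoc, h, B.R_mul_R_mul]

theorem e1R0e1 : B.e 1 * ↑(B.R 0) * B.e 1 = B.e 1 * B.e 0 * B.e 1 := by
  have h1 : B.e 1 * ↑(B.R 0) * B.e 1 * ↑(B.R 0) = B.e 1 * ↑(B.R 0) * B.e 1 := by
    have h := congrArg (fun x : A => (B.R 0 : A) * (B.e 1 * x)) B.e0e1R0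
    simp only [← mul_assoc] at h
    have h' := congrArg (fun x : A => (B.R 0 : A) * x) B.R0e1R0e1
    simp only [← mul_assoc] at h'
    rw [← h', B.R_mul_R, one_mul] at h
    exact h
  refine B.eq_of_d_mul_eq ?_
  have he := B.e_sq 1 one_pos B.one_lt
  calc ↑B.d * (B.e 1 * ↑(B.R 0) * B.e 1)
      = B.e 1 * ↑(B.R 0) * (B.e 1 * B.e 1) := by rw [he, B.d_comm, B.d_comm, mul_assoc]
    _ = B.e 1 * (↑(B.R 0) * B.e 1 * ↑(B.R 0) * B.e 1) := by rw [← mul_assoc, ← h1]; simp only [mul_assoc]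
    _ = (B.e 1 * B.e 1) * (B.e 0 * B.e 1) := by rw [B.R0e1R0e1]; simp only [mul_assoc]
    _ = _ := by rw [he]; simp only [mul_assoc]

theorem E_sq (a : Fin n) : B.E a * B.E a = ↑B.d * (↑B.d * B.E a) := by
  obtain ⟨u, σ, hu, hσ⟩ := B.exists_lifts_map (l := [B.pt 0]) (l' := [a])
    (by simp) (by simp) rfl
  obtain rfl : σ (B.pt 0) = a := by simpa using hσ
  have h := congrArg (toConjAct u • ·) B.e_zero_sq
  simpa only [smul_mul', ← E_zero, smul_d, hu.E] using h

theorem P_sq {a b : Fin n} (hab : a ≠ b) : B.P a b * B.P a b = ↑B.d * B.P a b := by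
  obtain ⟨u, σ, hu, rfl, rfl⟩ := B.exists_lifts_pair hab
  have h := congrArg (toConjAct u • ·) (B.e_sq 1 one_pos B.one_lt)
  simpa only [smul_mul', ← P_zero_one, smul_d, hu.P _ _ B.pt_zero_ne_one] using h

theorem E_mul_P_mul_E {a b : Fin n} (hab : a ≠ b) : B.E a * B.P a b * B.E a = ↑B.d * B.E a := by
  obtain ⟨u, σ, hu, rfl, rfl⟩ := B.exists_lifts_pair hab
  have h := congrArg (toConjAct u • ·) B.e0e1e0
  simpa only [smul_mul', ← E_zero, ← P_zero_one, smul_d, hu.P _ _ B.pt_zero_ne_one, hu.E] using h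

theorem P_mul_S_mul_P {a b : Fin n} (hab : a ≠ b) :
    B.P a b * B.S a * B.P a b = B.P a b * B.E a * B.P a b := by
  obtain ⟨u, σ, hu, rfl, rfl⟩ := B.exists_lifts_pair hab
  have h := congrArg (toConjAct u • ·) B.e1R0e1
  simpa only [smul_mul', ← E_zero, ← P_zero_one, ← S_zero, smul_unit_val, hu.P _ _ B.pt_zero_ne_one, hu.E,
    hu.S] using h

theorem E_mul_P_mul_S {a b : Fin n} (hab : a ≠ b) :
    B.E a * B.P a b * B.S a = B.E a * B.P a b := by
  obtain ⟨u, σ, hu, rfl, rfl⟩ := B.exists_lifts_pair hab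
  have h := congrArg (toConjAct u • ·) B.e0e1R0
  simpa only [smul_mul', ← E_zero, ← P_zero_one, ← S_zero, smul_unit_val, hu.P _ _ B.pt_zero_ne_one, hu.E,
    hu.S] using h

theorem E_mul_S (a b : Fin n) : B.E a * B.S b = B.E a := by
  obtain rfl | hab := eq_or_ne a b
  · obtain ⟨u, σ, hu, hσ⟩ := B.exists_lifts_map (l := [B.pt 0]) (l' := [a])
      (by simp) (by simp) rfl
    obtain rfl : σ (B.pt 0) = a := by simpa using hσ
    have h := congrArg (toConjAct u • ·) (B.e_mul_R 0 (by have := B.three_le; omega))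
    simpa only [smul_mul', ← E_zero, ← S_zero, smul_unit_val, hu.E, hu.S] using h
  · obtain ⟨u, σ, hu, rfl, rfl⟩ := B.exists_lifts_pair hab
    have h1 : B.E (B.pt 0) * B.S (B.pt 1) = B.E (B.pt 0) := by
      rw [S_one, E_zero, Units.val_mul, Units.val_mul, ← mul_assoc, ← mul_assoc, B.e0R1R0,
        mul_assoc, B.R_mul_R, mul_one]
    have h := congrArg (toConjAct u • ·) h1
    simpa only [smul_mul', smul_unit_val, hu.E, hu.S] using h

theorem S_mul_E (a b : Fin n) : B.S b * B.E a = B.E a := by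
  obtain rfl | hab := eq_or_ne a b
  · obtain ⟨u, σ, hu, hσ⟩ := B.exists_lifts_map (l := [B.pt 0]) (l' := [a])
      (by simp) (by simp) rfl
    obtain rfl : σ (B.pt 0) = a := by simpa using hσ
    have h := congrArg (toConjAct u • ·) (B.R_mul_e 0 (by have := B.three_le; omega))
    simpa only [smul_mul', ← E_zero, ← S_zero, smul_unit_val, hu.E, hu.S] using h
  · obtain ⟨u, σ, hu, rfl, rfl⟩ := B.exists_lifts_pair hab
    have h1 : B.S (B.pt 1) * B.E (B.pt 0) = B.E (B.pt 0) := by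
      rw [S_one, E_zero, Units.val_mul, Units.val_mul, mul_assoc, mul_assoc, ← mul_assoc (B.R 0 : A),
        B.R01e0, B.R_mul_R_mul]
    have h := congrArg (toConjAct u • ·) h1
    simpa only [smul_mul', smul_unit_val, hu.E, hu.S] using h

theorem S_sq (a : Fin n) : B.S a * B.S a = 1 := by
  obtain ⟨i, hi⟩ := a
  change pointOrbit B.ρ (B.R 0) i * pointOrbit B.ρ (B.R 0) i = 1
  clear hi
  induction i with
  | zero => exact B.R_sq 0
  | succ i ih => rw [pointOrbit, ← smul_mul', ih, smul_one]

theorem S_comm (a b : Fin n) : B.S a * B.S b = B.S b * B.S a := by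
  obtain rfl | hab := eq_or_ne a b
  · rfl
  · obtain ⟨u, σ, hu, rfl, rfl⟩ := B.exists_lifts_pair hab
    have h1 : B.S (B.pt 0) * B.S (B.pt 1) = B.S (B.pt 1) * B.S (B.pt 0) := by
      rw [S_one, S_zero, B.R_braid_zero, mul_assoc, mul_assoc, mul_assoc]
    have h := congrArg (toConjAct u • ·) h1
    simpa only [smul_mul', hu.S] using h

theorem S_mul_S_mul_P {a b : Fin n} (hab : a ≠ b) :
    B.S a * (B.S b * B.P a b) = B.P a b * (B.S a * B.S b) := by
  obtain ⟨u, σ, hu, rfl, rfl⟩ := B.exists_lifts_pair hab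
  have h1 : (B.S (B.pt 0) : A) * (B.S (B.pt 1) * B.P (B.pt 0) (B.pt 1))
      = B.P (B.pt 0) (B.pt 1) * (B.S (B.pt 0) * B.S (B.pt 1)) := by
    have h2 := B.R010e1
    rw [← Units.val_mul (B.S _) (B.S _), B.S_comm, S_one, S_zero, P_zero_one]
    simp only [Units.val_mul, mul_assoc] at h2 ⊢
    rw [B.R_mul_e 1 B.one_lt, h2, ← mul_assoc (B.e 1) (B.R 1 : A), B.e_mul_R 1 B.one_lt]
  have h := congrArg (toConjAct u • ·) h1
  simpa only [smul_mul', hu.S, smul_unit_val, hu.P _ _ B.pt_zero_ne_one] using h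

theorem S_mul_P {a b c : Fin n} (hab : a ≠ b) (hac : a ≠ c) (hbc : b ≠ c) :
    B.S c * B.P a b = B.P a b * B.S c := by
  obtain ⟨u, σ, hu, rfl, rfl, rfl⟩ := B.exists_lifts_triple hab hac hbc
  have h1 : B.S (B.pt 2) * B.P (B.pt 0) (B.pt 1) = B.P (B.pt 0) (B.pt 1) * B.S (B.pt 2) := by
    have h3 : ↑(B.R 1) * (↑(B.R 2) * (B.e 1 * (↑(B.R 2) * ↑(B.R 1)))) = B.e 2 := by
      have := B.edgeFamily.shift 0 B.two_lt
      simpa only [ρ_smul, mul_assoc] using this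
    have h2 := B.R_e_far 2 0 (by omega) B.two_lt (by have := B.three_le; omega)
    rw [← h3] at h2
    have h4 := congrArg (fun x : A => (B.R 2 : A) * ((B.R 1 : A) * (x * ((B.R 1 : A) * (B.R 2 : A))))) h2
    simp only [mul_assoc, B.R_mul_R_mul, B.R_mul_R, mul_one] at h4
    rw [S_two, P_zero_one]
    simpa only [Units.val_mul, mul_assoc] using h4
  have h := congrArg (toConjAct u • ·) h1
  simpa only [smul_mul', hu.S, smul_unit_val, hu.P _ _ B.pt_zero_ne_one] using h

theorem E_mul_P {a b c : Fin n} (hab : a ≠ b) (hac : a ≠ c) (hbc : b ≠ c) :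
    B.E a * B.P b c = B.P b c * B.E a := by
  obtain ⟨u, σ, hu, rfl, rfl, rfl⟩ := B.exists_lifts_triple hab hac hbc
  have h := congrArg (toConjAct u • ·) (B.e_far 0 2 le_rfl B.two_lt)
  simpa only [smul_mul', ← E_zero, ← P_one_two, hu.E, hu.P _ _ B.pt_one_ne_two] using h

theorem P_mul_P_comm {a b c d : Fin n} (h : [a, b, c, d].Nodup) :
    B.P a b * B.P c d = B.P c d * B.P a b := by
  have hn : 4 ≤ n := by simpa using h.length_le_card
  obtain ⟨u, σ, hu, hσ⟩ := B.exists_lifts_map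
    (l := [⟨0, by omega⟩, ⟨1, by omega⟩, ⟨2, by omega⟩, ⟨3, by omega⟩]) (by simp) h rfl
  simp only [List.map_cons, List.map_nil, List.cons.injEq, and_true] at hσ
  obtain ⟨rfl, rfl, rfl, rfl⟩ := hσ
  rw [← hu.P _ _ (by simp), ← hu.P _ _ (by simp), ← smul_mul', ← smul_mul']
  exact congrArg _ (B.e_far 1 3 le_rfl (by omega))

theorem exists_swap {a b : Fin n} (hab : a ≠ b) : ∃ t, B.Lifts t (swap a b) ∧
    B.E a * B.E b = ↑B.d * (B.E a * ↑t) ∧ ↑t * B.P a b = B.P a b ∧ B.P a b * ↑t = B.P a b := by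
  obtain ⟨u, σ, hu, rfl, rfl⟩ := B.exists_lifts_pair hab
  have ht : B.Lifts (B.R 1) (swap (B.pt 0) (B.pt 1)) := B.lifts_R B.one_lt
  have hval : toConjAct u • (B.R 1 : A) = ↑(u * B.R 1 * u⁻¹) := by
    simp only [units_smul_def, ofConjAct_toConjAct, Units.val_mul]
  refine ⟨u * B.R 1 * u⁻¹, ?_, ?_, ?_, ?_⟩
  · rw [swap_apply_apply]
    exact (hu.mul ht).mul hu.inv
  · have h1 : B.E (B.pt 0) * B.E (B.pt 1) = ↑B.d * (B.E (B.pt 0) * ↑(B.R 1)) := by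
      rw [E_zero, E_one, ← mul_assoc, ← mul_assoc, B.e0R1e0, mul_assoc]
    have h := congrArg (toConjAct u • ·) h1
    simpa only [smul_mul', hu.E, smul_d, hval] using h
  · have h := congrArg (toConjAct u • ·) (B.R_mul_e 1 B.one_lt)
    simpa only [smul_mul', ← P_zero_one, hu.P _ _ B.pt_zero_ne_one, hval] using h
  · have h := congrArg (toConjAct u • ·) (B.e_mul_R 1 B.one_lt)
    simpa only [smul_mul', ← P_zero_one, hu.P _ _ B.pt_zero_ne_one, hval] using h

theorem exists_cycle {a b c : Fin n} (hab : a ≠ b) (hac : a ≠ c) (hbc : b ≠ c) :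
    ∃ t, B.Lifts t (swap b c * swap a b) ∧ B.P a b * B.P b c = B.P a b * ↑t := by
  obtain ⟨u, σ, hu, rfl, rfl, rfl⟩ := B.exists_lifts_triple hab hac hbc
  have ht : B.Lifts (B.R 2 * B.R 1) (swap (B.pt 1) (B.pt 2) * swap (B.pt 0) (B.pt 1)) :=
    (B.lifts_R B.two_lt).mul (B.lifts_R B.one_lt)
  have hval : toConjAct u • ((B.R 2 : A) * B.R 1) = ↑(u * (B.R 2 * B.R 1) * u⁻¹) := by
    simp only [units_smul_def, ofConjAct_toConjAct, Units.val_mul]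
  refine ⟨u * (B.R 2 * B.R 1) * u⁻¹, ?_, ?_⟩
  · have := (hu.mul ht).mul hu.inv
    convert this using 1
    rw [swap_apply_apply, swap_apply_apply]
    group
  · have h := congrArg (toConjAct u • ·) B.e1_e2
    rw [smul_mul', smul_mul', hval, ← P_zero_one, ← P_one_two, hu.P _ _ B.pt_zero_ne_one,
      hu.P _ _ B.pt_one_ne_two] at h
    exact h

variable {B}

theorem smul_eq_iff {u : Aˣ} {x y : A} : toConjAct u • x = y ↔ ↑u * x = y * ↑u := by
  rw [units_smul_def, ofConjAct_toConjAct, Units.mul_inv_eq_iff_eq_mul]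

theorem Lifts.mul_E {u : Aˣ} {σ : Perm (Fin n)} (hu : B.Lifts u σ) (a : Fin n) :
    ↑u * B.E a = B.E (σ a) * ↑u := smul_eq_iff.1 (hu.E a)

theorem Lifts.mul_P {u : Aˣ} {σ : Perm (Fin n)} (hu : B.Lifts u σ) {a b : Fin n} (h : a ≠ b) :
    ↑u * B.P a b = B.P (σ a) (σ b) * ↑u := smul_eq_iff.1 (hu.P a b h)

theorem Lifts.mul_S {u : Aˣ} {σ : Perm (Fin n)} (hu : B.Lifts u σ) (a : Fin n) :
    u * B.S a = B.S (σ a) * u := by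
  rw [← hu.S, ConjAct.smul_def, ofConjAct_toConjAct, inv_mul_cancel_right]

/-- The points occurring in a list of pairs. -/
def pts (L : List (Fin n × Fin n)) : List (Fin n) := L.flatMap fun p => [p.1, p.2]

variable (B) in
/-- The product of the elements `P a b` over a list of pairs. -/
def prod (L : List (Fin n × Fin n)) : A := (L.map fun p => B.P p.1 p.2).prod

@[simp] theorem pts_nil : pts ([] : List (Fin n × Fin n)) = [] := rfl

@[simp] theorem pts_cons (a b : Fin n) (L : List (Fin n × Fin n)) :
    pts ((a, b) :: L) = a :: b :: pts L := rfl

@[simp] theorem prod_nil : B.prod [] = 1 := rfl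

theorem prod_cons (a b : Fin n) (L : List (Fin n × Fin n)) :
    B.prod ((a, b) :: L) = B.P a b * B.prod L := List.prod_cons

theorem commute_E_prod {a : Fin n} {L : List (Fin n × Fin n)} (h : (a :: pts L).Nodup) :
    Commute (B.E a) (B.prod L) := by
  induction L with
  | nil => exact Commute.one_right _
  | cons p L ih =>
    obtain ⟨x, y⟩ := p
    simp only [pts_cons, List.nodup_cons, List.mem_cons, not_or] at h ih
    rw [prod_cons]
    exact Commute.mul_right (B.E_mul_P h.1.1 h.1.2.1 h.2.1.1) (ih ⟨h.1.2.2, h.2.2.2⟩)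

theorem commute_S_prod {a : Fin n} {L : List (Fin n × Fin n)} (h : (a :: pts L).Nodup) :
    Commute (B.S a : A) (B.prod L) := by
  induction L with
  | nil => exact Commute.one_right _
  | cons p L ih =>
    obtain ⟨x, y⟩ := p
    simp only [pts_cons, List.nodup_cons, List.mem_cons, not_or] at h ih
    rw [prod_cons]
    exact Commute.mul_right (B.S_mul_P h.2.1.1 (Ne.symm h.1.1) (Ne.symm h.1.2.1))
      (ih ⟨h.1.2.2, h.2.2.2⟩)

theorem commute_P_prod {a b : Fin n} {L : List (Fin n × Fin n)} (h : (a :: b :: pts L).Nodup) :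
    Commute (B.P a b) (B.prod L) := by
  induction L with
  | nil => exact Commute.one_right _
  | cons p L ih =>
    obtain ⟨x, y⟩ := p
    rw [prod_cons]
    refine Commute.mul_right (B.P_mul_P_comm ?_) (ih ?_) <;>
    · simp only [pts_cons, List.nodup_cons, List.mem_cons, not_or] at h ⊢
      simp [h]

theorem Lifts.commute_prod {u : Aˣ} {σ : Perm (Fin n)} (hu : B.Lifts u σ)
    {L : List (Fin n × Fin n)} (h : (pts L).Nodup) (hσ : ∀ a ∈ pts L, σ a = a) :
    Commute (u : A) (B.prod L) := by
  induction L with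
  | nil => exact Commute.one_right _
  | cons p L ih =>
    obtain ⟨x, y⟩ := p
    simp only [pts_cons, List.nodup_cons, List.mem_cons, not_or, forall_eq_or_imp] at h ih hσ
    rw [prod_cons]
    refine Commute.mul_right ?_ (ih h.2.2 hσ.2.2)
    have := hu.mul_P h.1.1
    rwa [hσ.1, hσ.2.1] at this

theorem Lifts.mul_prod {u : Aˣ} {σ : Perm (Fin n)} (hu : B.Lifts u σ)
    {L : List (Fin n × Fin n)} (h : (pts L).Nodup) :
    ↑u * B.prod L = B.prod (L.map (Prod.map σ σ)) * ↑u := by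
  induction L with
  | nil => simp
  | cons p L ih =>
    obtain ⟨x, y⟩ := p
    simp only [pts_cons, List.nodup_cons, List.mem_cons, not_or] at h
    rw [List.map_cons, Prod.map_apply, prod_cons, prod_cons, ← mul_assoc, hu.mul_P h.1.1,
      mul_assoc, ih h.2.2, mul_assoc]

theorem pts_map (σ : Perm (Fin n)) (L : List (Fin n × Fin n)) :
    pts (L.map (Prod.map σ σ)) = (pts L).map σ := by
  induction L with
  | nil => rfl
  | cons p L ih => simpa [Prod.map, pts] using ih

theorem exists_prod_eq_of_mem {a : Fin n} {L : List (Fin n × Fin n)} (h : (pts L).Nodup)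
    (ha : a ∈ pts L) :
    ∃ c L', B.prod L = B.P a c * B.prod L' ∧ (a :: c :: pts L').Perm (pts L) := by
  induction L with
  | nil => simp at ha
  | cons p L ih =>
    obtain ⟨x, y⟩ := p
    rw [pts_cons] at h ha
    obtain rfl | rfl | ha : a = x ∨ a = y ∨ a ∈ pts L := by simpa using ha
    · exact ⟨y, L, prod_cons _ _ _, .refl _⟩
    · exact ⟨x, L, by rw [prod_cons, P_comm], .swap _ _ _⟩
    · obtain ⟨c, L', hL, hp⟩ := ih h.of_cons.of_cons ha
      refine ⟨c, (x, y) :: L', ?_, ?_⟩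
      · have hx : [x, y, a, c].Nodup := by
          have : (x :: y :: a :: c :: pts L').Nodup :=
            (((hp.cons y).cons x).nodup_iff).2 h
          exact this.sublist (by simp)
        rw [prod_cons, prod_cons, hL, ← mul_assoc, ← mul_assoc, B.P_mul_P_comm hx]
      · rw [pts_cons]
        refine .trans ?_ ((hp.cons y).cons x)
        exact (List.perm_append_comm (l₁ := [a, c]) (l₂ := [x, y])).append_right (pts L')

theorem exists_prod_mul_P_eq_of_mem {x y : Fin n} {L : List (Fin n × Fin n)} (h : (pts L).Nodup)
    (hxy : x ≠ y) (hx : x ∈ pts L) : ∃ v ∈ B.W, B.prod L * B.P x y = B.prod L * ↑v := by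
  obtain ⟨c, L', hL, hp⟩ := exists_prod_eq_of_mem (B := B) h hx
  have hn := hp.nodup_iff.2 h
  have hc := commute_P_prod (B := B) hn
  obtain rfl | hcy := eq_or_ne c y
  · exact ⟨B.d, B.d_mem_W, by
      rw [hL, mul_assoc, ← hc.eq, ← mul_assoc, B.P_sq hxy, mul_assoc, B.d_comm, mul_assoc]⟩
  · have hxc : x ≠ c := by rintro rfl; simp at hn
    obtain ⟨t, ht, h'⟩ := B.exists_cycle hxc.symm hcy hxy
    refine ⟨t, ht.mem, ?_⟩
    rw [hL, hc.eq, mul_assoc, B.P_comm x c, h', mul_assoc]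

theorem exists_prod_mul_P_eq {x y : Fin n} {L : List (Fin n × Fin n)} (h : (pts L).Nodup)
    (hxy : x ≠ y) (hx : x ∈ pts L ∨ y ∈ pts L) :
    ∃ v ∈ B.W, B.prod L * B.P x y = B.prod L * ↑v := by
  obtain hx | hx := hx
  · exact exists_prod_mul_P_eq_of_mem h hxy hx
  · rw [B.P_comm]
    exact exists_prod_mul_P_eq_of_mem h hxy.symm hx

variable (B) in
/-- Representatives of the elements of the monoid up to multiplication by units. -/
inductive Core : A → Prop
  | prod {L : List (Fin n × Fin n)} : (pts L).Nodup → Core (B.prod L)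
  | E {a : Fin n} {L : List (Fin n × Fin n)} : (a :: pts L).Nodup → Core (B.E a * B.prod L)
  | EP {a b : Fin n} {L : List (Fin n × Fin n)} : (a :: b :: pts L).Nodup →
      Core (B.E a * B.P a b * B.prod L)
  | PE {a b : Fin n} {L : List (Fin n × Fin n)} : (a :: b :: pts L).Nodup →
      Core (B.P a b * (B.E a * B.prod L))
  | PEP {a b : Fin n} {L : List (Fin n × Fin n)} : (a :: b :: pts L).Nodup →
      Core (B.P a b * (B.E a * B.P a b * B.prod L))
  | PEP' {a b c : Fin n} {L : List (Fin n × Fin n)} : (a :: b :: c :: pts L).Nodup →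
      Core (B.P a c * (B.E a * B.P a b * B.prod L))

variable (B) in
/-- The elements of the monoid that are representatives up to multiplication by units. -/
def Good (x : A) : Prop := ∃ u ∈ B.W, ∃ v ∈ B.W, ∃ f, B.Core f ∧ x = ↑u * f * ↑v

theorem Core.good {f : A} (h : B.Core f) : B.Good f :=
  ⟨1, one_mem _, 1, one_mem _, f, h, by simp⟩

theorem Good.mul_unit {x : A} (h : B.Good x) {w : Aˣ} (hw : w ∈ B.W) : B.Good (x * ↑w) := by
  obtain ⟨u, hu, v, hv, f, hf, rfl⟩ := h
  exact ⟨u, hu, v * w, mul_mem hv hw, f, hf, by simp [mul_assoc]⟩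

theorem Good.unit_mul {x : A} (h : B.Good x) {w : Aˣ} (hw : w ∈ B.W) : B.Good (↑w * x) := by
  obtain ⟨u, hu, v, hv, f, hf, rfl⟩ := h
  exact ⟨w * u, mul_mem hw hu, v, hv, f, hf, by simp [mul_assoc]⟩

theorem Good.mul_prod_mul_P {x : A} {L : List (Fin n × Fin n)} (h : B.Good (x * B.prod L))
    (hL : (pts L).Nodup) {a b : Fin n} (hab : a ≠ b) (ha : a ∈ pts L ∨ b ∈ pts L) :
    B.Good (x * (B.prod L * B.P a b)) := by
  obtain ⟨v, hv, h'⟩ := exists_prod_mul_P_eq (B := B) hL hab ha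
  rw [h', ← mul_assoc]
  exact h.mul_unit hv

theorem prod_mul_P {a b : Fin n} {L : List (Fin n × Fin n)} (h : (a :: b :: pts L).Nodup) :
    B.prod L * B.P a b = B.prod ((a, b) :: L) := by
  rw [prod_cons, (commute_P_prod h).eq]

theorem good_prod_mul_P {L : List (Fin n × Fin n)} (h : (pts L).Nodup) {x y : Fin n}
    (hxy : x ≠ y) : B.Good (B.prod L * B.P x y) := by
  by_cases hx : x ∈ pts L ∨ y ∈ pts L
  · simpa using Good.mul_prod_mul_P (B := B) (x := 1) (by simpa using (Core.prod h).good) h hxy hx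
  · have : (x :: y :: pts L).Nodup := by simp_all
    rw [prod_mul_P this]
    exact (Core.prod (by simpa using this)).good

theorem good_EP_mul_P {a b : Fin n} {L : List (Fin n × Fin n)} (h : (a :: b :: pts L).Nodup)
    {x y : Fin n} (hxy : x ≠ y) : B.Good (B.E a * B.P a b * B.prod L * B.P x y) := by
  by_cases hx : x ∈ a :: b :: pts L ∨ y ∈ a :: b :: pts L
  · have := Good.mul_prod_mul_P (B := B) (x := B.E a) (L := (a, b) :: L)
      (by simpa only [prod_cons, mul_assoc] using (Core.EP h).good) h hxy hx
    simpa only [prod_cons, mul_assoc] using this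
  · have h' : (x :: y :: pts L).Nodup := by simp_all
    rw [mul_assoc, prod_mul_P h']
    refine (Core.EP ?_).good
    simp only [pts_cons, List.nodup_cons, List.mem_cons, not_or] at *
    tauto

theorem good_PEP_mul_P {a b : Fin n} {L : List (Fin n × Fin n)} (h : (a :: b :: pts L).Nodup)
    {x y : Fin n} (hxy : x ≠ y) :
    B.Good (B.P a b * (B.E a * B.P a b * B.prod L) * B.P x y) := by
  by_cases hx : x ∈ a :: b :: pts L ∨ y ∈ a :: b :: pts L
  · have := Good.mul_prod_mul_P (B := B) (x := B.P a b * B.E a) (L := (a, b) :: L)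
      (by simpa only [prod_cons, mul_assoc] using (Core.PEP h).good) h hxy hx
    simpa only [prod_cons, mul_assoc] using this
  · have h' : (x :: y :: pts L).Nodup := by simp_all
    rw [mul_assoc, mul_assoc (B.E a * B.P a b), prod_mul_P h']
    refine (Core.PEP ?_).good
    simp only [pts_cons, List.nodup_cons, List.mem_cons, not_or] at *
    tauto

theorem good_E_mul_P {a : Fin n} {L : List (Fin n × Fin n)} (h : (a :: pts L).Nodup)
    {x y : Fin n} (hxy : x ≠ y) : B.Good (B.E a * B.prod L * B.P x y) := by
  by_cases hx : x ∈ pts L ∨ y ∈ pts L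
  · rw [mul_assoc]
    exact (Core.E h).good.mul_prod_mul_P h.of_cons hxy hx
  have h' : (x :: y :: pts L).Nodup := by
    simp only [List.nodup_cons, List.mem_cons, not_or] at *
    tauto
  rw [mul_assoc, prod_mul_P h']
  obtain rfl | hxa := eq_or_ne x a
  · rw [prod_cons, ← mul_assoc]
    exact (Core.EP h').good
  obtain rfl | hya := eq_or_ne y a
  · rw [prod_cons, ← mul_assoc, P_comm]
    exact (Core.EP ((List.Perm.swap _ _ _).nodup h')).good
  refine (Core.E ?_).good
  simp only [pts_cons, List.nodup_cons, List.mem_cons, not_or] at *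
  tauto

theorem good_PE_mul_P_left {a b : Fin n} {L : List (Fin n × Fin n)}
    (h : (a :: b :: pts L).Nodup) {y : Fin n} (hxy : a ≠ y) (hy : y ∉ pts L) :
    B.Good (B.P a b * (B.E a * B.prod L) * B.P a y) := by
  have h' : (a :: y :: pts L).Nodup := by
    simp only [List.nodup_cons, List.mem_cons, not_or] at *
    tauto
  rw [mul_assoc, mul_assoc, prod_mul_P h', prod_cons, ← mul_assoc (B.E a)]
  obtain rfl | hyb := eq_or_ne y b
  · exact (Core.PEP h).good
  refine (Core.PEP' ?_).good
  simp only [List.nodup_cons, List.mem_cons, not_or] at *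
  tauto

theorem good_PE_mul_P_right {a b : Fin n} {L : List (Fin n × Fin n)}
    (h : (a :: b :: pts L).Nodup) {y : Fin n} (hxy : b ≠ y) (hy : y ∉ pts L) :
    B.Good (B.P a b * (B.E a * B.prod L) * B.P b y) := by
  obtain rfl | hya := eq_or_ne y a
  · rw [B.P_comm b]
    exact good_PE_mul_P_left h hxy.symm (by simp_all)
  have h' : (b :: y :: pts L).Nodup := by
    simp only [List.nodup_cons, List.mem_cons, not_or] at *
    tauto
  have hab : a ≠ b := by rintro rfl; simp at h
  obtain ⟨t, ht, hP⟩ := B.exists_cycle hab hya.symm hxy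
  have hta : (swap b y * swap a b) a = y := by simp
  have htL : ∀ c ∈ pts L, (swap b y * swap a b) c = c := fun c hc => by
    simp only [List.nodup_cons, List.mem_cons, not_or] at h
    rw [Perm.mul_apply, swap_apply_of_ne_of_ne (a := a), swap_apply_of_ne_of_ne] <;>
    · rintro rfl
      tauto
  have : B.P a b * (B.E a * B.prod L) * B.P b y = B.E y * B.prod ((a, b) :: L) * ↑t := by
    rw [mul_assoc, mul_assoc, ← (commute_P_prod h').eq, ← mul_assoc (B.E a),
      B.E_mul_P hab hya.symm hxy, mul_assoc, ← mul_assoc, hP, mul_assoc, ← mul_assoc (t : A),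
      ht.mul_E, hta, mul_assoc, (ht.commute_prod h.of_cons.of_cons htL).eq, ← mul_assoc,
      ← B.E_mul_P hya hxy.symm hab, prod_cons]
    simp only [mul_assoc]
  rw [this]
  refine (Core.E ?_).good.mul_unit ht.mem
  simp only [pts_cons, List.nodup_cons, List.mem_cons, not_or] at *
  tauto

theorem good_PE_mul_P {a b : Fin n} {L : List (Fin n × Fin n)} (h : (a :: b :: pts L).Nodup)
    {x y : Fin n} (hxy : x ≠ y) : B.Good (B.P a b * (B.E a * B.prod L) * B.P x y) := by
  by_cases hx : x ∈ pts L ∨ y ∈ pts L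
  · rw [← mul_assoc, mul_assoc]
    exact Good.mul_prod_mul_P (by simpa only [mul_assoc] using (Core.PE h).good) h.of_cons.of_cons
      hxy hx
  rw [not_or] at hx
  obtain rfl | hxa := eq_or_ne x a
  · exact good_PE_mul_P_left h hxy hx.2
  obtain rfl | hxb := eq_or_ne x b
  · exact good_PE_mul_P_right h hxy hx.2
  obtain rfl | hya := eq_or_ne y a
  · rw [B.P_comm x]
    exact good_PE_mul_P_left h hxy.symm hx.1
  obtain rfl | hyb := eq_or_ne y b
  · rw [B.P_comm x]
    exact good_PE_mul_P_right h hxy.symm hx.1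
  have h' : (x :: y :: pts L).Nodup := by
    simp only [List.nodup_cons, List.mem_cons, not_or] at *
    tauto
  rw [mul_assoc, mul_assoc, prod_mul_P h']
  refine (Core.PE ?_).good
  simp only [pts_cons, List.nodup_cons, List.mem_cons, not_or] at *
  tauto

theorem good_PEP'_mul_P_right {a b c : Fin n} {L : List (Fin n × Fin n)}
    (h : (a :: b :: c :: pts L).Nodup) {y : Fin n} (hy : y ∉ a :: b :: c :: pts L) :
    B.Good (B.P a c * (B.E a * B.P a b * B.prod L) * B.P c y) := by
  simp only [List.nodup_cons, List.mem_cons, not_or] at h hy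
  obtain ⟨⟨hab, hac, haL⟩, ⟨hbc, hbL⟩, hcL, hL⟩ := h
  obtain ⟨hya, hyb, hyc, hyL⟩ := hy
  obtain ⟨t, ht, hP⟩ := B.exists_cycle hac (Ne.symm hya) (Ne.symm hyc)
  have hta : (swap c y * swap a c) a = y := by simp
  have htb : (swap c y * swap a c) b = b := by
    rw [Perm.mul_apply, swap_apply_of_ne_of_ne (Ne.symm hab) hbc,
      swap_apply_of_ne_of_ne hbc (Ne.symm hyb)]
  have htL : ∀ z ∈ pts L, (swap c y * swap a c) z = z := fun z hz => by
    rw [Perm.mul_apply, swap_apply_of_ne_of_ne (a := a), swap_apply_of_ne_of_ne] <;>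
    · rintro rfl
      tauto
  have hcy : B.P c y * (B.E a * (B.P a b * B.prod L)) = B.E a * (B.P a b * B.prod L) * B.P c y :=
    Commute.mul_right (B.E_mul_P hac (Ne.symm hya) (Ne.symm hyc)).symm
      (Commute.mul_right (B.P_mul_P_comm (by simp; tauto)) (commute_P_prod (by simp; tauto)))
  have hP' : B.P a c * (B.E y * B.P y b) = B.E y * B.P y b * B.P a c :=
    Commute.mul_right (B.E_mul_P hya hyc hac).symm (B.P_mul_P_comm (by simp; tauto))
  have : B.P a c * (B.E a * B.P a b * B.prod L) * B.P c y
      = B.E y * B.P y b * B.prod ((a, c) :: L) * ↑t := by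
    rw [mul_assoc, mul_assoc (B.E a), ← hcy, ← mul_assoc, hP, mul_assoc, ← mul_assoc (t : A),
      ht.mul_E, hta, mul_assoc, ← mul_assoc (t : A), ht.mul_P hab, hta, htb, mul_assoc,
      (ht.commute_prod hL htL).eq, prod_cons, ← mul_assoc (_ * _) (B.P a c), ← hP']
    simp only [mul_assoc]
  rw [this]
  refine (Core.EP ?_).good.mul_unit ht.mem
  simp only [pts_cons, List.nodup_cons, List.mem_cons, not_or]
  tauto

theorem good_PEP'_mul_P {a b c : Fin n} {L : List (Fin n × Fin n)}
    (h : (a :: b :: c :: pts L).Nodup) {x y : Fin n} (hxy : x ≠ y) :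
    B.Good (B.P a c * (B.E a * B.P a b * B.prod L) * B.P x y) := by
  have h' : (a :: b :: pts L).Nodup := by
    simp only [List.nodup_cons, List.mem_cons, not_or] at *
    tauto
  by_cases hx : x ∈ a :: b :: pts L ∨ y ∈ a :: b :: pts L
  · have := Good.mul_prod_mul_P (B := B) (x := B.P a c * B.E a) (L := (a, b) :: L)
      (by simpa only [prod_cons, mul_assoc] using (Core.PEP' h).good) h' hxy hx
    simpa only [prod_cons, mul_assoc] using this
  obtain rfl | hxc := eq_or_ne x c
  · exact good_PEP'_mul_P_right h (by simp only [List.mem_cons] at *; tauto)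
  obtain rfl | hyc := eq_or_ne y c
  · rw [B.P_comm x]
    exact good_PEP'_mul_P_right h (by simp only [List.mem_cons] at *; tauto)
  have h' : (x :: y :: pts L).Nodup := by simp_all
  rw [mul_assoc, mul_assoc (B.E a * B.P a b), prod_mul_P h']
  refine (Core.PEP' ?_).good
  simp only [pts_cons, List.nodup_cons, List.mem_cons, not_or] at *
  tauto

theorem Core.good_mul_P {f : A} (h : B.Core f) {x y : Fin n} (hxy : x ≠ y) :
    B.Good (f * B.P x y) := by
  cases h with
  | prod h => exact good_prod_mul_P h hxy
  | E h => exact good_E_mul_P h hxy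
  | EP h => exact good_EP_mul_P h hxy
  | PE h => exact good_PE_mul_P h hxy
  | PEP h => exact good_PEP_mul_P h hxy
  | PEP' h => exact good_PEP'_mul_P h hxy

theorem _root_.List.Nodup.of_cons_cons {α : Type*} {a b : α} {l : List α}
    (h : (a :: b :: l).Nodup) : (a :: l).Nodup :=
  h.sublist ((List.sublist_cons_self b l).cons_cons a)

theorem _root_.List.Nodup.of_cons_cons_cons {α : Type*} {a b c : α} {l : List α}
    (h : (a :: b :: c :: l).Nodup) : (a :: b :: l).Nodup :=
  h.sublist (((List.sublist_cons_self c l).cons_cons b).cons_cons a)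

theorem exists_E_mul_E (a x : Fin n) : ∃ v ∈ B.W, B.E a * B.E x = B.E a * ↑v := by
  obtain rfl | hax := eq_or_ne a x
  · exact ⟨B.d * B.d, mul_mem B.d_mem_W B.d_mem_W, by
      rw [B.E_sq, Units.val_mul, B.d_comm, B.d_comm, mul_assoc]⟩
  · obtain ⟨t, ht, h, -⟩ := B.exists_swap hax
    exact ⟨B.d * t, mul_mem B.d_mem_W ht.mem, by
      rw [h, B.d_comm, mul_assoc, ← B.d_comm, Units.val_mul]⟩

theorem good_prod_mul_E {L : List (Fin n × Fin n)} (h : (pts L).Nodup) (x : Fin n) :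
    B.Good (B.prod L * B.E x) := by
  by_cases hx : x ∈ pts L
  · obtain ⟨c, L', hL, hp⟩ := exists_prod_eq_of_mem (B := B) h hx
    have hn := hp.nodup_iff.2 h
    rw [hL, mul_assoc, ← (commute_E_prod (hn.sublist (by simp))).eq]
    exact (Core.PE hn).good
  · have hn : (x :: pts L).Nodup := List.nodup_cons.2 ⟨hx, h⟩
    rw [← (commute_E_prod hn).eq]
    exact (Core.E hn).good

theorem exists_E_prod_mul_E {a : Fin n} {L : List (Fin n × Fin n)} (h : (a :: pts L).Nodup)
    (x : Fin n) : ∃ v ∈ B.W, B.E a * B.prod L * B.E x = B.E a * B.prod L * ↑v := by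
  obtain ⟨v, hv, h'⟩ := exists_E_mul_E (B := B) a x
  exact ⟨v, hv, by rw [(commute_E_prod h).eq, mul_assoc, h', mul_assoc]⟩

theorem exists_EP_prod_mul_E {a b : Fin n} {L : List (Fin n × Fin n)}
    (h : (a :: b :: pts L).Nodup) (x : Fin n) : ∃ v ∈ B.W,
      B.E a * B.P a b * B.prod L * B.E x = B.E a * B.prod L * ↑v ∨
      x ≠ b ∧ B.E a * B.P a b * B.prod L * B.E x = B.E a * B.prod L * B.P x b * ↑v := by
  have hab : a ≠ b := by rintro rfl; simp at h
  have ha : (a :: pts L).Nodup := h.of_cons_cons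
  have hEE : B.E a * B.P a b * B.prod L * B.E a = B.E a * B.prod L * ↑B.d := by
    rw [mul_assoc, ← (commute_E_prod ha).eq, ← mul_assoc, B.E_mul_P_mul_E hab, mul_assoc,
      B.d_comm]
  obtain rfl | hxa := eq_or_ne x a
  · exact ⟨B.d, B.d_mem_W, .inl hEE⟩
  obtain rfl | hxb := eq_or_ne x b
  · obtain ⟨t, ht, -, -, hPt⟩ := B.exists_swap hab
    refine ⟨B.d * t, mul_mem B.d_mem_W ht.mem, .inl ?_⟩
    have htL : ∀ z ∈ pts L, swap a x z = z := fun z hz => by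
      simp only [List.nodup_cons, List.mem_cons, not_or] at h
      apply swap_apply_of_ne_of_ne <;> (rintro rfl; tauto)
    rw [← hPt, ← mul_assoc, mul_assoc (_ * _) (t : A),
      (ht.commute_prod h.of_cons.of_cons htL).eq, mul_assoc, mul_assoc _ (t : A), ht.mul_E,
      swap_apply_right, ← mul_assoc, ← mul_assoc, hEE, Units.val_mul, mul_assoc]
  · obtain ⟨t, ht, hEt, -⟩ := B.exists_swap (Ne.symm hxa)
    refine ⟨B.d * t, mul_mem B.d_mem_W ht.mem, .inr ⟨hxb, ?_⟩⟩
    rw [mul_assoc (B.E a), (commute_P_prod h).eq, ← mul_assoc, mul_assoc,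
      ← B.E_mul_P hxa hxb hab, (commute_E_prod ha).eq, ← mul_assoc, mul_assoc (B.prod L),
      hEt, B.d_comm, mul_assoc (_ * _), mul_assoc (B.prod L), mul_assoc (B.E a),
      mul_assoc (B.E a), mul_assoc (t : A), B.d_comm,
      ← mul_assoc (t : A), ht.mul_P hab, swap_apply_left,
      swap_apply_of_ne_of_ne (Ne.symm hab) (Ne.symm hxb), mul_assoc _ (t : A), ← B.d_comm,
      Units.val_mul]
    simp only [mul_assoc]

theorem Core.good_mul_E {f : A} (h : B.Core f) (x : Fin n) : B.Good (f * B.E x) := by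
  cases h with
  | prod h => exact good_prod_mul_E h x
  | E h =>
    obtain ⟨v, hv, h'⟩ := exists_E_prod_mul_E (B := B) h x
    rw [h']
    exact (Core.E h).good.mul_unit hv
  | PE h =>
    obtain ⟨v, hv, h'⟩ := exists_E_prod_mul_E (B := B) h.of_cons_cons x
    rw [mul_assoc, h', ← mul_assoc]
    exact (Core.PE h).good.mul_unit hv
  | EP h =>
    have ha := h.of_cons_cons
    obtain ⟨v, hv, h' | ⟨hx, h'⟩⟩ := exists_EP_prod_mul_E (B := B) h x <;> rw [h']
    · exact (Core.E ha).good.mul_unit hv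
    · exact (good_E_mul_P ha hx).mul_unit hv
  | PEP h =>
    obtain ⟨v, hv, h' | ⟨hx, h'⟩⟩ := exists_EP_prod_mul_E (B := B) h x <;>
      rw [mul_assoc, h', ← mul_assoc]
    · exact (Core.PE h).good.mul_unit hv
    · rw [← mul_assoc]
      exact (good_PE_mul_P h hx).mul_unit hv
  | PEP' h =>
    obtain ⟨v, hv, h' | ⟨hx, h'⟩⟩ := exists_EP_prod_mul_E (B := B) h.of_cons_cons_cons x <;>
      rw [mul_assoc, h', ← mul_assoc]
    · exact (Core.PE h.of_cons_cons).good.mul_unit hv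
    · rw [← mul_assoc]
      exact (good_PE_mul_P h.of_cons_cons hx).mul_unit hv

theorem E_prod_mul_S {a : Fin n} {L : List (Fin n × Fin n)} (h : (a :: pts L).Nodup)
    (x : Fin n) : B.E a * B.prod L * B.S x = B.E a * B.prod L := by
  rw [(commute_E_prod h).eq, mul_assoc, B.E_mul_S]

theorem E_mul_P_mul_S' {a b : Fin n} (h : a ≠ b) (x : Fin n) :
    B.E a * B.P a b * B.S x = B.E a * B.P a b := by
  obtain rfl | hxa := eq_or_ne x a
  · exact B.E_mul_P_mul_S h
  obtain rfl | hxb := eq_or_ne x b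
  · obtain ⟨t, ht, -, -, hPt⟩ := B.exists_swap h
    nth_rw 1 [← hPt]
    rw [mul_assoc, mul_assoc, ← Units.val_mul, ht.mul_S, swap_apply_right, Units.val_mul,
      ← mul_assoc, ← mul_assoc, B.E_mul_P_mul_S h, mul_assoc, hPt]
  · rw [mul_assoc, ← B.S_mul_P h (Ne.symm hxa) (Ne.symm hxb), ← mul_assoc, B.E_mul_S]

theorem EP_prod_mul_S {a b : Fin n} {L : List (Fin n × Fin n)} (h : (a :: b :: pts L).Nodup)
    (x : Fin n) : B.E a * B.P a b * B.prod L * B.S x = B.E a * B.P a b * B.prod L := by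
  have hab : a ≠ b := by rintro rfl; simp at h
  rw [mul_assoc (B.E a), (commute_P_prod h).eq, ← mul_assoc,
    (commute_E_prod h.of_cons_cons).eq, mul_assoc (B.prod L), mul_assoc (B.prod L),
    E_mul_P_mul_S' hab]

theorem Core.mul_S {f : A} (h : B.Core f) :
    (∃ L, (pts L).Nodup ∧ f = B.prod L) ∨ ∀ x, f * B.S x = f := by
  cases h with
  | prod h => exact .inl ⟨_, h, rfl⟩
  | E h => exact .inr fun x => E_prod_mul_S h x
  | PE h => exact .inr fun x => by rw [mul_assoc, E_prod_mul_S h.of_cons_cons]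
  | EP h => exact .inr fun x => EP_prod_mul_S h x
  | PEP h => exact .inr fun x => by rw [mul_assoc, EP_prod_mul_S h]
  | PEP' h => exact .inr fun x => by rw [mul_assoc, EP_prod_mul_S h.of_cons_cons_cons]

theorem S_mul_S_val (a : Fin n) : (B.S a * B.S a : A) = 1 := by
  rw [← Units.val_mul, B.S_sq, Units.val_one]

theorem good_prod_mul_S_mul_P {L : List (Fin n × Fin n)} (h : (pts L).Nodup) {x y : Fin n}
    (hxy : x ≠ y) : B.Good (B.prod L * (B.S x * B.P x y)) := by
  by_cases hx : x ∈ pts L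
  · obtain ⟨c, L', hL, hp⟩ := exists_prod_eq_of_mem (B := B) h hx
    have hn := hp.nodup_iff.2 h
    have hx' : (x :: pts L').Nodup := hn.sublist (by simp)
    obtain rfl | hcy := eq_or_ne c y
    · have : B.prod L * (B.S x * B.P x c) = B.P x c * (B.E x * B.P x c * B.prod L') := by
        rw [hL, mul_assoc, ← mul_assoc (B.prod L'), ← (commute_S_prod hx').eq,
          mul_assoc, ← (commute_P_prod hn).eq, ← mul_assoc, ← mul_assoc, B.P_mul_S_mul_P hxy]
        simp only [mul_assoc]
      rw [this]
      exact (Core.PEP hn).good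
    · have hxc : x ≠ c := by rintro rfl; simp at hn
      have hPS : B.P x c * B.S x = B.S x * B.S c * B.P x c * B.S c := by
        rw [mul_assoc (B.S x : A), B.S_mul_S_mul_P hxc, mul_assoc, mul_assoc, S_mul_S_val, mul_one]
      have hc := commute_S_prod (B := B) (hn.sublist (by simp) : (c :: pts L').Nodup)
      have : B.prod L * (B.S x * B.P x y)
          = ↑(B.S x * B.S c) * (B.prod L * B.P x y) * ↑(B.S c) := by
        rw [hL, mul_assoc, ← mul_assoc (B.prod L'), ← (commute_S_prod hx').eq, mul_assoc,
          ← mul_assoc, hPS, Units.val_mul]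
        simp only [mul_assoc]
        rw [← mul_assoc (B.S c : A) (B.prod L'), hc.eq, mul_assoc,
          B.S_mul_P hxy hxc hcy.symm]
      rw [this]
      exact ((good_prod_mul_P h hxy).unit_mul (mul_mem (B.S_mem_W _) (B.S_mem_W _))).mul_unit
        (B.S_mem_W _)
  · rw [← mul_assoc, ← (commute_S_prod (List.nodup_cons.2 ⟨hx, h⟩)).eq, mul_assoc]
    exact (good_prod_mul_P h hxy).unit_mul (B.S_mem_W _)

variable (B) in
/-- The group generated by `d` and the sign changes. -/
def N : Subgroup Aˣ := Subgroup.closure (insert B.d (Set.range B.S))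

theorem S_inv (a : Fin n) : (B.S a)⁻¹ = B.S a := inv_eq_of_mul_eq_one_left (B.S_sq a)

theorem S_mem_N (a : Fin n) : B.S a ∈ B.N := Subgroup.subset_closure (.inr ⟨a, rfl⟩)

theorem d_mem_N : B.d ∈ B.N := Subgroup.subset_closure (.inl rfl)

theorem d_commute (x : A) : Commute (B.d : A) x := B.d_comm x

theorem exists_eq_mul_lifts {v : Aˣ} (hv : v ∈ B.W) :
    ∃ s ∈ B.N, ∃ w σ, B.Lifts w σ ∧ v = s * w := by
  have hd (s w : Aˣ) (z : Aˣ) (hz : ∀ w, z * w = w * z) : s * w * z = s * z * w := by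
    rw [mul_assoc, ← hz, mul_assoc]
  have hR (s : Aˣ) (hs : s ∈ B.N) (w : Aˣ) (σ : Perm (Fin n)) (hw : B.Lifts w σ) (i : ℕ)
      (hi : i < n) : ∃ s' ∈ B.N, ∃ w' σ', B.Lifts w' σ' ∧ s * w * B.R i = s' * w' := by
    obtain _ | i := i
    · refine ⟨s * B.S (σ (B.pt 0)), mul_mem hs (S_mem_N _), w, σ, hw, ?_⟩
      rw [← S_zero, mul_assoc, hw.mul_S, mul_assoc]
    · exact ⟨s, hs, _, _, hw.mul (B.lifts_R hi), mul_assoc _ _ _⟩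
  have hc (w : Aˣ) : B.d * w = w * B.d := Units.ext (B.d_comm _)
  induction hv using Subgroup.closure_induction_right with
  | one => exact ⟨1, one_mem _, 1, 1, .one, by simp⟩
  | mul_right x _ y hy h =>
    obtain ⟨s, hs, w, σ, hw, rfl⟩ := h
    obtain rfl | ⟨i, hi, rfl⟩ := hy
    · exact ⟨s * B.d, mul_mem hs d_mem_N, w, σ, hw, by rw [mul_assoc, ← hc, mul_assoc]⟩
    · exact hR s hs w σ hw i hi
  | mul_inv_cancel x _ y hy h =>
    obtain ⟨s, hs, w, σ, hw, rfl⟩ := h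
    obtain rfl | ⟨i, hi, rfl⟩ := hy
    · refine ⟨s * B.d⁻¹, mul_mem hs (inv_mem d_mem_N), w, σ, hw, ?_⟩
      rw [mul_assoc, mul_assoc, (show Commute B.d w from hc w).inv_left.eq]
    · rw [R_inv]
      exact hR s hs w σ hw i hi

theorem exists_N_mul_E {s : Aˣ} (hs : s ∈ B.N) (a : Fin n) :
    ∃ v ∈ B.W, ↑s * B.E a = B.E a * ↑v := by
  induction hs using Subgroup.closure_induction with
  | mem x hx =>
    obtain rfl | ⟨b, rfl⟩ := hx
    · exact ⟨B.d, B.d_mem_W, B.d_comm _⟩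
    · exact ⟨1, one_mem _, by rw [B.S_mul_E, Units.val_one, mul_one]⟩
  | one => exact ⟨1, one_mem _, by simp⟩
  | mul x y _ _ h h' =>
    obtain ⟨v, hv, h⟩ := h
    obtain ⟨w, hw, h'⟩ := h'
    exact ⟨v * w, mul_mem hv hw, by
      rw [Units.val_mul, mul_assoc, h', ← mul_assoc, h, mul_assoc, Units.val_mul]⟩
  | inv x _ h =>
    obtain ⟨v, hv, h⟩ := h
    refine ⟨v⁻¹, inv_mem hv, ?_⟩
    rw [Units.inv_mul_eq_iff_eq_mul, ← mul_assoc, h, Units.mul_inv_cancel_right]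

theorem exists_N_mul_P {s : Aˣ} (hs : s ∈ B.N) {a b : Fin n} (hab : a ≠ b) :
    ∃ v ∈ B.W, ↑s * B.P a b = B.P a b * ↑v ∨ ↑s * B.P a b = B.S a * B.P a b * ↑v := by
  have hS (c : Fin n) (z : A) (h : ∃ v ∈ B.W, z = B.P a b * ↑v ∨ z = B.S a * B.P a b * ↑v) :
      ∃ v ∈ B.W, B.S c * z = B.P a b * ↑v ∨ B.S c * z = B.S a * B.P a b * ↑v := by
    obtain ⟨v, hv, h⟩ := h
    have h1 : (B.S a : A) * (B.S a * B.P a b) = B.P a b := by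
      rw [← mul_assoc, S_mul_S_val, one_mul]
    obtain rfl | hca := eq_or_ne c a
    · exact ⟨v, hv, h.symm.imp (fun h => by rw [h, ← mul_assoc, h1])
        fun h => by rw [h, mul_assoc]⟩
    obtain rfl | hcb := eq_or_ne c b
    · have h2 := B.S_mul_S_mul_P hab
      refine ⟨B.S a * B.S c * v, mul_mem (mul_mem (B.S_mem_W _) (B.S_mem_W _)) hv, ?_⟩
      refine h.symm.imp (fun h => ?_) fun h => ?_
      · rw [h, ← mul_assoc, ← mul_assoc, ← Units.val_mul, B.S_comm, Units.val_mul,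
          mul_assoc (B.S a : A), h2]
        simp only [Units.val_mul, mul_assoc]
      · have h3 : (B.S c : A) * B.P a c = B.S a * B.P a c * (B.S a * B.S c) := by
          rw [mul_assoc, ← h2, ← mul_assoc, S_mul_S_val, one_mul]
        rw [h, ← mul_assoc, h3]
        simp only [Units.val_mul, mul_assoc]
    · refine ⟨B.S c * v, mul_mem (B.S_mem_W _) hv, ?_⟩
      have h2 := B.S_mul_P hab (Ne.symm hca) (Ne.symm hcb)
      refine h.imp (fun h => ?_) fun h => ?_
      · rw [h, ← mul_assoc, h2, mul_assoc, Units.val_mul]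
      · rw [h, ← mul_assoc, ← mul_assoc, ← Units.val_mul, B.S_comm, Units.val_mul, Units.val_mul,
          mul_assoc (B.S a : A), h2]
        simp only [mul_assoc]
  induction hs using Subgroup.closure_induction_left with
  | one => exact ⟨1, one_mem _, by simp⟩
  | mul_left x hx y _ h =>
    obtain rfl | ⟨c, rfl⟩ := hx
    · obtain ⟨v, hv, h⟩ := h
      refine ⟨v * B.d, mul_mem hv B.d_mem_W, ?_⟩
      rw [Units.val_mul, mul_assoc, B.d_comm, Units.val_mul, ← mul_assoc, ← mul_assoc]
      exact h.imp (congrArg (· * _)) (congrArg (· * _))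
    · rw [Units.val_mul, mul_assoc]
      exact hS c _ h
  | inv_mul_cancel x hx y _ h =>
    obtain rfl | ⟨c, rfl⟩ := hx
    · obtain ⟨v, hv, h⟩ := h
      refine ⟨v * B.d⁻¹, mul_mem hv (inv_mem B.d_mem_W), ?_⟩
      rw [Units.val_mul, mul_assoc, ((d_commute _).units_inv_left).eq, Units.val_mul,
        ← mul_assoc, ← mul_assoc]
      exact h.imp (congrArg (· * _)) (congrArg (· * _))
    · rw [S_inv, Units.val_mul, mul_assoc]
      exact hS c _ h

theorem Good.mul_E {x : A} (h : B.Good x) (a : Fin n) : B.Good (x * B.E a) := by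
  obtain ⟨u, hu, v, hv, f, hf, rfl⟩ := h
  obtain ⟨s, hs, w, σ, hw, rfl⟩ := exists_eq_mul_lifts hv
  obtain ⟨v', hv', h'⟩ := exists_N_mul_E hs (σ a)
  rw [Units.val_mul, mul_assoc, mul_assoc, mul_assoc, hw.mul_E, ← mul_assoc (s : A), h', mul_assoc,
    ← mul_assoc f, ← Units.val_mul]
  exact ((hf.good_mul_E _).mul_unit (mul_mem hv' hw.mem)).unit_mul hu

theorem Core.good_mul_S_mul_P {f : A} (h : B.Core f) {x y : Fin n} (hxy : x ≠ y) :
    B.Good (f * (B.S x * B.P x y)) := by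
  obtain ⟨L, hL, rfl⟩ | h' := h.mul_S
  · exact good_prod_mul_S_mul_P hL hxy
  · rw [← mul_assoc, h']
    exact h.good_mul_P hxy

theorem Good.mul_P {x : A} (h : B.Good x) {a b : Fin n} (hab : a ≠ b) :
    B.Good (x * B.P a b) := by
  obtain ⟨u, hu, v, hv, f, hf, rfl⟩ := h
  obtain ⟨s, hs, w, σ, hw, rfl⟩ := exists_eq_mul_lifts hv
  have hab' := σ.injective.ne hab
  obtain ⟨v', hv', h'⟩ := exists_N_mul_P hs hab'
  rw [Units.val_mul, mul_assoc, mul_assoc, mul_assoc, hw.mul_P hab, ← mul_assoc (s : A)]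
  obtain h' | h' := h' <;>
    rw [h', mul_assoc _ (v' : A), ← Units.val_mul, ← mul_assoc f]
  · exact ((hf.good_mul_P hab').mul_unit (mul_mem hv' hw.mem)).unit_mul hu
  · exact ((hf.good_mul_S_mul_P hab').mul_unit (mul_mem hv' hw.mem)).unit_mul hu

variable (B) in
theorem P_succ {k : ℕ} (hk : k + 1 < n) : B.P ⟨k, by omega⟩ ⟨k + 1, hk⟩ = B.e (k + 1) := by
  simp [P, pairOf, pairOrbit]

theorem Good.mul_e {x : A} (h : B.Good x) {i : ℕ} (hi : i < n) : B.Good (x * B.e i) := by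
  obtain _ | i := i
  · exact h.mul_E (B.pt 0)
  · rw [← B.P_succ hi]
    exact h.mul_P (by simp)

theorem mul_prod_mul_P_mul_S_mul_P_mul_S {X : A} {L : List (Fin n × Fin n)} {a b : Fin n}
    (h : (a :: b :: pts L).Nodup)
    (hX : X * B.prod ((a, b) :: L) * B.S a = X * B.prod ((a, b) :: L)) :
    X * B.prod L * (B.P a b * (B.S a * B.P a b * B.S a)) =
      ↑B.d * (X * B.prod ((a, b) :: L)) := by
  have hab : a ≠ b := by rintro rfl; simp at h
  calc X * B.prod L * (B.P a b * (B.S a * B.P a b * B.S a))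
      = X * B.prod ((a, b) :: L) * B.S a * (B.P a b * B.S a) := by
        rw [← prod_mul_P h]; simp only [mul_assoc]
    _ = X * (B.prod L * (B.P a b * B.P a b)) * B.S a := by
        rw [hX, ← prod_mul_P h]; simp only [mul_assoc]
    _ = ↑B.d * (X * B.prod ((a, b) :: L) * B.S a) := by
        rw [B.P_sq hab, B.d_comm, ← mul_assoc (B.prod L), prod_mul_P h, B.d_comm,
          mul_assoc, mul_assoc, B.d_comm]
        simp only [mul_assoc]
    _ = _ := by rw [hX]

theorem length_pts (L : List (Fin n × Fin n)) : (pts L).length = 2 * L.length := by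
  induction L with
  | nil => rfl
  | cons p L ih => obtain ⟨x, y⟩ := p; simp [ih]; ring

theorem pts_injective : Function.Injective (pts (n := n)) := by
  intro L
  induction L with
  | nil => rintro (_ | ⟨⟨x, y⟩, L'⟩) h <;> simp at h ⊢
  | cons p L ih =>
    obtain ⟨x, y⟩ := p
    rintro (_ | ⟨⟨x', y'⟩, L'⟩) h
    · simp at h
    · simp only [pts_cons, List.cons.injEq] at h
      rw [h.1, h.2.1, ih h.2.2]

variable (B) in
theorem exists_lifts_mul_prod {L L' : List (Fin n × Fin n)} {l l' : List (Fin n)}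
    (h : (l ++ pts L).Nodup) (h' : (l' ++ pts L').Nodup) (hl : l.length = l'.length)
    (hL : L.length = L'.length) :
    ∃ u σ, B.Lifts u σ ∧ l.map σ = l' ∧ ↑u * B.prod L = B.prod L' * ↑u := by
  obtain ⟨u, σ, hu, hσ⟩ := B.exists_lifts_map h h' (by simp [hl, hL, length_pts])
  rw [List.map_append] at hσ
  obtain ⟨h1, h2⟩ := List.append_inj hσ (by simpa)
  rw [← pts_map] at h2
  exact ⟨u, σ, hu, h1, by rw [hu.mul_prod h.of_append_right, pts_injective h2]⟩

variable (B) in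
/-- The elements that are a product of an element of `F` with units on both sides. -/
def Reduces (F : Set A) (x : A) : Prop := ∃ u ∈ B.W, ∃ v ∈ B.W, ∃ f ∈ F, x = ↑u * f * ↑v

theorem Reduces.of_mem {F : Set A} {x : A} (h : x ∈ F) : B.Reduces F x :=
  ⟨1, one_mem _, 1, one_mem _, x, h, by simp⟩

theorem Reduces.of_mul_eq {F : Set A} {x y : A} (h : B.Reduces F y) {u v : Aˣ} (hu : u ∈ B.W)
    (hv : v ∈ B.W) (hxy : ↑u * x = y * ↑v) : B.Reduces F x := by
  obtain ⟨u', hu', v', hv', f, hf, rfl⟩ := h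
  refine ⟨u⁻¹ * u', mul_mem (inv_mem hu) hu', v' * v, mul_mem hv' hv, f, hf, ?_⟩
  rw [Units.val_mul, mul_assoc, mul_assoc, Units.eq_inv_mul_iff_mul_eq, hxy, Units.val_mul]
  simp only [mul_assoc]

theorem Reduces.of_mul_mem {F : Set A} {x : A} {u : Aˣ} (hu : u ∈ B.W) (h : ↑u * x ∈ F) :
    B.Reduces F x :=
  (Reduces.of_mem h).of_mul_eq hu (one_mem _) (by simp)

theorem length_add_two_mul_length_le {l : List (Fin n)} {L : List (Fin n × Fin n)}
    (h : (l ++ pts L).Nodup) : l.length + 2 * L.length ≤ n := by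
  simpa [length_pts] using h.length_le_card

end BrauerData

section

variable {n : ℕ}

theorem rb_of_lt {i : ℕ} (h : i < n) :
    rb n i = RingQuot.mkAlgHom Lp (BrauerBRel n) (fr ⟨i, h⟩) := dif_pos h

theorem eb_of_lt {i : ℕ} (h : i < n) :
    eb n i = RingQuot.mkAlgHom Lp (BrauerBRel n) (fe ⟨i, h⟩) := dif_pos h

theorem rb_of_le {i : ℕ} (h : n ≤ i) : rb n i = 1 := dif_neg (by omega)

variable (n) in
/-- The parameter `δ` as a unit of `Br(B_n)`. -/
noncomputable def δunit : (BrauerB n)ˣ :=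
  Units.map (algebraMap Lp (BrauerB n)).toMonoidHom
    ⟨LaurentPolynomial.T 1, LaurentPolynomial.T (-1), by rw [← LaurentPolynomial.T_add]; simp,
      by rw [← LaurentPolynomial.T_add]; simp⟩

theorem mkAlgHom_δpar_smul (x : FreeAlgebra Lp (BGen n)) :
    RingQuot.mkAlgHom Lp (BrauerBRel n) (δpar • x) =
      ↑(δunit n) * RingQuot.mkAlgHom Lp (BrauerBRel n) x := by
  rw [map_smul, Algebra.smul_def]
  rfl

theorem rb_mul_rb (i : ℕ) : rb n i * rb n i = 1 := by
  by_cases h : i < n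
  · rw [rb_of_lt h]
    simpa using RingQuot.mkAlgHom_rel Lp (BrauerBRel.rr ⟨i, h⟩)
  · rw [rb_of_le (by omega), one_mul]

variable (n) in
/-- The generators of the Brauer algebra of type `B_n`. -/
noncomputable def brauerData (hn : 3 ≤ n) : BrauerData n (BrauerB n) where
  R i := ⟨rb n i, rb n i, rb_mul_rb i, rb_mul_rb i⟩
  e := eb n
  d := δunit n
  three_le := hn
  d_comm x := Algebra.commutes _ _
  R_sq i := Units.ext (rb_mul_rb i)
  R_far i j h := Units.ext <| by
    change rb n i * rb n j = rb n j * rb n i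
    by_cases hj : j < n
    · have := RingQuot.mkAlgHom_rel Lp (BrauerBRel.rrFar ⟨i, by omega⟩ ⟨j, hj⟩ (.inl h))
      simpa only [map_mul, ← rb_of_lt] using this
    · rw [rb_of_le (i := j) (by omega), mul_one, one_mul]
  R_braid i h h' := Units.ext <| by
    have := RingQuot.mkAlgHom_rel Lp
      (BrauerBRel.braid ⟨i, by omega⟩ ⟨i + 1, h'⟩ (.inl rfl) h i.succ_pos)
    change rb n i * rb n (i + 1) * rb n i = rb n (i + 1) * rb n i * rb n (i + 1)
    simpa only [map_mul, ← rb_of_lt] using this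
  R_mul_e i h := by
    have := RingQuot.mkAlgHom_rel Lp (BrauerBRel.re ⟨i, h⟩)
    simpa only [map_mul, ← rb_of_lt, ← eb_of_lt] using this
  e_mul_R i h := by
    have := RingQuot.mkAlgHom_rel Lp (BrauerBRel.er ⟨i, h⟩)
    simpa only [map_mul, ← rb_of_lt, ← eb_of_lt] using this
  e_sq i h h' := by
    have := RingQuot.mkAlgHom_rel Lp (BrauerBRel.ee ⟨i, h'⟩ h)
    simpa only [map_mul, ← rb_of_lt, ← eb_of_lt, mkAlgHom_δpar_smul] using this
  e_zero_sq := by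
    have := RingQuot.mkAlgHom_rel Lp (BrauerBRel.e0e0 (n := n) ⟨0, by omega⟩ rfl)
    simpa only [map_mul, ← rb_of_lt, ← eb_of_lt, mkAlgHom_δpar_smul, mul_smul] using this
  R_e_far i j h hi hj := by
    have := (RingQuot.mkAlgHom_rel Lp (BrauerBRel.erFar ⟨i, hi⟩ ⟨j, hj⟩ h)).symm
    simpa only [map_mul, ← rb_of_lt, ← eb_of_lt] using this
  e_far i j h hj := by
    have := RingQuot.mkAlgHom_rel Lp (BrauerBRel.eeFar ⟨i, by omega⟩ ⟨j, hj⟩ (.inl h))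
    simpa only [map_mul, ← rb_of_lt, ← eb_of_lt] using this
  RRe := by
    have := RingQuot.mkAlgHom_rel Lp (BrauerBRel.rre (n := n) ⟨1, by omega⟩ ⟨2, by omega⟩ (.inl rfl)
        one_pos two_pos)
    simpa only [map_mul, ← rb_of_lt, ← eb_of_lt] using this
  ReR i h h' := by
    have := RingQuot.mkAlgHom_rel Lp
        (BrauerBRel.rer ⟨i, by omega⟩ ⟨i + 1, h'⟩ (.inl rfl) h i.succ_pos)
    simpa only [map_mul, ← rb_of_lt, ← eb_of_lt] using this
  R_braid_zero := Units.ext <| by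
    have := RingQuot.mkAlgHom_rel Lp
      (BrauerBRel.b1010 (n := n) ⟨0, by omega⟩ ⟨1, by omega⟩ rfl rfl)
    change rb n 1 * rb n 0 * rb n 1 * rb n 0 = rb n 0 * rb n 1 * rb n 0 * rb n 1
    simpa only [map_mul, ← rb_of_lt] using this
  R01e0 := by
    have := RingQuot.mkAlgHom_rel Lp
      (BrauerBRel.b_r0r1e0 (n := n) ⟨0, by omega⟩ ⟨1, by omega⟩ rfl rfl)
    simpa only [map_mul, ← rb_of_lt, ← eb_of_lt] using this
  R0e1R0e1 := by
    have := RingQuot.mkAlgHom_rel Lp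
      (BrauerBRel.b_r0e1r0e1 (n := n) ⟨0, by omega⟩ ⟨1, by omega⟩ rfl rfl)
    simpa only [map_mul, ← rb_of_lt, ← eb_of_lt] using this
  R010e1 := by
    have := RingQuot.mkAlgHom_rel Lp
      (BrauerBRel.b_r0r1r0e1 (n := n) ⟨0, by omega⟩ ⟨1, by omega⟩ rfl rfl)
    simpa only [map_mul, ← rb_of_lt, ← eb_of_lt] using this
  e0R1e0 := by
    have := RingQuot.mkAlgHom_rel Lp
        (BrauerBRel.b_e0r1e0 (n := n) ⟨0, by omega⟩ ⟨1, by omega⟩ rfl rfl)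
    simpa only [map_mul, ← rb_of_lt, ← eb_of_lt, mkAlgHom_δpar_smul] using this
  e0e1e0 := by
    have := RingQuot.mkAlgHom_rel Lp
        (BrauerBRel.b_e0e1e0 (n := n) ⟨0, by omega⟩ ⟨1, by omega⟩ rfl rfl)
    simpa only [map_mul, ← rb_of_lt, ← eb_of_lt, mkAlgHom_δpar_smul] using this
  e0R1R0 := by
    have := RingQuot.mkAlgHom_rel Lp
      (BrauerBRel.b_e0r1r0 (n := n) ⟨0, by omega⟩ ⟨1, by omega⟩ rfl rfl)
    simpa only [map_mul, ← rb_of_lt, ← eb_of_lt] using this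
  e0e1R0 := by
    have := RingQuot.mkAlgHom_rel Lp
      (BrauerBRel.b_e0e1r0 (n := n) ⟨0, by omega⟩ ⟨1, by omega⟩ rfl rfl)
    simpa only [map_mul, ← rb_of_lt, ← eb_of_lt] using this

end

section

open BrauerData Equiv

variable {n : ℕ} (hn : 3 ≤ n)

theorem eb_succ {k : ℕ} (hk : k + 1 < n) :
    eb n (k + 1) = (brauerData n hn).P ⟨k, by omega⟩ ⟨k + 1, hk⟩ :=
  ((brauerData n hn).P_succ hk).symm

theorem es_succ {k : ℕ} (hk : k + 1 < n) : es n (k + 1) =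
    ↑((brauerData n hn).S ⟨k, by omega⟩) * (brauerData n hn).P ⟨k, by omega⟩ ⟨k + 1, hk⟩ *
      ↑((brauerData n hn).S ⟨k, by omega⟩) := by
  set B := brauerData n hn with hB
  induction k with
  | zero => rw [← eb_succ hn hk]; rfl
  | succ k ih =>
    have hu := (B.lifts_R (k := k) (by omega)).mul (B.lifts_R hk)
    set u : (BrauerB n)ˣ := B.R (k + 1) * B.R (k + 1 + 1) with hu_def
    have hS := hu.mul_S ⟨k, by omega⟩
    have hP := hu.mul_P (a := ⟨k, by omega⟩) (b := ⟨k + 1, by omega⟩) (by simp)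
    have h1 : (swap ⟨k, by omega⟩ ⟨k + 1, by omega⟩ * swap ⟨k + 1, by omega⟩ ⟨k + 1 + 1, hk⟩ :
        Perm (Fin n)) ⟨k, by omega⟩ = ⟨k + 1, by omega⟩ := by
      simp [swap_apply_def]
      intro h
      omega
    have h2 : (swap ⟨k, by omega⟩ ⟨k + 1, by omega⟩ * swap ⟨k + 1, by omega⟩ ⟨k + 1 + 1, hk⟩ :
        Perm (Fin n)) ⟨k + 1, by omega⟩ = ⟨k + 1 + 1, hk⟩ := by
      rw [Perm.mul_apply, swap_apply_left, swap_apply_of_ne_of_ne (by simp; omega) (by simp)]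
    rw [h1] at hS hP
    rw [h2] at hP
    replace hS := congrArg Units.val hS
    simp only [Units.val_mul] at hS
    have hinv : (u : BrauerB n) * (B.R (k + 1 + 1) * B.R (k + 1)) = 1 := by
      rw [hu_def, Units.val_mul, mul_assoc, R_mul_R_mul, R_mul_R]
    change ↑(B.R (k + 1)) * ↑(B.R (k + 1 + 1)) * es n (k + 1) * ↑(B.R (k + 1 + 1)) *
      ↑(B.R (k + 1)) = _
    rw [ih (by omega), ← Units.val_mul, ← hu_def, ← mul_assoc, ← mul_assoc, hS,
      mul_assoc (B.S _ : BrauerB n), hP, mul_assoc, mul_assoc, mul_assoc, mul_assoc, ← mul_assoc (u : BrauerB n), hS, mul_assoc,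
      hinv, mul_one, mul_assoc]

theorem exists_f1B_eq_prod (t : ℕ) (ht : 2 * t ≤ n) : ∃ L, L.length = t ∧ (pts L).Nodup ∧
    (∀ p ∈ pts L, n - 2 * t ≤ p.val) ∧ f1B n t = (brauerData n hn).prod L := by
  induction t with
  | zero => exact ⟨[], by simp [f1B]⟩
  | succ t ih =>
    obtain ⟨L, hl, hL, hp, h⟩ := ih (by omega)
    obtain ⟨k, rfl⟩ : ∃ k, n = k + 2 * t + 2 := ⟨n - 2 * t - 2, by omega⟩
    have hk : k + 2 * t + 2 - 1 - 2 * t = k + 1 := by omega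
    have hL' : pts ((⟨k, by omega⟩, ⟨k + 1, by omega⟩) :: L) |>.Nodup := by
      simp only [pts_cons, List.nodup_cons, List.mem_cons, not_or]
      refine ⟨⟨by simp, fun h => ?_⟩, fun h => ?_, hL⟩ 
      · have : _ ≤ k := hp _ h
        omega
      · have : _ ≤ k + 1 := hp _ h
        omega
    refine ⟨_ :: L, by simp [hl], hL', ?_, ?_⟩
    · simp only [pts_cons, List.mem_cons]
      rintro p (rfl | rfl | h)
      · simp; omega
      · simp; omega
      · have := hp p h; omega
    · rw [f1B, h, hk, eb_succ hn (k := k) (by omega), prod_mul_P hL']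

theorem exists_mul_f2B_eq {X Y : BrauerB n} {s : ℕ} {l : List (Fin n)} (hXY : X * f2B n s = Y)
    (hY : ∀ M, (l ++ pts M).Nodup → ∀ a,
      Y * (brauerData n hn).prod M * ↑((brauerData n hn).S a) = Y * (brauerData n hn).prod M)
    (hl : l.Nodup) (t : ℕ) (hst : 2 * (s + t) ≤ n)
    (hlt : ∀ p ∈ l, p.val < n - 2 * (s + t) ∨ n - 2 * s ≤ p.val) :
    ∃ L, L.length = t ∧ (l ++ pts L).Nodup ∧
      (∀ p ∈ pts L, n - 2 * (s + t) ≤ p.val ∧ p.val < n - 2 * s) ∧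
      X * f2B n (s + t) = ↑((brauerData n hn).d ^ t) * (Y * (brauerData n hn).prod L) := by
  set B := brauerData n hn
  induction t with
  | zero => exact ⟨[], by simp [hXY, hl]⟩
  | succ t ih =>
    obtain ⟨L, hLt, hL, hp, h⟩ := ih (by omega) fun p hp => (hlt p hp).imp_left (by omega)
    obtain ⟨k, rfl⟩ : ∃ k, n = k + 2 * (s + t) + 2 := ⟨n - 2 * (s + t) - 2, by omega⟩
    have hk : k + 2 * (s + t) + 2 - 1 - 2 * (s + t) = k + 1 := by omega
    set a : Fin (k + 2 * (s + t) + 2) := ⟨k, by omega⟩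
    set b : Fin (k + 2 * (s + t) + 2) := ⟨k + 1, by omega⟩
    have hp' : ∀ p ∈ pts ((a, b) :: L), k ≤ p.val ∧ p.val < k + 2 * t + 2 := by
      simp only [pts_cons, List.mem_cons]
      rintro p (rfl | rfl | h)
      · change k ≤ k ∧ k < _; omega
      · change k ≤ k + 1 ∧ k + 1 < _; omega
      · have := hp p h; omega
    have hL' : (pts ((a, b) :: L)).Nodup := by
      simp only [pts_cons, List.nodup_cons, List.mem_cons, not_or]
      refine ⟨⟨by simp [a, b], fun h => ?_⟩, fun h => ?_, hL.of_append_right⟩ 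
      · have : _ ≤ k := (hp _ h).1
        omega
      · have : _ ≤ k + 1 := (hp _ h).1
        omega
    have hlL : (l ++ pts ((a, b) :: L)).Nodup := by
      refine List.nodup_append'.2 ⟨hl, hL', fun p h h' => ?_⟩
      have := hp' p h'
      have := hlt p h
      omega
    refine ⟨(a, b) :: L, by simp [hLt], hlL, fun p h => ?_, ?_⟩
    · have := hp' p h; omega
    · rw [← add_assoc, f2B, hk, ← mul_assoc, h, eb_succ hn (k := k) (by omega),
        es_succ hn (k := k) (by omega), mul_assoc,
        mul_prod_mul_P_mul_S_mul_P_mul_S hL' (hY _ hlL _), ← mul_assoc, pow_succ, Units.val_mul]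


theorem FsetB.f1 {t : ℕ} (h : 2 * t ≤ n) : f1B n t ∈ FsetB n :=
  .inl (.inl (.inl (.inl (.inl ⟨t, h, rfl⟩))))

theorem FsetB.f2 {t : ℕ} (h : 2 * (t + 1) ≤ n) : f2B n (t + 1) ∈ FsetB n :=
  .inl (.inl (.inl (.inl (.inr ⟨t + 1, by omega, h, rfl⟩))))

theorem FsetB.f3 {t : ℕ} (h : 2 * t + 1 ≤ n) : eb n 0 * f2B n t ∈ FsetB n :=
  .inl (.inl (.inl (.inr ⟨t + 1, by omega, by omega, rfl⟩)))

theorem FsetB.f4 {t : ℕ} (h : 2 * (t + 1) + 1 ≤ n) : gB n * f2B n t ∈ FsetB n :=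
  .inl (.inl (.inr ⟨t + 1, by omega, h, rfl⟩))

theorem FsetB.f5 {t : ℕ} (h : 2 * (t + 1) ≤ n) : eb n 0 * eb n 1 * f2B n t ∈ FsetB n :=
  .inl (.inr ⟨t + 1, by omega, h, rfl⟩)

theorem FsetB.f6 {t : ℕ} (h : 2 * (t + 1) ≤ n) : eb n 1 * eb n 0 * f2B n t ∈ FsetB n :=
  .inr ⟨t + 1, by omega, h, rfl⟩

theorem reduces_of_conj {x X Y : BrauerB n} {u v : (BrauerB n)ˣ} {t : ℕ}
    (hu : u ∈ (brauerData n hn).W) (hv : v ∈ (brauerData n hn).W)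
    (hX : X = ↑((brauerData n hn).d ^ t) * Y) (hXF : X ∈ FsetB n) (hx : ↑u * x = Y * ↑v) :
    (brauerData n hn).Reduces (FsetB n) x :=
  Reduces.of_mul_eq (.of_mul_mem (pow_mem (d_mem_W _) t) (by rwa [← hX])) hu hv hx

theorem reduces_of_core {x : BrauerB n} (hx : (brauerData n hn).Core x) :
    (brauerData n hn).Reduces (FsetB n) x := by
  set B := brauerData n hn
  have h01 : B.pt 0 ≠ B.pt 1 := B.pt_zero_ne_one
  cases hx with
  | @prod L h =>
    have hle := length_add_two_mul_length_le (l := []) h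
    rw [List.length_nil, zero_add] at hle
    obtain ⟨L', hL, h', -, hf⟩ := exists_f1B_eq_prod hn L.length hle
    obtain ⟨u, σ, hu, -, hL⟩ := B.exists_lifts_mul_prod (l := []) (l' := []) h h' rfl hL.symm
    exact reduces_of_conj hn (t := 0) hu.mem hu.mem (by simpa using hf) (.f1 hle) hL
  | @E a L h =>
    have hle := length_add_two_mul_length_le (l := [a]) h
    simp only [List.length_singleton] at hle
    obtain ⟨L', hL, h', -, hf⟩ := exists_mul_f2B_eq hn (X := eb n 0) (s := 0) (l := [B.pt 0])
      (mul_one _) (fun M hM x => E_prod_mul_S (B := B) hM x) (by simp) L.length (by omega)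
      (by simp [pt]; omega)
    obtain ⟨u, σ, hu, hl, hL⟩ := B.exists_lifts_mul_prod (l := [a]) (l' := [B.pt 0]) h h' rfl hL.symm
    simp only [List.map_cons, List.map_nil, List.cons.injEq, and_true] at hl
    rw [zero_add] at hf
    refine reduces_of_conj hn hu.mem hu.mem hf (.f3 (by omega)) ?_
    rw [← mul_assoc, hu.mul_E, mul_assoc, hL, hl, mul_assoc]
    rfl
  | @EP a b L h =>
    have hab : a ≠ b := by rintro rfl; simp at h
    have hle := length_add_two_mul_length_le (l := [a, b]) h
    simp only [List.length_cons, List.length_nil] at hle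
    obtain ⟨L', hL, h', -, hf⟩ := exists_mul_f2B_eq hn (X := eb n 0 * eb n 1) (s := 0)
      (l := [B.pt 0, B.pt 1]) (mul_one _) (fun M hM x => EP_prod_mul_S (B := B) hM x) (by simpa)
      L.length (by omega) (by simp [pt]; omega)
    obtain ⟨u, σ, hu, hl, hL⟩ := B.exists_lifts_mul_prod (l := [a, b]) (l' := [B.pt 0, B.pt 1])
      h h' rfl hL.symm
    simp only [List.map_cons, List.map_nil, List.cons.injEq, and_true] at hl
    rw [zero_add] at hf
    refine reduces_of_conj hn hu.mem hu.mem hf (.f5 (by omega)) ?_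
    rw [← mul_assoc, ← mul_assoc, hu.mul_E, mul_assoc (B.E _), hu.mul_P hab, mul_assoc, mul_assoc,
      hL, hl.1, hl.2]
    simp only [← mul_assoc]
    rfl
  | @PE a b L h =>
    have hab : a ≠ b := by rintro rfl; simp at h
    have hle := length_add_two_mul_length_le (l := [a, b]) h
    simp only [List.length_cons, List.length_nil] at hle
    obtain ⟨L', hL, h', -, hf⟩ := exists_mul_f2B_eq hn (X := eb n 1 * eb n 0) (s := 0)
      (l := [B.pt 0, B.pt 1]) (mul_one _)
      (fun M hM x => by
        rw [mul_assoc (eb n 1), mul_assoc (eb n 1)]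
        exact congrArg _ (E_prod_mul_S (B := B) (a := B.pt 0) (hM.sublist (by simp)) x)) (by simpa)
      L.length (by omega) (by simp [pt]; omega)
    obtain ⟨u, σ, hu, hl, hL⟩ := B.exists_lifts_mul_prod (l := [a, b]) (l' := [B.pt 0, B.pt 1])
      h h' rfl hL.symm
    simp only [List.map_cons, List.map_nil, List.cons.injEq, and_true] at hl
    rw [zero_add] at hf
    refine reduces_of_conj hn hu.mem hu.mem hf (.f6 (by omega)) ?_
    rw [← mul_assoc, ← mul_assoc, hu.mul_P hab, mul_assoc (B.P _ _), hu.mul_E, mul_assoc, mul_assoc,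
      hL, hl.1, hl.2]
    simp only [← mul_assoc]
    rfl
  | @PEP a b L h =>
    have hab : a ≠ b := by rintro rfl; simp at h
    have hle := length_add_two_mul_length_le (l := [a, b]) h
    simp only [List.length_cons, List.length_nil] at hle
    obtain ⟨k, rfl⟩ : ∃ k, n = k + 2 := ⟨n - 2, by omega⟩
    set p : Fin (k + 2) := ⟨k, by omega⟩
    set q : Fin (k + 2) := ⟨k + 1, by omega⟩
    have hpq : p ≠ q := by simp [p, q]
    have hXY : 1 * f2B (k + 2) 1 = B.P p q * (B.E p * B.P p q) := by
      rw [f2B, f2B, one_mul, one_mul]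
      change eb _ (k + 1) * es _ (k + 1) = _
      rw [eb_succ hn (k := k) (by omega), es_succ hn (k := k) (by omega), ← mul_assoc, ← mul_assoc,
        P_mul_S_mul_P _ hpq, mul_assoc, mul_assoc, ← mul_assoc (BrauerData.E _ _),
        E_mul_P_mul_S _ hpq]
    obtain ⟨L', hL, h', -, hf⟩ := exists_mul_f2B_eq hn (l := [p, q]) hXY
      (fun M hM x => by
        change B.P p q * (B.E p * B.P p q) * B.prod M * ↑(B.S x) =
          B.P p q * (B.E p * B.P p q) * B.prod M
        rw [mul_assoc (B.P p q) _ (B.prod M), mul_assoc (B.P p q), EP_prod_mul_S hM]) (by simpa)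
      L.length (by omega) (by simp [p, q])
    obtain ⟨u, σ, hu, hl, hL⟩ := B.exists_lifts_mul_prod (l := [a, b]) (l' := [p, q])
      h h' rfl hL.symm
    simp only [List.map_cons, List.map_nil, List.cons.injEq, and_true] at hl
    rw [add_comm 1, one_mul] at hf
    refine reduces_of_conj hn hu.mem hu.mem hf (.f2 (by omega)) ?_
    rw [← mul_assoc, hu.mul_P hab, mul_assoc (B.P _ _), ← mul_assoc (u : BrauerB (k + 2)),
      ← mul_assoc (u : BrauerB (k + 2)), hu.mul_E, mul_assoc (B.E _), hu.mul_P hab, mul_assoc, mul_assoc,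
      hL, hl.1, hl.2]
    simp only [mul_assoc]
    rfl
  | @PEP' a b c L h =>
    have hab : a ≠ b := by rintro rfl; simp at h
    have hac : a ≠ c := by rintro rfl; simp at h
    have hle := length_add_two_mul_length_le (l := [a, b, c]) h
    simp only [List.length_cons, List.length_nil] at hle
    obtain ⟨t, ht, h012⟩ := B.exists_cycle h01 (c := B.pt 2) (by simp [B.pt_injective.eq_iff])
      (by simp [B.pt_injective.eq_iff])
    obtain ⟨Z, hZ⟩ : ∃ Z, Z = B.P (B.pt 1) (B.pt 2) * (B.E (B.pt 1) * B.P (B.pt 1) (B.pt 0)) :=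
      ⟨_, rfl⟩
    have hXY : gB n * f2B n 0 = Z * ↑t := by
      rw [hZ, mul_assoc, mul_assoc, B.P_comm (B.pt 1) (B.pt 0), ← h012, f2B, mul_one, E_one,
        P_zero_one, P_one_two, mul_assoc (_ * _), ← mul_assoc (B.R 1 : BrauerB n),
        B.R_mul_e 1 (by omega)]
      simp only [← mul_assoc]
      rfl
    have hcomm {M : List (Fin n × Fin n)} (hM : ([B.pt 1, B.pt 0, B.pt 2] ++ pts M).Nodup) :
        ↑t * B.prod M = B.prod M * ↑t := by
      refine ht.commute_prod hM.of_append_right fun a ha => ?_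
      have h : ∀ p ∈ [B.pt 1, B.pt 0, B.pt 2], a ≠ p := fun p hp hap =>
        List.disjoint_of_nodup_append hM hp (hap ▸ ha)
      simp only [List.mem_cons, forall_eq_or_imp, List.not_mem_nil, false_imp_iff,
        implies_true, and_true] at h
      rw [Perm.mul_apply, swap_apply_of_ne_of_ne h.2.1 h.1, swap_apply_of_ne_of_ne h.1 h.2.2]
    obtain ⟨L', hL, h', -, hf⟩ := exists_mul_f2B_eq hn (l := [B.pt 1, B.pt 0, B.pt 2]) hXY
      (fun M hM x => by
        have h1 : Z * ↑t * B.prod M = Z * B.prod M * ↑t := by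
          rw [mul_assoc, hcomm hM, mul_assoc]
        have h2 := congrArg Units.val (ht.mul_S x)
        rw [Units.val_mul, Units.val_mul] at h2
        have hM' : (B.pt 1 :: B.pt 0 :: pts M).Nodup := hM.sublist (by simp)
        have h3 (y) : Z * B.prod M * ↑(B.S y) = Z * B.prod M := by
          rw [hZ, mul_assoc _ _ (B.prod M), mul_assoc (B.P _ _), EP_prod_mul_S hM']
        change Z * ↑t * B.prod M * ↑(B.S x) = Z * ↑t * B.prod M
        rw [h1, mul_assoc, h2, ← mul_assoc, h3])
      (by simp [B.pt_injective.eq_iff]) L.length (by omega) (by simp [pt]; omega)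
    obtain ⟨u, σ, hu, hl, hL⟩ := B.exists_lifts_mul_prod (l := [a, b, c])
      (l' := [B.pt 1, B.pt 0, B.pt 2]) h h' rfl hL.symm
    simp only [List.map_cons, List.map_nil, List.cons.injEq, and_true] at hl
    rw [zero_add] at hf
    refine reduces_of_conj hn hu.mem (mul_mem (inv_mem ht.mem) hu.mem) hf (.f4 (by omega)) ?_
    rw [mul_assoc Z, hcomm h', Units.val_mul, ← mul_assoc Z, mul_assoc _ (t : BrauerB n),
      Units.mul_inv_cancel_left, ← mul_assoc, hu.mul_P hac, mul_assoc (B.P _ _),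
      ← mul_assoc (u : BrauerB n), ← mul_assoc (u : BrauerB n), hu.mul_E, mul_assoc (B.E _),
      hu.mul_P hab, mul_assoc, mul_assoc, hL, hl.1, hl.2.1, hl.2.2, hZ]
    simp only [mul_assoc]

end

section

open BrauerData LaurentPolynomial

variable {n : ℕ} (hn : 3 ≤ n)

theorem algebraMap_T_mul_mul_algebraMap_T_mul (k l : ℤ) (x y : BrauerB n) :
    algebraMap Lp (BrauerB n) (T k) * x * (algebraMap Lp (BrauerB n) (T l) * y) =
      algebraMap Lp (BrauerB n) (T (k + l)) * (x * y) := by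
  rw [T_add, map_mul, mul_assoc, mul_assoc, ← mul_assoc x, ← Algebra.commutes, mul_assoc]

theorem exists_eq_algebraMap_T_mul {w : (BrauerB n)ˣ} (hw : w ∈ (brauerData n hn).W) :
    ∃ k : ℤ, ∃ m ∈ WmonB n, (w : BrauerB n) = algebraMap Lp (BrauerB n) (T k) * m := by
  induction hw using Subgroup.closure_induction'' with
  | mem x hx =>
    obtain rfl | ⟨i, hi, rfl⟩ := hx
    · exact ⟨1, 1, one_mem _, (mul_one _).symm⟩
    · exact ⟨0, rb n i, Submonoid.subset_closure ⟨i, hi, rfl⟩, by simp; rfl⟩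
  | inv_mem x hx =>
    obtain rfl | ⟨i, hi, rfl⟩ := hx
    · exact ⟨-1, 1, one_mem _, (mul_one _).symm⟩
    · exact ⟨0, rb n i, Submonoid.subset_closure ⟨i, hi, rfl⟩, by rw [R_inv]; simp; rfl⟩
  | one => exact ⟨0, 1, one_mem _, by simp⟩
  | mul x y _ _ hx hy =>
    obtain ⟨k, m, hm, hx⟩ := hx
    obtain ⟨l, m', hm', hy⟩ := hy
    exact ⟨k + l, m * m', mul_mem hm hm',
      by rw [Units.val_mul, hx, hy, algebraMap_T_mul_mul_algebraMap_T_mul]⟩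

theorem good_of_mem_BrMB {x : BrauerB n} (hx : x ∈ BrMB n) : (brauerData n hn).Good x := by
  induction hx using Submonoid.closure_induction_right with
  | one => exact (Core.prod (B := brauerData n hn) (L := []) (by simp)).good
  | mul_right x _ y hy h =>
    obtain ((rfl | rfl) | ⟨i, hi, rfl⟩) | ⟨i, hi, rfl⟩ := hy
    · exact h.mul_unit (d_mem_W _)
    · exact h.mul_unit (inv_mem (d_mem_W _))
    · exact h.mul_unit (R_mem_W _ hi)
    · exact h.mul_e hi

theorem reduces_of_mem_BrMB {x : BrauerB n} (hx : x ∈ BrMB n) :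
    (brauerData n hn).Reduces (FsetB n) x := by
  obtain ⟨u, hu, v, hv, f, hf, rfl⟩ := good_of_mem_BrMB hn hx
  exact (reduces_of_core hn hf).of_mul_eq (inv_mem hu) hv (by simp [mul_assoc])

end

/-- Every element of the Brauer monoid `BrM(B_n)` can be written as `δ^k · u·f·v` with
`k ∈ ℤ`, `u, v` in the submonoid generated by `r_0, …, r_{n-1}`, and `f ∈ F`. -/
theorem statement_14 (n : ℕ) (hn : 3 ≤ n) :
    ∀ x ∈ BrMB n, ∃ (k : ℤ) (u v f : BrauerB n),
      u ∈ WmonB n ∧ v ∈ WmonB n ∧ f ∈ FsetB n ∧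
      x = algebraMap Lp (BrauerB n) (LaurentPolynomial.T k) * (u * f * v) := by
  intro x hx
  obtain ⟨u, hu, v, hv, f, hf, rfl⟩ := reduces_of_mem_BrMB hn hx
  obtain ⟨k, a, ha, hu⟩ := exists_eq_algebraMap_T_mul hn hu
  obtain ⟨l, b, hb, hv⟩ := exists_eq_algebraMap_T_mul hn hv
  refine ⟨k + l, a, b, f, ha, hb, hf, ?_⟩
  rw [hu, hv, mul_assoc (algebraMap _ _ _), algebraMap_T_mul_mul_algebraMap_T_mul]
end
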